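/- arXiv:math/0611708 — 3 statements merged into one kernel-verified Lean document; each statement's English description precedes it below -/
import Mathlib

section
/- Let r ≥ 1 and for each ν ∈ {1,…,r} and n ∈ ℕ let A^{(ν,n)} be a complex n×n matrix. Assume that for all μ,ν ∈ {1,…,r} the limit c_{μν} := lim_{n→∞} (1/(2n))·Re Tr(A^{(μ,n)}(A^{(ν,n)})*) exists, and that c_{νν} > 0 for each ν. Let g^{(n)} be a Haar-distributed random element of U(n). Then, as n → ∞, the random vector (Re Tr(A^{(1,n)}g^{(n)}), …, Re Tr(A^{(r,n)}g^{(n)})) converges in distribution to the centered Gaussian distribution on ℝ^r with covariance matrix (c_{μν}). -/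
open MeasureTheory ProbabilityTheory Matrix Filter Topology

/-- Matrices inherit the (Borel) product measurable structure. -/
instance matrixMeasurableSpace {m n α : Type*} [MeasurableSpace α] :
    MeasurableSpace (Matrix m n α) :=
  inferInstanceAs (MeasurableSpace (m → n → α))

/-- `γ` is the Gaussian distribution on `ℝ^r` with mean vector `m` and covariance
matrix `C`, characterized via its one-dimensional linear projections (Cramér–Wold). -/
def IsGaussianMeasure {r : ℕ} (γ : Measure (Fin r → ℝ)) (m : Fin r → ℝ)
    (C : Matrix (Fin r) (Fin r) ℝ) : Prop :=
  IsProbabilityMeasure γ ∧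
    ∀ t : Fin r → ℝ,
      γ.map (fun x => ∑ i, t i * x i) =
        gaussianReal (∑ i, t i * m i)
          (Real.toNNReal (∑ i, ∑ j, t i * C i j * t j))

namespace BorelU

section Framework

open scoped Matrix.Norms.Operator

open Complex

/-- Square complex matrices. -/
abbrev M (n : ℕ) := Matrix (Fin n) (Fin n) ℂ

/-- The unitary group. -/
abbrev U (n : ℕ) := Matrix.unitaryGroup (Fin n) ℂ

instance borelM (n : ℕ) : BorelSpace (M n) :=
  inferInstanceAs (BorelSpace (Fin n → Fin n → ℂ))

instance compactU (n : ℕ) : CompactSpace (U n) := by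
  refine (isCompact_iff_compactSpace (s := ((Matrix.unitaryGroup (Fin n) ℂ : Submonoid (M n)) : Set (M n)))).mp ?_
  have h1 : IsCompact (Set.univ.pi fun _ : Fin n => Set.univ.pi fun _ : Fin n =>
      Metric.closedBall (0 : ℂ) 1) :=
    isCompact_univ_pi fun _ => isCompact_univ_pi fun _ => isCompact_closedBall _ _
  have h2 : IsClosed ((Matrix.unitaryGroup (Fin n) ℂ : Submonoid (M n)) : Set (M n)) := by
    have : ((Matrix.unitaryGroup (Fin n) ℂ : Submonoid (M n)) : Set (M n))
        = {g : M n | g * star g = 1} := by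
      ext g
      exact Matrix.mem_unitaryGroup_iff
    rw [this]
    exact isClosed_eq (by fun_prop) continuous_const
  refine IsCompact.of_isClosed_subset (X := M n) h1 h2 ?_
  intro g hg
  exact fun i _ j _ => mem_closedBall_zero_iff.mpr (entry_norm_bound_of_unitary hg i j)

instance contStarM (n : ℕ) : @ContinuousStar (M n)
    (inferInstance : PseudoMetricSpace (M n)).toUniformSpace.toTopologicalSpace _ :=
  ⟨continuous_id.matrix_conjTranspose⟩

/-- one-parameter group -/
noncomputable def ex {n : ℕ} (X : selfAdjoint (M n)) (t : ℝ) : U n :=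
  selfAdjoint.expUnitary (t • X)

lemma ex_zero {n : ℕ} (X : selfAdjoint (M n)) : ex X 0 = 1 := by
  simp [ex]

lemma ex_add {n : ℕ} (X : selfAdjoint (M n)) (s t : ℝ) : ex X (s + t) = ex X s * ex X t := by
  unfold ex
  rw [add_smul]
  apply Commute.expUnitary_add
  simp only [selfAdjoint.val_smul]
  exact ((Commute.refl (X : M n)).smul_left s).smul_right t

lemma ex_coe {n : ℕ} (X : selfAdjoint (M n)) (t : ℝ) :
    ((ex X t : U n) : M n) = NormedSpace.exp (t • (I • (X : M n))) := by
  unfold ex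
  rw [selfAdjoint.expUnitary_coe]
  congr 1
  simp only [selfAdjoint.val_smul]
  rw [smul_comm]

lemma ex_deriv {n : ℕ} (X : selfAdjoint (M n)) :
    HasDerivAt (fun t : ℝ => ((ex X t : U n) : M n)) (I • (X : M n)) 0 := by
  have h := hasDerivAt_exp_smul_const (𝕂 := ℝ) (I • (X : M n)) (0 : ℝ)
  simp only [zero_smul, NormedSpace.exp_zero, one_mul] at h
  refine h.congr_of_eventuallyEq (Eventually.of_forall fun t => ex_coe X t)

/-- `F` is a smooth function on `U(n)` whose derivative in (complexified) direction
`Z` at `g` is `D Z g`. -/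
structure Good {n : ℕ} {E : Type*} [NormedAddCommGroup E] [NormedSpace ℝ E] [NormedSpace ℂ E]
    (F : U n → E) (D : M n → U n → E) : Prop where
  cont : Continuous F
  contD : ∀ Z, Continuous (D Z)
  add : ∀ Z W g, D (Z + W) g = D Z g + D W g
  smul : ∀ (a : ℂ) Z g, D (a • Z) g = a • D Z g
  deriv : ∀ (X : selfAdjoint (M n)) (g : U n),
    HasDerivAt (fun t : ℝ => F (ex X t * g)) (D (I • (X : M n)) g) 0

lemma contU {n : ℕ} : Continuous (fun g : U n => (g : M n)) := continuous_subtype_val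

lemma contUs {n : ℕ} : Continuous (fun g : U n => (g : M n)ᴴ) :=
  contU.matrix_conjTranspose

lemma Good.const {n : ℕ} {E : Type*} [NormedAddCommGroup E] [NormedSpace ℝ E] [NormedSpace ℂ E]
    (c : E) : Good (n := n) (fun _ => c) (fun _ _ => 0) where
  cont := continuous_const
  contD _ := continuous_const
  add := by simp
  smul := by simp
  deriv X g := hasDerivAt_const _ _

lemma Good.id {n : ℕ} : Good (n := n) (fun g => (g : M n)) (fun Z g => Z * g) where
  cont := contU
  contD Z := continuous_const.matrix_mul contU
  add := by simp [add_mul]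
  smul := by simp
  deriv X g := by
    simpa using (ex_deriv X).mul_const (g : M n)

lemma ex_deriv_star {n : ℕ} (X : selfAdjoint (M n)) :
    HasDerivAt (fun t : ℝ => ((ex X t : U n) : M n)ᴴ) (-(I • (X : M n))) 0 := by
  have h := hasDerivAt_exp_smul_const (𝕂 := ℝ) (-(I • (X : M n))) (0 : ℝ)
  simp only [zero_smul, NormedSpace.exp_zero, one_mul] at h
  refine h.congr_of_eventuallyEq (Eventually.of_forall fun t => ?_)
  have hX : (X : M n)ᴴ = X := X.2
  simp only [ex_coe]
  rw [← Matrix.exp_conjTranspose]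
  congr 1
  simp [hX, Matrix.conjTranspose_smul]

lemma Good.star {n : ℕ} : Good (n := n) (fun g => (g : M n)ᴴ) (fun Z g => -((g : M n)ᴴ * Z)) where
  cont := contUs
  contD Z := (contUs.matrix_mul continuous_const).neg
  add := by intros; simp [mul_add]; abel
  smul := by simp
  deriv X g := by
    simpa [Matrix.conjTranspose_mul] using (ex_deriv_star X).const_mul ((g : M n)ᴴ)

lemma Good.mulM {n : ℕ} {F G : U n → M n} {D D' : M n → U n → M n} (h : Good F D)
    (h' : Good G D') :
    Good (fun g => F g * G g) (fun Z g => D Z g * G g + F g * D' Z g) where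
  cont := h.cont.matrix_mul h'.cont
  contD Z := ((h.contD Z).matrix_mul h'.cont).add (h.cont.matrix_mul (h'.contD Z))
  add Z W g := by rw [h.add, h'.add]; noncomm_ring
  smul a Z g := by rw [h.smul, h'.smul]; simp
  deriv X g := by
    have := (h.deriv X g).mul (h'.deriv X g)
    simp only [ex_zero, one_mul] at this
    exact this

lemma Good.mul {n : ℕ} {F G : U n → ℂ} {D D' : M n → U n → ℂ} (h : Good F D)
    (h' : Good G D') :
    Good (fun g => F g * G g) (fun Z g => D Z g * G g + F g * D' Z g) where
  cont := h.cont.mul h'.cont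
  contD Z := ((h.contD Z).mul h'.cont).add (h.cont.mul (h'.contD Z))
  add Z W g := by rw [h.add, h'.add]; ring
  smul a Z g := by rw [h.smul, h'.smul]; simp only [smul_eq_mul]; ring
  deriv X g := by
    have := (h.deriv X g).mul (h'.deriv X g)
    simp only [ex_zero, one_mul] at this
    exact this

lemma Good.addF {n : ℕ} {F G : U n → ℂ} {D D' : M n → U n → ℂ} (h : Good F D)
    (h' : Good G D') :
    Good (fun g => F g + G g) (fun Z g => D Z g + D' Z g) where
  cont := h.cont.add h'.cont
  contD Z := (h.contD Z).add (h'.contD Z)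
  add Z W g := by rw [h.add, h'.add]; ring
  smul a Z g := by rw [h.smul, h'.smul]; simp only [smul_eq_mul]; ring
  deriv X g := by
    exact (h.deriv X g).add (h'.deriv X g)

lemma Good.cexp {n : ℕ} {F : U n → ℂ} {D : M n → U n → ℂ} (h : Good F D) :
    Good (fun g => Complex.exp (F g)) (fun Z g => Complex.exp (F g) * D Z g) where
  cont := Complex.continuous_exp.comp h.cont
  contD Z := (Complex.continuous_exp.comp h.cont).mul (h.contD Z)
  add Z W g := by rw [h.add]; ring
  smul a Z g := by rw [h.smul]; simp only [smul_eq_mul]; ring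
  deriv X g := by
    simpa [ex_zero] using (h.deriv X g).cexp

lemma Good.trace {n : ℕ} {F : U n → M n} {D : M n → U n → M n} (h : Good F D) :
    Good (fun g => (F g).trace) (fun Z g => (D Z g).trace) where
  cont := h.cont.matrix_trace
  contD Z := (h.contD Z).matrix_trace
  add Z W g := by rw [h.add, Matrix.trace_add]
  smul a Z g := by rw [h.smul, Matrix.trace_smul]
  deriv X g := 
    (LinearMap.toContinuousLinearMap
      (Matrix.traceLinearMap (Fin n) ℝ ℂ)).hasFDerivAt.comp_hasDerivAt 0 (h.deriv X g)

lemma Good.entry {n : ℕ} {F : U n → M n} {D : M n → U n → M n} (h : Good F D) (i j : Fin n) :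
    Good (fun g => F g i j) (fun Z g => D Z g i j) where
  cont := h.cont.matrix_elem i j
  contD Z := (h.contD Z).matrix_elem i j
  add Z W g := by rw [h.add, Matrix.add_apply]
  smul a Z g := by rw [h.smul, Matrix.smul_apply]
  deriv X g := 
    (LinearMap.toContinuousLinearMap
      (Matrix.entryLinearMap ℝ ℂ i j)).hasFDerivAt.comp_hasDerivAt 0 (h.deriv X g)

lemma integrable_cont {n : ℕ} {E : Type*} [NormedAddCommGroup E] [SecondCountableTopology E]
    (μ : Measure (U n)) [IsProbabilityMeasure μ]
    {f : U n → E} (hf : Continuous f) : Integrable f μ := by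
  exact hf.integrable_of_hasCompactSupport (HasCompactSupport.of_compactSpace f)

variable {n : ℕ} (μ : Measure (U n)) [IsProbabilityMeasure μ] [μ.IsMulLeftInvariant]

lemma sd_self {F : U n → ℂ} {D : M n → U n → ℂ} (h : Good F D) (X : selfAdjoint (M n)) :
    ∫ g, D (I • (X : M n)) g ∂μ = 0 := by
  have hd : ∀ (t : ℝ) (g : U n),
      HasDerivAt (fun t : ℝ => F (ex X t * g)) (D (I • (X : M n)) (ex X t * g)) t := by
    intro t g
    have h1 := h.deriv X (ex X t * g)
    have h2 : HasDerivAt (fun s : ℝ => s - t) 1 t := (hasDerivAt_id t).sub_const t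
    have h3 := HasDerivAt.scomp (h := fun s : ℝ => s - t) (h' := 1) t
      (by simpa using h1) h2
    simp only [one_smul] at h3
    refine h3.congr_of_eventuallyEq (Eventually.of_forall fun s => ?_)
    simp only [Function.comp]
    rw [← mul_assoc, ← ex_add]
    simp
  obtain ⟨C, hC⟩ : ∃ C, ∀ g, ‖D (I • (X : M n)) g‖ ≤ C := by
    obtain ⟨C, hC⟩ := (isCompact_range (h.contD (I • (X : M n)))).isBounded.exists_norm_le
    exact ⟨C, fun g => hC _ ⟨g, rfl⟩⟩
  have cm : ∀ t, Continuous fun g => ex X t * g := fun t => continuous_const.mul continuous_id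
  have key := hasDerivAt_integral_of_dominated_loc_of_deriv_le (μ := μ) (s := Set.univ)
    (F := fun (t : ℝ) g => F (ex X t * g)) (x₀ := (0 : ℝ)) (bound := fun _ => C)
    (F' := fun (t : ℝ) g => D (I • (X : M n)) (ex X t * g)) univ_mem
    (Eventually.of_forall fun t => (h.cont.comp (cm t)).aestronglyMeasurable)
    (integrable_cont μ (h.cont.comp (cm 0)))
    ((h.contD _).comp (cm 0)).aestronglyMeasurable
    (Eventually.of_forall fun g t _ => hC _) (integrable_const _)
    (Eventually.of_forall fun g t _ => hd t g)
  have h1 := key.2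
  have h2 : (fun t : ℝ => ∫ g, F (ex X t * g) ∂μ) = fun t => ∫ g, F g ∂μ := by
    funext t
    exact integral_mul_left_eq_self F (ex X t)
  rw [h2] at h1
  have h3 := h1.unique (hasDerivAt_const _ _)
  simpa [ex_zero] using h3

lemma sd {F : U n → ℂ} {D : M n → U n → ℂ} (h : Good F D) (Z : M n) :
    ∫ g, D Z g ∂μ = 0 := by
  have h1 := sd_self μ h (realPart Z)
  have h2 := sd_self μ h (imaginaryPart Z)
  have e : Z = (-I) • (I • ((realPart Z : selfAdjoint (M n)) : M n))
      + (1 : ℂ) • (I • ((imaginaryPart Z : selfAdjoint (M n)) : M n)) := by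
    conv_lhs => rw [← realPart_add_I_smul_imaginaryPart Z]
    simp [smul_smul]
  have : ∀ g, D Z g = (-I) * D (I • ((realPart Z : selfAdjoint (M n)) : M n)) g
      + D (I • ((imaginaryPart Z : selfAdjoint (M n)) : M n)) g := by
    intro g
    conv_lhs => rw [e]
    rw [h.add, h.smul, h.smul]
    simp
  simp_rw [this]
  rw [integral_add, integral_const_mul, h1, h2]
  · simp
  · exact (integrable_cont μ (h.contD _)).const_mul _
  · exact integrable_cont μ (h.contD _)

/-- Master Schwinger-Dyson identity. -/
lemma master {F : U n → M n} {D : M n → U n → M n} (h : Good F D)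
    {S : U n → ℂ} {D' : M n → U n → ℂ} (h' : Good S D') :
    ∫ g, ∑ i, ∑ j, (D (Matrix.single i j 1) g i j * S g
      + F g i j * D' (Matrix.single i j 1) g) ∂μ = 0 := by
  rw [integral_finsetSum]
  · refine Finset.sum_eq_zero fun i _ => ?_
    rw [integral_finsetSum]
    · refine Finset.sum_eq_zero fun j _ => ?_
      exact sd μ ((h.entry i j).mul h') _
    · intro j _
      exact integrable_cont μ (((h.entry i j).mul h').contD _)
  · intro i _
    refine integrable_cont μ ?_
    exact continuous_finsetSum _ fun j _ => (((h.entry i j).mul h').contD _)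

lemma sum_single_left (A : M n) : ∑ i, ∑ j, (Matrix.single i j (1 : ℂ) * A : M n) i j = n * A.trace := by
  simp [Matrix.trace]

lemma sum_single_mid (A B : M n) :
    ∑ i, ∑ j, (A * Matrix.single i j (1 : ℂ) * B : M n) i j = A.trace * B.trace := by
  simp [Matrix.trace, Matrix.mul_apply, Matrix.single_apply, Finset.sum_mul_sum, ite_and]

lemma sum_single_right (A B : M n) :
    ∑ i, ∑ j, A i j * (Matrix.single i j (1 : ℂ) * B).trace = (A * B).trace := by
  simp [Matrix.trace, Matrix.mul_apply, Matrix.single_apply, ite_and]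

lemma master' {F : U n → M n} {D : M n → U n → M n} (h : Good F D)
    {S : U n → ℂ} {D' : M n → U n → ℂ} (h' : Good S D') (A P Q R : U n → M n)
    (hD : ∀ Z g, D Z g = Z * A g + P g * Z * Q g)
    (hD' : ∀ Z g, D' Z g = (Z * R g).trace) :
    ∫ g, ((n * (A g).trace + (P g).trace * (Q g).trace) * S g + (F g * R g).trace) ∂μ = 0 := by
  rw [← master μ h h']
  congr 1
  funext g
  simp only [hD, hD', Finset.sum_add_distrib, sum_single_right, ← Finset.sum_mul,
    Matrix.add_apply, sum_single_left, sum_single_mid]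

end Framework

section Moments

open scoped Matrix.Norms.Operator

open Complex

variable {n : ℕ} (μ : Measure (U n)) [IsProbabilityMeasure μ] [μ.IsMulLeftInvariant]

lemma gsg (g : U n) : (g : M n)ᴴ * (g : M n) = 1 := by
  simpa [Matrix.star_eq_conjTranspose] using Matrix.UnitaryGroup.star_mul_self g

lemma ggs (g : U n) : (g : M n) * (g : M n)ᴴ = 1 :=
  mul_eq_one_comm.mp (gsg g)

lemma gsg' (g : U n) (A : M n) : (g : M n)ᴴ * ((g : M n) * A) = A := by
  rw [← mul_assoc, gsg, one_mul]

lemma ggs' (g : U n) (A : M n) : (g : M n) * ((g : M n)ᴴ * A) = A := by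
  rw [← mul_assoc, ggs, one_mul]

lemma trace_cyc (g : U n) (A : M n) : ((g : M n) * (A * (g : M n)ᴴ)).trace = A.trace := by
  rw [Matrix.trace_mul_comm, mul_assoc, gsg, mul_one]

/-- `g B` -/
lemma goodT (B : M n) : Good (fun g : U n => (g : M n) * B) (fun Z g => Z * (g * B)) := by
  have := Good.id.mulM (Good.const (n := n) B)
  simpa [mul_assoc] using this

/-- `C g*` -/
lemma goodTs (C : M n) : Good (fun g : U n => C * (g : M n)ᴴ) (fun Z g => - (C * (g : M n)ᴴ * Z)) := by
  have := (Good.const (n := n) C).mulM Good.star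
  simpa [mul_assoc] using this

lemma e_conj (A N : M n) :
    (n : ℂ) * ∫ g : U n, ((g : M n) * (A * ((g : M n)ᴴ * N))).trace ∂μ = A.trace * N.trace := by
  have h := ((goodT (n := n) A).mulM (Good.star.mulM (Good.const (n := n) N)))
  have := master' μ h (Good.const (1 : ℂ)) (fun g => (g : M n) * (A * ((g : M n)ᴴ * N)))
    (fun g => - ((g : M n) * (A * (g : M n)ᴴ))) (fun _ => N) (fun _ => 0)
    (by intro Z g; simp only [mul_zero, add_zero]; noncomm_ring) (by simp)
  simp only [Matrix.trace_neg, trace_cyc, mul_one, mul_zero, Matrix.trace_zero, add_zero] at this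
  rw [integral_add, integral_const_mul] at this
  · simp only [neg_mul, integral_const, probReal_univ, one_smul] at this
    linear_combination this
  · refine (integrable_cont μ ?_).const_mul _
    have := h.trace.cont
    simpa [mul_assoc] using this
  · exact integrable_const _

lemma e_two (B C : M n) :
    (n : ℂ) * ∫ g : U n, ((g : M n) * B).trace * (C * (g : M n)ᴴ).trace ∂μ = (B * C).trace := by
  have hS := (goodTs (n := n) C).trace
  have := master' μ (goodT (n := n) B) hS (fun g => (g : M n) * B)
    0 0 (fun g => -(C * (g : M n)ᴴ))
    (by intro Z g; simp) (by intro Z g; rw [← Matrix.trace_mul_comm]; simp)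
  simp only [Pi.zero_apply, Matrix.trace_zero, mul_zero, add_zero, mul_neg, Matrix.trace_neg,
    mul_assoc] at this
  have e : ∀ g : U n, ((g : M n) * (B * (C * (g : M n)ᴴ))).trace = (B * C).trace := by
    intro g; rw [← mul_assoc B, trace_cyc]
  simp only [e] at this
  rw [integral_add, integral_const_mul] at this
  · simp only [integral_const, probReal_univ, one_smul] at this
    linear_combination this
  · exact (integrable_cont μ ((goodT (n := n) B).trace.mul hS).cont).const_mul _
  · exact integrable_const _

/-- `g B g B` -/
lemma goodP (B : M n) : Good (fun g : U n => (g : M n) * B * (g * B))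
    (fun Z g => Z * (g * B * (g * B)) + (g * B) * Z * (g * B)) := by
  have := (goodT (n := n) B).mulM (goodT (n := n) B)
  simpa [mul_assoc] using this

lemma goodPs (C : M n) : Good (fun g : U n => (C * (g : M n)ᴴ * (C * (g : M n)ᴴ)).trace)
    (fun Z g => (Z * (-2 * (C * (g : M n)ᴴ * (C * (g : M n)ᴴ)))).trace) := by
  have := ((goodTs (n := n) C).mulM (goodTs (n := n) C)).trace
  convert this using 3 with Z g
  rw [Matrix.trace_add]
  have e1 : (-(C * (g : M n)ᴴ * Z) * (C * (g : M n)ᴴ)).trace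
      = - (Z * (C * (g : M n)ᴴ * (C * (g : M n)ᴴ))).trace := by
    rw [Matrix.trace_mul_comm]
    simp only [mul_neg, Matrix.trace_neg]
    rw [← mul_assoc, Matrix.trace_mul_comm]
  have e2 : (C * (g : M n)ᴴ * -(C * (g : M n)ᴴ * Z)).trace
      = - (Z * (C * (g : M n)ᴴ * (C * (g : M n)ᴴ))).trace := by
    simp only [mul_neg, Matrix.trace_neg]
    rw [← mul_assoc, Matrix.trace_mul_comm]
  rw [e1, e2]
  have : Z * (-2 * (C * (g : M n)ᴴ * (C * (g : M n)ᴴ)))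
    = (-2 : ℂ) • (Z * (C * (g : M n)ᴴ * (C * (g : M n)ᴴ))) := by
    rw [neg_mul, mul_neg, two_mul, mul_add, neg_smul, two_smul]
  rw [this, Matrix.trace_smul, smul_eq_mul]
  ring

/-- `T = tr (g B)`. -/
noncomputable def T (B : M n) (g : U n) : ℂ := ((g : M n) * B).trace
/-- `P = tr (g B g B)`. -/
noncomputable def P (B : M n) (g : U n) : ℂ := ((g : M n) * B * (g * B)).trace

lemma contT (B : M n) : Continuous (T B) := (goodT (n := n) B).trace.cont
lemma contP (B : M n) : Continuous (P B) := (goodP (n := n) B).trace.cont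

lemma starT (B : M n) (g : U n) : (starRingEnd ℂ) (T B g) = (Bᴴ * (g : M n)ᴴ).trace := by
  rw [T, ← Matrix.conjTranspose_mul, Matrix.trace_conjTranspose]; rfl

lemma starP (B : M n) (g : U n) :
    (starRingEnd ℂ) (P B g) = (Bᴴ * (g : M n)ᴴ * (Bᴴ * (g : M n)ᴴ)).trace := by
  rw [P, ← Matrix.conjTranspose_mul, ← Matrix.conjTranspose_mul, Matrix.trace_conjTranspose]; rfl

/-- equation (b) -/
lemma eqb (B : M n) :
    (n : ℂ) ^ 2 * (∫ g, P B g * (starRingEnd ℂ) (P B g) ∂μ)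
      + n * (∫ g, T B g ^ 2 * (starRingEnd ℂ) (P B g) ∂μ)
      = 2 * ((B * Bᴴ).trace) ^ 2 := by
  have h1 := master' μ (goodP (n := n) B) (goodPs (n := n) Bᴴ) _ _ _ _ (fun Z g => rfl)
    (fun Z g => rfl)
  have h2 := e_conj μ (B * Bᴴ) (Bᴴ * B)
  have e : ∀ g : U n, ((g : M n) * B * (g * B) *
      (-2 * (Bᴴ * (g : M n)ᴴ * (Bᴴ * (g : M n)ᴴ)))).trace
      = -2 * ((g : M n) * (B * Bᴴ * ((g : M n)ᴴ * (Bᴴ * B)))).trace := by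
    intro g
    have : (g : M n) * B * (g * B) * (-2 * (Bᴴ * (g : M n)ᴴ * (Bᴴ * (g : M n)ᴴ)))
      = (-2 : ℂ) • ((g : M n) * ((B * (g * (B * (Bᴴ * ((g : M n)ᴴ * Bᴴ))))) * (g : M n)ᴴ)) := by
      rw [neg_mul, mul_neg, two_mul, mul_add, neg_smul, two_smul]
      simp only [mul_assoc]
    rw [this, Matrix.trace_smul, trace_cyc, Matrix.trace_mul_comm, smul_eq_mul]
    simp only [mul_assoc]
  simp only [e, ← starP] at h1
  have i1 : Integrable (fun g => P B g * (starRingEnd ℂ) (P B g)) μ :=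
    integrable_cont μ ((contP B).mul (Complex.continuous_conj.comp (contP B)))
  have i2 : Integrable (fun g => T B g ^ 2 * (starRingEnd ℂ) (P B g)) μ :=
    integrable_cont μ (((contT B).pow 2).mul (Complex.continuous_conj.comp (contP B)))
  have i3 : Integrable (fun g : U n => -2 *
      ((g : M n) * (B * Bᴴ * ((g : M n)ᴴ * (Bᴴ * B)))).trace) μ := by
    refine (integrable_cont μ ?_).const_mul _
    exact ((contU.matrix_mul (continuous_const.matrix_mul
      (contUs.matrix_mul continuous_const)))).matrix_trace
  have h3 : ∫ g, (n * (P B g * (starRingEnd ℂ) (P B g)) + T B g ^ 2 * (starRingEnd ℂ) (P B g)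
     + -2 * ((g : M n) * (B * Bᴴ * ((g : M n)ᴴ * (Bᴴ * B)))).trace) ∂μ = 0 := by
    rw [← h1]
    congr 1
    funext g
    simp only [P, T]
    ring
  rw [integral_add (show Integrable (fun g => _ + _) μ from (i1.const_mul (n : ℂ)).add i2) i3,
    integral_add (i1.const_mul _) i2,
    integral_const_mul, integral_const_mul] at h3
  rw [Matrix.trace_mul_comm Bᴴ B] at h2
  linear_combination (n : ℂ) * h3 + 2 * h2

/-- equation (c) -/
lemma eqc (B : M n) :
    (n : ℂ) ^ 2 * (∫ g, T B g ^ 2 * (starRingEnd ℂ) (P B g) ∂μ)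
      + n * (∫ g, P B g * (starRingEnd ℂ) (P B g) ∂μ)
      = 2 * (B * Bᴴ * (B * Bᴴ)).trace := by
  have h1 := master' μ (goodT (n := n) B) ((goodT (n := n) B).trace.mul (goodPs (n := n) Bᴴ))
    (fun g => (g : M n) * B) 0 0
    (fun g => (starRingEnd ℂ) (P B g) • ((g : M n) * B)
      + T B g • (-2 * (Bᴴ * (g : M n)ᴴ * (Bᴴ * (g : M n)ᴴ)))) (fun Z g => by simp)
    (fun Z g => by
      simp only [mul_add, Matrix.trace_add, Matrix.mul_smul, Matrix.trace_smul, starP, T,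
        smul_eq_mul]
      ring)
  have h2 := e_two μ B (Bᴴ * B * Bᴴ)
  have e : ∀ g : U n, ((g : M n) * B * ((starRingEnd ℂ) (P B g) • ((g : M n) * B)
      + T B g • (-2 * (Bᴴ * (g : M n)ᴴ * (Bᴴ * (g : M n)ᴴ))))).trace
      = P B g * (starRingEnd ℂ) (P B g) +
        -2 * (((g : M n) * B).trace * (Bᴴ * B * Bᴴ * (g : M n)ᴴ).trace) := by
    intro g
    have : (g : M n) * B * (-2 * (Bᴴ * (g : M n)ᴴ * (Bᴴ * (g : M n)ᴴ)))
      = (-2 : ℂ) • ((g : M n) * ((B * (Bᴴ * ((g : M n)ᴴ * Bᴴ))) * (g : M n)ᴴ)) := by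
      rw [neg_mul, mul_neg, two_mul, mul_add, neg_smul, two_smul]
      simp only [mul_assoc]
    rw [mul_add, Matrix.mul_smul, Matrix.mul_smul, this, Matrix.trace_add, Matrix.trace_smul,
      Matrix.trace_smul, Matrix.trace_smul, trace_cyc]
    have e2 : (B * (Bᴴ * ((g : M n)ᴴ * Bᴴ))).trace = (Bᴴ * B * Bᴴ * (g : M n)ᴴ).trace := by
      rw [← mul_assoc, ← mul_assoc, Matrix.trace_mul_comm]
      simp only [mul_assoc]
    rw [e2]
    simp only [P, T, smul_eq_mul]
    ring
  simp only [e, ← starP] at h1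
  have i1 : Integrable (fun g => P B g * (starRingEnd ℂ) (P B g)) μ :=
    integrable_cont μ ((contP B).mul (Complex.continuous_conj.comp (contP B)))
  have i2 : Integrable (fun g => T B g ^ 2 * (starRingEnd ℂ) (P B g)) μ :=
    integrable_cont μ (((contT B).pow 2).mul (Complex.continuous_conj.comp (contP B)))
  have i3 : Integrable (fun g : U n => -2 * (((g : M n) * B).trace *
      (Bᴴ * B * Bᴴ * (g : M n)ᴴ).trace)) μ := by
    refine (integrable_cont μ ?_).const_mul _
    exact (contT B).mul (continuous_const.matrix_mul contUs).matrix_trace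
  have h3 : ∫ g, (n * (T B g ^ 2 * (starRingEnd ℂ) (P B g)) + P B g * (starRingEnd ℂ) (P B g)
     + -2 * (((g : M n) * B).trace * (Bᴴ * B * Bᴴ * (g : M n)ᴴ).trace)) ∂μ = 0 := by
    rw [← h1]
    congr 1
    funext g
    simp only [T, Pi.zero_apply, Matrix.trace_zero]
    ring
  rw [integral_add (show Integrable (fun g => _ + _) μ from (i2.const_mul (n : ℂ)).add i1) i3,
    integral_add (i2.const_mul _) i1,
    integral_const_mul, integral_const_mul] at h3
  have e3 : B * (Bᴴ * B * Bᴴ) = B * Bᴴ * (B * Bᴴ) := by simp only [mul_assoc]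
  rw [e3] at h2
  linear_combination (n : ℂ) * h3 + 2 * h2

open scoped ComplexOrder in
lemma trace_nonneg (B : M n) : 0 ≤ (B * Bᴴ).trace.re ∧ (B * Bᴴ).trace.im = 0 := by
  have h := (Matrix.posSemidef_self_mul_conjTranspose B).trace_nonneg
  rw [Complex.le_def] at h
  exact ⟨h.1, h.2.symm⟩

lemma trace_real (B : M n) : (B * Bᴴ).trace = (((B * Bᴴ).trace.re : ℝ) : ℂ) := by
  apply Complex.ext
  · simp
  · simp [(trace_nonneg B).2]

lemma P_sq (B : M n) (hn : 2 ≤ n) :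
    ((n : ℝ) ^ 2 - 1) * ∫ g, ‖P B g‖ ^ 2 ∂μ ≤ 2 * ((B * Bᴴ).trace.re) ^ 2 := by
  have hb := eqb μ B
  have hc := eqc μ B
  have e : ∫ g, P B g * (starRingEnd ℂ) (P B g) ∂μ = ((∫ g, ‖P B g‖ ^ 2 ∂μ : ℝ) : ℂ) := by
    rw [← integral_complex_ofReal]
    congr 1
    funext g
    rw [Complex.mul_conj, Complex.normSq_eq_norm_sq]
  have h4 := trace_nonneg (B * Bᴴ)
  have h4' := trace_real (B * Bᴴ)
  rw [Matrix.conjTranspose_mul, Matrix.conjTranspose_conjTranspose] at h4 h4'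
  rw [e] at hb hc
  rw [h4'] at hc
  rw [trace_real B] at hb
  set Y := ∫ g, T B g ^ 2 * (starRingEnd ℂ) (P B g) ∂μ
  set x := ∫ g, ‖P B g‖ ^ 2 ∂μ
  set q := (B * Bᴴ * (B * Bᴴ)).trace.re
  set p := (B * Bᴴ).trace.re
  have hx : (n : ℂ) * (((n : ℝ) ^ 2 - 1 : ℝ) * x) = ((n * (2 * p ^ 2) - 2 * q : ℝ) : ℂ) := by
    push_cast
    linear_combination (n : ℂ) * hb - hc
  have hx' : (n : ℝ) * (((n : ℝ) ^ 2 - 1 : ℝ) * x) = n * (2 * p ^ 2) - 2 * q := by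
    exact_mod_cast hx
  have hn' : (0 : ℝ) < n := by positivity
  have : (n : ℝ) * (((n : ℝ) ^ 2 - 1 : ℝ) * x) ≤ n * (2 * p ^ 2) := by linarith [h4.1]
  exact le_of_mul_le_mul_left this hn'

lemma P_one (B : M n) (hn : 2 ≤ n) :
    ∫ g, ‖P B g‖ ∂μ ≤ 2 * (B * Bᴴ).trace.re / n := by
  have hn' : (2 : ℝ) ≤ n := by exact_mod_cast hn
  have h := P_sq μ B hn
  have hp := (trace_nonneg B).1
  set p := (B * Bᴴ).trace.re
  have i1 : Integrable (fun g => ‖P B g‖) μ := integrable_cont μ (contP B).norm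
  have i2 : Integrable (fun g => ‖P B g‖ ^ 2) μ := integrable_cont μ ((contP B).norm.pow 2)
  have hj : (∫ g, ‖P B g‖ ∂μ) ^ 2 ≤ ∫ g, ‖P B g‖ ^ 2 ∂μ := by
    set m := ∫ g, ‖P B g‖ ∂μ with hm
    have h0 : 0 ≤ ∫ g, (‖P B g‖ - m) ^ 2 ∂μ := integral_nonneg fun g => sq_nonneg _
    have h1 : ∫ g, (‖P B g‖ - m) ^ 2 ∂μ = ∫ g, (‖P B g‖ ^ 2 - 2 * m * ‖P B g‖ + m ^ 2) ∂μ := by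
      congr 1; funext g; ring
    rw [h1, integral_add (show Integrable (fun g => _ - _) μ from i2.sub (i1.const_mul (2 * m)))
        (integrable_const _),
      integral_sub i2 (i1.const_mul _), integral_const_mul, ← hm] at h0
    simp at h0
    nlinarith
  have h5 : (n : ℝ) ^ 2 * ∫ g, ‖P B g‖ ^ 2 ∂μ ≤ (2 * p) ^ 2 := by
    have : 0 ≤ ∫ g, ‖P B g‖ ^ 2 ∂μ := integral_nonneg fun g => sq_nonneg _
    nlinarith [mul_nonneg (show (0:ℝ) ≤ n ^ 2 - 2 by nlinarith) this]
  rw [le_div_iff₀ (by linarith)]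
  apply le_of_sq_le_sq _ (by linarith)
  calc _ = (n : ℝ) ^ 2 * (∫ g, ‖P B g‖ ∂μ) ^ 2 := by ring
    _ ≤ _ := mul_le_mul_of_nonneg_left hj (by positivity)
    _ ≤ _ := h5

end Moments

section CharFun

open scoped Matrix.Norms.Operator

open Complex

variable {n : ℕ} (μ : Measure (U n)) [IsProbabilityMeasure μ] [μ.IsMulLeftInvariant]

/-- `exp (i s Re T)` -/
noncomputable def S (B : M n) (s : ℝ) (g : U n) : ℂ := Complex.exp (I * s * (T B g).re)

lemma contS (B : M n) (s : ℝ) : Continuous (S B s) := by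
  unfold S
  exact Complex.continuous_exp.comp (continuous_const.mul
    (Complex.continuous_ofReal.comp (Complex.continuous_re.comp (contT B))))

lemma normS (B : M n) (s : ℝ) (g : U n) : ‖S B s g‖ = 1 := by
  unfold S
  rw [Complex.norm_exp]
  simp

lemma conjS (B : M n) (s : ℝ) (g : U n) : (starRingEnd ℂ) (S B (-s) g) = S B s g := by
  unfold S
  rw [← Complex.exp_conj]
  simp

lemma goodS (B : M n) (s : ℝ) : Good (S B s) (fun Z g => (Z * ((S B s g * (I * s / 2)) •
    ((g : M n) * B - Bᴴ * (g : M n)ᴴ))).trace) := by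
  have h := ((Good.const (n := n) (I * s / 2 : ℂ)).mul ((goodT (n := n) B).trace.addF
    (goodTs (n := n) Bᴴ).trace)).cexp
  have e : (fun g : U n => Complex.exp (I * s / 2 * (((g : M n) * B).trace
      + (Bᴴ * (g : M n)ᴴ).trace))) = S B s := by
    funext g
    rw [← starT]
    unfold S
    congr 1
    have : ((T B g).re : ℂ) = (T B g + (starRingEnd ℂ) (T B g)) / 2 := by
      rw [Complex.re_eq_add_conj]
    rw [this]
    unfold T
    ring
  have e' : ∀ g : U n, Complex.exp (I * s / 2 * (((g : M n) * B).trace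
      + (Bᴴ * (g : M n)ᴴ).trace)) = S B s g := fun g => congrFun e g
  simp only [e'] at h
  convert h using 3 with Z g
  rw [Matrix.mul_smul, Matrix.trace_smul, mul_sub, Matrix.trace_sub, Matrix.trace_neg,
    Matrix.trace_mul_comm Z (Bᴴ * (g : M n)ᴴ), smul_eq_mul]
  ring

/-- equation (a) -/
lemma eqa (B : M n) (s : ℝ) :
    (n : ℂ) * (∫ g, T B g * S B s g ∂μ) + (I * s / 2) * (∫ g, P B g * S B s g ∂μ)
      = (I * s / 2) * ((B * Bᴴ).trace.re : ℝ) * (∫ g, S B s g ∂μ) := by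
  have h := master' μ (goodT (n := n) B) (goodS (n := n) B s)
    (fun g => (g : M n) * B) 0 0 _ (fun Z g => by simp) (fun Z g => rfl)
  have e : ∀ g : U n, ((g : M n) * B * ((S B s g * (I * s / 2)) •
    ((g : M n) * B - Bᴴ * (g : M n)ᴴ))).trace
      = (I * s / 2) * (P B g * S B s g) -
        (I * s / 2) * ((B * Bᴴ).trace.re : ℝ) * S B s g := by
    intro g
    rw [Matrix.mul_smul, Matrix.trace_smul, mul_sub, Matrix.trace_sub, ← trace_real]
    have : (g : M n) * B * (Bᴴ * (g : M n)ᴴ) = g * ((B * Bᴴ) * (g : M n)ᴴ) := by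
      simp only [mul_assoc]
    rw [this, trace_cyc, smul_eq_mul, P]
    ring
  have i1 : Integrable (fun g => T B g * S B s g) μ :=
    integrable_cont μ ((contT B).mul (contS B s))
  have i2 : Integrable (fun g => P B g * S B s g) μ :=
    integrable_cont μ ((contP B).mul (contS B s))
  have i3 : Integrable (S B s) μ := integrable_cont μ (contS B s)
  have h3 : ∫ g, (n * (T B g * S B s g) + ((I * s / 2) * (P B g * S B s g) -
        (I * s / 2) * ((B * Bᴴ).trace.re : ℝ) * S B s g)) ∂μ = 0 := by
    rw [← h]
    congr 1
    funext g
    rw [e]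
    simp only [T, Pi.zero_apply, Matrix.trace_zero]
    ring
  rw [integral_add (i1.const_mul _) (show Integrable (fun g => _ - _) μ from
    (i2.const_mul (I * s / 2)).sub (i3.const_mul ((I * s / 2) * ((B * Bᴴ).trace.re : ℝ)))),
    integral_sub (i2.const_mul _) (i3.const_mul _), integral_const_mul, integral_const_mul,
    integral_const_mul] at h3
  linear_combination h3

lemma eqa' (B : M n) (s : ℝ) :
    (n : ℂ) * (∫ g, ((T B g).re : ℂ) * S B s g ∂μ)
      + (I * s / 2) * (∫ g, ((P B g).re : ℂ) * S B s g ∂μ)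
      = (I * s / 2) * ((B * Bᴴ).trace.re : ℝ) * (∫ g, S B s g ∂μ) := by
  have h1 := eqa μ B s
  have h2 := congrArg (starRingEnd ℂ) (eqa μ B (-s))
  simp only [map_add, map_mul, map_div₀, ← integral_conj, conjS, Complex.conj_I,
    Complex.conj_ofReal, map_natCast, map_ofNat, Complex.ofReal_neg, map_neg] at h2
  have i1 : Integrable (fun g => T B g * S B s g) μ :=
    integrable_cont μ ((contT B).mul (contS B s))
  have i2 : Integrable (fun g => P B g * S B s g) μ :=
    integrable_cont μ ((contP B).mul (contS B s))
  have i1' : Integrable (fun g => (starRingEnd ℂ) (T B g) * S B s g) μ :=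
    integrable_cont μ ((Complex.continuous_conj.comp (contT B)).mul (contS B s))
  have i2' : Integrable (fun g => (starRingEnd ℂ) (P B g) * S B s g) μ :=
    integrable_cont μ ((Complex.continuous_conj.comp (contP B)).mul (contS B s))
  have e1 : ∫ g, ((T B g).re : ℂ) * S B s g ∂μ = (1 / 2 : ℂ) * ((∫ g, T B g * S B s g ∂μ) +
      ∫ g, (starRingEnd ℂ) (T B g) * S B s g ∂μ) := by
    rw [← integral_add i1 i1', ← integral_const_mul]
    congr 1
    funext g
    rw [Complex.re_eq_add_conj]
    ring
  have e2 : ∫ g, ((P B g).re : ℂ) * S B s g ∂μ = (1 / 2 : ℂ) * ((∫ g, P B g * S B s g ∂μ) +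
      ∫ g, (starRingEnd ℂ) (P B g) * S B s g ∂μ) := by
    rw [← integral_add i2 i2', ← integral_const_mul]
    congr 1
    funext g
    rw [Complex.re_eq_add_conj]
    ring
  rw [e1, e2]
  linear_combination (1 / 2 : ℂ) * h1 + (1 / 2 : ℂ) * h2

lemma phi_deriv (B : M n) (s : ℝ) :
    HasDerivAt (fun s : ℝ => ∫ g, S B s g ∂μ) (I * ∫ g, ((T B g).re : ℂ) * S B s g ∂μ) s := by
  have cX : Continuous fun g : U n => ((T B g).re : ℂ) :=
    Complex.continuous_ofReal.comp (Complex.continuous_re.comp (contT B))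
  have key := hasDerivAt_integral_of_dominated_loc_of_deriv_le (μ := μ) (s := Set.univ)
    (F := fun (t : ℝ) g => S B t g) (x₀ := s) (bound := fun g => ‖((T B g).re : ℂ)‖)
    (F' := fun (t : ℝ) g => I * (((T B g).re : ℂ) * S B t g)) univ_mem
    (Eventually.of_forall fun t => (contS B t).aestronglyMeasurable)
    (integrable_cont μ (contS B s))
    (continuous_const.mul (cX.mul (contS B s))).aestronglyMeasurable
    (Eventually.of_forall fun g t _ => by simp [normS])
    (integrable_cont μ cX.norm)
    (Eventually.of_forall fun g t _ => by
      have h0 : HasDerivAt (fun t : ℝ => (t : ℂ)) 1 t := Complex.ofRealCLM.hasDerivAt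
      have h1 : HasDerivAt (fun t : ℝ => I * (t : ℂ) * ((T B g).re : ℂ))
          (I * 1 * ((T B g).re : ℂ)) t := (h0.const_mul I).mul_const _
      have h2 := h1.cexp
      exact h2.congr_deriv (by unfold S; ring))
  have h := key.2
  rwa [integral_const_mul] at h

lemma phi_bound (B : M n) (hn : 2 ≤ n) :
    ‖(∫ g, S B 1 g ∂μ) - Complex.exp (-(((1 / (2 * (n : ℝ))) * (B * Bᴴ).trace.re : ℝ) : ℂ) / 2)‖
      ≤ 2 * ((1 / (2 * (n : ℝ))) * (B * Bᴴ).trace.re) / n := by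
  have hn' : (2 : ℝ) ≤ n := by exact_mod_cast hn
  have hn0 : (n : ℂ) ≠ 0 := by
    have : (n : ℝ) ≠ 0 := by linarith
    exact_mod_cast this
  have hτ := (trace_nonneg B).1
  have hP := P_one μ B hn
  have ha := eqa' μ B
  set τ := (B * Bᴴ).trace.re
  set v : ℝ := (1 / (2 * (n : ℝ))) * τ with hv
  have hv0 : 0 ≤ v := by positivity
  set φ : ℝ → ℂ := fun s => ∫ g, S B s g ∂μ with hφ
  have hφ' : ∀ s, HasDerivAt φ (-(v * s) * φ s
      + (s / (2 * n)) * ∫ g, ((P B g).re : ℂ) * S B s g ∂μ) s := by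
    intro s
    have h := phi_deriv μ B s
    convert h using 1
    have h2 := ha s
    have h3 : (n : ℂ) * (I * ∫ g, ((T B g).re : ℂ) * S B s g ∂μ) =
        (n : ℂ) * (-(v * s) * φ s + (s / (2 * n)) * ∫ g, ((P B g).re : ℂ) * S B s g ∂μ) := by
      have e1 : (n : ℂ) * v = τ / 2 := by
        rw [hv]; push_cast; field_simp
      have e2 : (n : ℂ) * (s / (2 * n)) = s / 2 := by field_simp
      rw [mul_add, ← mul_assoc (n : ℂ) ((s : ℂ) / (2 * n)), e2]
      have e3 : (n : ℂ) * (-(v * s) * φ s) = -(τ / 2 * s) * φ s := by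
        rw [← e1]; ring
      rw [e3]
      simp only [hφ]
      linear_combination I * h2 + (s / 2 * (τ * (∫ g, S B s g ∂μ)
        - ∫ g, ((P B g).re : ℂ) * S B s g ∂μ)) * Complex.I_sq
    exact (mul_left_cancel₀ hn0 h3).symm
  have hψ : ∀ s : ℝ, HasDerivAt (fun s : ℝ => Complex.exp ((v * s ^ 2 / 2 : ℝ)) * φ s)
      (Complex.exp ((v * s ^ 2 / 2 : ℝ)) *
        ((s / (2 * n)) * ∫ g, ((P B g).re : ℂ) * S B s g ∂μ)) s := by
    intro s
    have h0 : HasDerivAt (fun s : ℝ => v * s ^ 2 / 2) (v * s) s := by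
      have := (((hasDerivAt_id s).pow 2).const_mul v).div_const 2
      refine this.congr_deriv ?_
      simp
      ring
    have h1 := h0.ofReal_comp.cexp
    have h2 := h1.mul (hφ' s)
    refine h2.congr_deriv ?_
    push_cast
    ring
  have hb : ∀ s ∈ Set.Ico (0 : ℝ) 1, ‖Complex.exp ((v * s ^ 2 / 2 : ℝ)) *
        ((s / (2 * n)) * ∫ g, ((P B g).re : ℂ) * S B s g ∂μ)‖
        ≤ Real.exp (v / 2) * (1 / (2 * n) * (2 * τ / n)) := by
    intro s hs
    have hs2 : s ^ 2 ≤ 1 := by nlinarith [hs.1, hs.2]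
    rw [norm_mul, norm_mul, ← Complex.ofReal_exp, Complex.norm_real, Real.norm_of_nonneg
      (Real.exp_pos _).le]
    gcongr
    · nlinarith
    · have : (s : ℂ) / (2 * n) = ((s / (2 * n) : ℝ) : ℂ) := by push_cast; rfl
      rw [this, Complex.norm_real, Real.norm_of_nonneg (by have := hs.1; positivity)]
      gcongr
      exact hs.2.le
    · refine (norm_integral_le_integral_norm _).trans (le_trans ?_ hP)
      refine integral_mono_of_nonneg (Eventually.of_forall fun g => norm_nonneg _)
        (integrable_cont μ (contP B).norm) (Eventually.of_forall fun g => ?_)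
      simp only [norm_mul, normS, mul_one, Complex.norm_real]
      exact Complex.abs_re_le_norm _
  have hfin := norm_image_sub_le_of_norm_deriv_le_segment_01'
    (fun s _ => (hψ s).hasDerivWithinAt) hb
  have hφ0 : φ 0 = 1 := by
    simp [hφ, S]
  have e : (∫ g, S B 1 g ∂μ) - Complex.exp (-(v : ℂ) / 2) = Complex.exp (-(v : ℂ) / 2) *
      (Complex.exp ((v * 1 ^ 2 / 2 : ℝ)) * φ 1 - Complex.exp ((v * 0 ^ 2 / 2 : ℝ)) * φ 0) := by
    rw [hφ0, mul_sub, ← mul_assoc, ← Complex.exp_add]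
    have : (-(v : ℂ) / 2) + ((v * 1 ^ 2 / 2 : ℝ) : ℂ) = 0 := by push_cast; ring
    rw [this]
    simp [hφ]
  rw [e, norm_mul]
  have e4 : ‖Complex.exp (-(v : ℂ) / 2)‖ = Real.exp (-v / 2) := by
    rw [Complex.norm_exp]
    congr 1
    have : (-(v : ℂ) / 2) = ((-v / 2 : ℝ) : ℂ) := by push_cast; rfl
    rw [this, Complex.ofReal_re]
  rw [e4]
  calc _ ≤ Real.exp (-v / 2) * (Real.exp (v / 2) * (1 / (2 * n) * (2 * τ / n))) := by gcongr
    _ = 2 * v / n := by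
      rw [← mul_assoc, ← Real.exp_add]
      have : -v / 2 + v / 2 = 0 := by ring
      rw [this, Real.exp_zero, hv]
      ring

end CharFun

section Assembly

open scoped Matrix.Norms.Operator

open Complex

variable {r : ℕ}

/-- linear combination -/
noncomputable def comb (A : Fin r → (n : ℕ) → M n) (t : Fin r → ℝ) (n : ℕ) : M n :=
  ∑ ν, (t ν : ℂ) • A ν n

lemma comb_T (A : Fin r → (n : ℕ) → M n) (t : Fin r → ℝ) (n : ℕ) (g : U n) :
    (T (comb A t n) g).re = ∑ ν, t ν * (A ν n * (g : M n)).trace.re := by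
  unfold T comb
  rw [Matrix.trace_mul_comm, Finset.sum_mul, Matrix.trace_sum, Complex.re_sum]
  simp

lemma comb_tr (A : Fin r → (n : ℕ) → M n) (t : Fin r → ℝ) (n : ℕ) :
    (1 / (2 * (n : ℝ))) * (comb A t n * (comb A t n)ᴴ).trace.re
      = ∑ i, ∑ j, t i * ((1 / (2 * (n : ℝ))) * (A i n * (A j n)ᴴ).trace.re) * t j := by
  unfold comb
  rw [Matrix.conjTranspose_sum, Finset.sum_mul_sum, Matrix.trace_sum, Complex.re_sum,
    Finset.mul_sum]
  refine Finset.sum_congr rfl fun i _ => ?_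
  rw [Matrix.trace_sum, Complex.re_sum, Finset.mul_sum]
  refine Finset.sum_congr rfl fun j _ => ?_
  simp [Matrix.conjTranspose_smul]
  ring

lemma comb_tendsto (A : Fin r → (n : ℕ) → M n) (c : Matrix (Fin r) (Fin r) ℝ)
    (hc : ∀ μ' ν, Tendsto
      (fun n : ℕ => (1 / (2 * (n : ℝ))) * ((A μ' n * (A ν n)ᴴ).trace.re))
      atTop (𝓝 (c μ' ν))) (t : Fin r → ℝ) :
    Tendsto (fun n : ℕ => (1 / (2 * (n : ℝ))) * (comb A t n * (comb A t n)ᴴ).trace.re) atTop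
      (𝓝 (∑ i, ∑ j, t i * c i j * t j)) := by
  simp_rw [comb_tr]
  exact tendsto_finsetSum _ fun i _ => tendsto_finsetSum _ fun j _ =>
    ((hc i j).const_mul (t i)).mul_const (t j)

lemma quad_eq (c : Matrix (Fin r) (Fin r) ℝ) (t : Fin r → ℝ) :
    t ⬝ᵥ c *ᵥ t = ∑ i, ∑ j, t i * c i j * t j := by
  simp [dotProduct, Matrix.mulVec, Finset.mul_sum, mul_assoc]

lemma c_psd (A : Fin r → (n : ℕ) → M n) (c : Matrix (Fin r) (Fin r) ℝ)
    (hc : ∀ μ' ν, Tendsto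
      (fun n : ℕ => (1 / (2 * (n : ℝ))) * ((A μ' n * (A ν n)ᴴ).trace.re))
      atTop (𝓝 (c μ' ν))) : c.PosSemidef := by
  refine Matrix.PosSemidef.of_dotProduct_mulVec_nonneg ?_ fun x => ?_
  · ext i j
    simp only [Matrix.conjTranspose_apply, star_trivial]
    refine tendsto_nhds_unique (hc j i) ?_
    refine (hc i j).congr fun n => ?_
    congr 1
    rw [← Complex.conj_re]
    have : (starRingEnd ℂ) (A i n * (A j n)ᴴ).trace = ((A i n * (A j n)ᴴ)ᴴ).trace := by
      rw [Matrix.trace_conjTranspose]; rfl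
    rw [this, Matrix.conjTranspose_mul, Matrix.conjTranspose_conjTranspose]
  · rw [star_trivial, quad_eq]
    refine ge_of_tendsto' (comb_tendsto A c hc x) fun n => ?_
    have := (trace_nonneg (comb A x n)).1
    positivity

lemma comb_char (A : Fin r → (n : ℕ) → M n) (c : Matrix (Fin r) (Fin r) ℝ)
    (hc : ∀ μ' ν, Tendsto
      (fun n : ℕ => (1 / (2 * (n : ℝ))) * ((A μ' n * (A ν n)ᴴ).trace.re))
      atTop (𝓝 (c μ' ν)))
    (μ : (n : ℕ) → Measure (U n))
    (hprob : ∀ n, IsProbabilityMeasure (μ n))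
    (hinv : ∀ n, (μ n).IsMulLeftInvariant) (t : Fin r → ℝ) :
    Tendsto (fun n => ∫ g, S (comb A t n) 1 g ∂μ n) atTop
      (𝓝 (Complex.exp (-((∑ i, ∑ j, t i * c i j * t j : ℝ) : ℂ) / 2))) := by
  have h := comb_tendsto A c hc t
  set q := ∑ i, ∑ j, t i * c i j * t j
  have h1 : Tendsto (fun n : ℕ => Complex.exp
      (-(((1 / (2 * (n : ℝ))) * (comb A t n * (comb A t n)ᴴ).trace.re : ℝ) : ℂ) / 2)) atTop
      (𝓝 (Complex.exp (-(q : ℂ) / 2))) := by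
    refine (Complex.continuous_exp.tendsto _).comp ?_
    exact (((Complex.continuous_ofReal.tendsto _).comp h).neg).div_const 2
  have h2 : Tendsto (fun n : ℕ => 2 * ((1 / (2 * (n : ℝ))) *
      (comb A t n * (comb A t n)ᴴ).trace.re) / n) atTop (𝓝 0) :=
    (h.const_mul 2).div_atTop tendsto_natCast_atTop_atTop
  have h3 : Tendsto (fun n => (∫ g, S (comb A t n) 1 g ∂μ n) - Complex.exp
      (-(((1 / (2 * (n : ℝ))) * (comb A t n * (comb A t n)ᴴ).trace.re : ℝ) : ℂ) / 2)) atTop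
      (𝓝 0) := by
    refine squeeze_zero_norm' ?_ h2
    filter_upwards [eventually_ge_atTop 2] with n hn
    have := hprob n
    have := hinv n
    exact phi_bound (μ n) (comb A t n) hn
  simpa using h3.add h1

/-- The limiting Gaussian measure. -/
noncomputable def gam (c : Matrix (Fin r) (Fin r) ℝ) : Measure (Fin r → ℝ) :=
  (multivariateGaussian 0 c).map (fun x : EuclideanSpace ℝ (Fin r) => (x.ofLp : Fin r → ℝ))

lemma gam_gauss (c : Matrix (Fin r) (Fin r) ℝ) (hc : c.PosSemidef) :
    IsGaussianMeasure (gam c) 0 c := by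
  have m1 : Measurable (fun x : EuclideanSpace ℝ (Fin r) => (x.ofLp : Fin r → ℝ)) := by fun_prop
  have hp : IsProbabilityMeasure (gam c) := Measure.isProbabilityMeasure_map m1.aemeasurable
  refine ⟨hp, fun t => ?_⟩
  have m2 : Measurable (fun x : Fin r → ℝ => ∑ i, t i * x i) := by fun_prop
  have : IsProbabilityMeasure ((gam c).map (fun x => ∑ i, t i * x i)) :=
    Measure.isProbabilityMeasure_map m2.aemeasurable
  apply Measure.ext_of_charFun
  funext s
  rw [charFun_gaussianReal, gam, Measure.map_map m2 m1, charFun_apply,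
    integral_map (m2.comp m1).aemeasurable (by fun_prop)]
  have h := charFun_multivariateGaussian (μ := 0) hc (WithLp.toLp 2 (fun i => s * t i))
  rw [charFun_apply] at h
  have hq : 0 ≤ ∑ i, ∑ j, t i * c i j * t j := by
    rw [← quad_eq]
    simpa using hc.dotProduct_mulVec_nonneg t
  have e : (∫ x, Complex.exp (((inner ℝ (((fun x : Fin r → ℝ => ∑ i, t i * x i) ∘
      fun x : EuclideanSpace ℝ (Fin r) => x.ofLp) x) s : ℝ) : ℂ) * I)
        ∂(multivariateGaussian 0 c)) =
      ∫ x, Complex.exp (((inner ℝ x (WithLp.toLp 2 (fun i => s * t i)) : ℝ) : ℂ) * I)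
        ∂(multivariateGaussian 0 c) := by
    congr 1
    funext x
    congr 3
    simp only [Function.comp, PiLp.inner_apply, RCLike.inner_apply, conj_trivial, Finset.mul_sum]
    refine Finset.sum_congr rfl fun i _ => ?_
    ring
  rw [e, h]
  congr 1
  have e2 : ((fun i => s * t i) ⬝ᵥ c *ᵥ (fun i => s * t i))
      = s ^ 2 * ∑ i, ∑ j, t i * c i j * t j := by
    rw [quad_eq, Finset.mul_sum]
    refine Finset.sum_congr rfl fun i _ => ?_
    rw [Finset.mul_sum]
    refine Finset.sum_congr rfl fun j _ => ?_
    ring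
  simp only [inner_zero_right, Pi.zero_apply, mul_zero, Finset.sum_const_zero]
  rw [e2, Real.coe_toNNReal _ hq]
  push_cast
  ring

theorem final
    (A : Fin r → (n : ℕ) → M n)
    (c : Matrix (Fin r) (Fin r) ℝ)
    (hc : ∀ μ' ν, Tendsto
      (fun n : ℕ => (1 / (2 * (n : ℝ))) * ((A μ' n * (A ν n)ᴴ).trace.re))
      atTop (𝓝 (c μ' ν)))
    (μ : (n : ℕ) → Measure (U n))
    (hprob : ∀ n, IsProbabilityMeasure (μ n))
    (hinv : ∀ n, (μ n).IsMulLeftInvariant)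
    (f : BoundedContinuousFunction (Fin r → ℝ) ℝ) :
    Tendsto
          (fun n => ∫ g, f (fun ν =>
            ((A ν n * (g : M n)).trace.re)) ∂ μ n)
          atTop (𝓝 (∫ x, f x ∂ (gam c))) := by
  have hpsd := c_psd A c hc
  let Y : (n : ℕ) → U n → EuclideanSpace ℝ (Fin r) := fun n g =>
    WithLp.toLp 2 (fun ν => (A ν n * (g : M n)).trace.re)
  have hY : ∀ n, Continuous (Y n) := by
    intro n
    refine (PiLp.continuous_toLp 2 _).comp (continuous_pi fun ν => ?_)
    exact Complex.continuous_re.comp (continuous_const.matrix_mul contU).matrix_trace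
  let μ' : ℕ → ProbabilityMeasure (EuclideanSpace ℝ (Fin r)) := fun n =>
    ⟨(μ n).map (Y n), Measure.isProbabilityMeasure_map (hY n).measurable.aemeasurable⟩
  let μ₀ : ProbabilityMeasure (EuclideanSpace ℝ (Fin r)) :=
    ⟨multivariateGaussian 0 c, inferInstance⟩
  have hconv : Tendsto μ' atTop (𝓝 μ₀) := by
    rw [ProbabilityMeasure.tendsto_iff_tendsto_charFun]
    intro t
    have h1 := comb_char A c hc μ hprob hinv t.ofLp
    have e1 : charFun (μ₀ : Measure (EuclideanSpace ℝ (Fin r))) t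
        = Complex.exp (-((∑ i, ∑ j, t i * c i j * t j : ℝ) : ℂ) / 2) := by
      change charFun (multivariateGaussian 0 c) t = _
      rw [charFun_multivariateGaussian hpsd, quad_eq]
      simp [neg_div]
    rw [e1]
    refine h1.congr fun n => ?_
    change _ = charFun ((μ n).map (Y n)) t
    rw [charFun_apply, integral_map (hY n).measurable.aemeasurable (by fun_prop)]
    congr 1
    funext g
    unfold S
    rw [comb_T]
    congr 1
    simp only [Y, PiLp.inner_apply, RCLike.inner_apply, conj_trivial]
    push_cast
    ring
  rw [ProbabilityMeasure.tendsto_iff_forall_integral_tendsto] at hconv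
  have h2 := hconv (f.compContinuous ⟨fun x : EuclideanSpace ℝ (Fin r) => x.ofLp,
    PiLp.continuous_ofLp 2 _⟩)
  have m1 : Measurable (fun x : EuclideanSpace ℝ (Fin r) => (x.ofLp : Fin r → ℝ)) := by fun_prop
  rw [gam, integral_map m1.aemeasurable f.continuous.aestronglyMeasurable]
  refine h2.congr fun n => ?_
  change ∫ x, _ ∂((μ n).map (Y n)) = _
  rw [integral_map (hY n).measurable.aemeasurable
    (BoundedContinuousFunction.continuous _).aestronglyMeasurable]
  rfl

end Assembly

end BorelU

/-- Borel theorem for the unitary group (class A): the random vector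
`(Re Tr(A^{(1,n)} g), …, Re Tr(A^{(r,n)} g))`, with `g` Haar distributed on `U(n)`,
converges in distribution to the centered Gaussian with covariances
`c μ ν = lim (1/(2n)) Re Tr(A^{(μ,n)} (A^{(ν,n)})^*)`. -/
theorem borel_theorem_unitary
    (r : ℕ) (hr : 1 ≤ r)
    (A : Fin r → (n : ℕ) → Matrix (Fin n) (Fin n) ℂ)
    (c : Matrix (Fin r) (Fin r) ℝ)
    (hc : ∀ μ' ν, Tendsto
      (fun n : ℕ => (1 / (2 * (n : ℝ))) * ((A μ' n * (A ν n)ᴴ).trace.re))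
      atTop (𝓝 (c μ' ν)))
    (hpos : ∀ ν, 0 < c ν ν)
    (μ : (n : ℕ) → Measure (Matrix.unitaryGroup (Fin n) ℂ))
    (hprob : ∀ n, IsProbabilityMeasure (μ n))
    (hinv : ∀ n, (μ n).IsMulLeftInvariant) :
    ∃ γ : Measure (Fin r → ℝ), IsGaussianMeasure γ 0 c ∧
      ∀ f : BoundedContinuousFunction (Fin r → ℝ) ℝ,
        Tendsto
          (fun n => ∫ g, f (fun ν =>
            ((A ν n * (g : Matrix (Fin n) (Fin n) ℂ)).trace.re)) ∂ μ n)
          atTop (𝓝 (∫ x, f x ∂ γ)) := by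
  exact ⟨BorelU.gam c, BorelU.gam_gauss c (BorelU.c_psd A c hc),
    BorelU.final A c hc μ hprob hinv⟩
end

section
/- Let r ≥ 1 and for each ν ∈ {1,…,r} and n ∈ ℕ let A^{(ν,n)} be a complex symmetric n×n matrix (A^{(ν,n)ᵀ} = A^{(ν,n)}). Assume that for all μ,ν ∈ {1,…,r} the limit c_{μν} := lim_{n→∞} (1/n)·Re Tr(A^{(μ,n)}(A^{(ν,n)})*) exists, and that c_{νν} > 0 for each ν. Let g^{(n)} be a Haar-distributed random element of U(n) and set V^{(n)} := g^{(n)}(g^{(n)})ᵀ. Then, as n → ∞, the random vector (Re Tr(A^{(1,n)}V^{(n)}), …, Re Tr(A^{(r,n)}V^{(n)})) converges in distribution to the centered Gaussian distribution on ℝ^r with covariance matrix (c_{μν}). -/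
open MeasureTheory ProbabilityTheory Matrix Filter Topology

namespace BorelAI

section one

variable {n : ℕ}

/-- The unitary group. -/
abbrev UU (n : ℕ) := Matrix.unitaryGroup (Fin n) ℂ

instance matBorel : BorelSpace (Matrix (Fin n) (Fin n) ℂ) :=
  inferInstanceAs (BorelSpace (Fin n → Fin n → ℂ))

instance matSC : SecondCountableTopology (Matrix (Fin n) (Fin n) ℂ) :=
  inferInstanceAs (SecondCountableTopology (Fin n → Fin n → ℂ))

instance uuBorel : BorelSpace (UU n) := Subtype.borelSpace _

instance uuSC : SecondCountableTopology (UU n) :=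
  TopologicalSpace.Subtype.secondCountableTopology _

instance uuCompact : CompactSpace (UU n) := by
  apply isCompact_iff_compactSpace.mp
  have h1 : IsCompact (Set.univ.pi fun _ : Fin n => Set.univ.pi fun _ : Fin n =>
      Metric.closedBall (0 : ℂ) 1) :=
    isCompact_univ_pi fun _ => isCompact_univ_pi fun _ => isCompact_closedBall _ _
  refine IsCompact.of_isClosed_subset (s := (Set.univ.pi fun _ : Fin n => Set.univ.pi fun _ : Fin n =>
      Metric.closedBall (0 : ℂ) 1 : Set (Matrix (Fin n) (Fin n) ℂ))) h1 ?_ ?_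
  · have : (Matrix.unitaryGroup (Fin n) ℂ : Set (Matrix (Fin n) (Fin n) ℂ)) =
        {M | M * star M = 1} := by
      ext M
      exact Matrix.mem_unitaryGroup_iff
    rw [this]
    exact isClosed_eq (continuous_id.matrix_mul continuous_id.matrix_conjTranspose)
      continuous_const
  · intro M hM i _ j _
    simpa using entry_norm_bound_of_unitary hM i j

instance uuMul : MeasurableMul (UU n) := inferInstance

theorem exp_mem (X : Matrix (Fin n) (Fin n) ℂ) (hX : Xᴴ = -X) (s : ℝ) :
    NormedSpace.exp (s • X) ∈ Matrix.unitaryGroup (Fin n) ℂ := by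
  rw [Matrix.mem_unitaryGroup_iff, Matrix.star_eq_conjTranspose, ← Matrix.exp_conjTranspose,
    Matrix.conjTranspose_smul, hX, ← Matrix.exp_add_of_commute]
  · simp
  · simp

/-- One-parameter subgroup. -/
noncomputable def expU (X : Matrix (Fin n) (Fin n) ℂ) (hX : Xᴴ = -X) (s : ℝ) : UU n :=
  ⟨NormedSpace.exp (s • X), exp_mem X hX s⟩

theorem expU_add (X : Matrix (Fin n) (Fin n) ℂ) (hX : Xᴴ = -X) (s t : ℝ) :
    expU X hX (s + t) = expU X hX s * expU X hX t := by
  apply Subtype.ext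
  change NormedSpace.exp ((s + t) • X) = NormedSpace.exp (s • X) * NormedSpace.exp (t • X)
  rw [add_smul, Matrix.exp_add_of_commute]
  exact ((Commute.refl X).smul_left s).smul_right t

theorem expU_zero (X : Matrix (Fin n) (Fin n) ℂ) (hX : Xᴴ = -X) :
    expU X hX 0 = 1 := by
  apply Subtype.ext
  change NormedSpace.exp ((0 : ℝ) • X) = 1
  simp

open scoped Matrix.Norms.Operator in
theorem expU_deriv (X : Matrix (Fin n) (Fin n) ℂ) (hX : Xᴴ = -X) (i j : Fin n) :
    HasDerivAt (fun s : ℝ => (expU X hX s).1 i j) (X i j) 0 := by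
  have h := hasDerivAt_exp_smul_const (𝕂 := ℝ) (𝔸 := Matrix (Fin n) (Fin n) ℂ) X 0
  simp only [zero_smul, NormedSpace.exp_zero, one_mul] at h
  have h2 := (hasDerivAt_pi.mp (hasDerivAt_pi.mp h i) j)
  exact h2

/-- `f` is smooth along left translations with complexified derivative `D`. -/
structure HasD (f : UU n → ℂ) (D : Matrix (Fin n) (Fin n) ℂ → UU n → ℂ) : Prop where
  cont : Continuous f
  contD : ∀ X, Continuous (D X)
  add : ∀ X Y g, D (X + Y) g = D X g + D Y g
  smul : ∀ (c : ℂ) X g, D (c • X) g = c * D X g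
  deriv : ∀ X (hX : Xᴴ = -X) g, HasDerivAt (fun s : ℝ => f (expU X hX s * g)) (D X g) 0

theorem integrable_cont (μ : Measure (UU n)) [IsProbabilityMeasure μ] {E : Type*}
    [NormedAddCommGroup E] [SecondCountableTopology E] {f : UU n → E}
    (hf : Continuous f) : Integrable f μ := by
  obtain ⟨C, hC⟩ := isCompact_univ.exists_bound_of_continuousOn hf.continuousOn
  exact Integrable.of_bound hf.aestronglyMeasurable C
    (Filter.Eventually.of_forall fun x => hC x (Set.mem_univ _))

theorem HasD.ibp_skew {f : UU n → ℂ} {D} (h : HasD f D) (μ : Measure (UU n))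
    [IsProbabilityMeasure μ] [μ.IsMulLeftInvariant] (X) (hX : Xᴴ = -X) :
    ∫ g, D X g ∂μ = 0 := by
  obtain ⟨C, hC⟩ := isCompact_univ.exists_bound_of_continuousOn (h.contD X).continuousOn
  have key := hasDerivAt_integral_of_dominated_loc_of_deriv_le (μ := μ) (𝕜 := ℝ)
    (F := fun s g => f (expU X hX s * g)) (F' := fun s g => D X (expU X hX s * g)) (x₀ := 0)
    (bound := fun _ => C) (s := Set.univ) Filter.univ_mem
    (Filter.Eventually.of_forall fun s =>
      (h.cont.comp (continuous_const_mul _)).aestronglyMeasurable)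
    (integrable_cont μ (h.cont.comp (continuous_const_mul _)))
    ((h.contD X).comp (continuous_const_mul _)).aestronglyMeasurable
    (Filter.Eventually.of_forall fun g s _ => hC _ (Set.mem_univ _))
    (integrable_const _)
    (Filter.Eventually.of_forall fun g s _ => by
      have h1 := h.deriv X hX (expU X hX s * g)
      have h2 : HasDerivAt (fun t : ℝ => f (expU X hX (t - s) * (expU X hX s * g)))
          (D X (expU X hX s * g)) s := by
        have := HasDerivAt.comp_sub_const (x := s) (a := s) (f := fun s' => f (expU X hX s' * (expU X hX s * g))) (f' := D X (expU X hX s * g)) (by simpa using h1)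
        exact this
      have h3 : (fun t : ℝ => f (expU X hX (t - s) * (expU X hX s * g))) =
          fun t => f (expU X hX t * g) := by
        funext t
        rw [← mul_assoc, ← expU_add, sub_add_cancel]
      rw [h3] at h2
      exact h2)
  have hconst : (fun s : ℝ => ∫ g, f (expU X hX s * g) ∂μ) = fun _ => ∫ g, f g ∂μ := by
    funext s
    exact integral_mul_left_eq_self f _
  have k2 := key.2
  rw [hconst] at k2
  have := k2.unique (hasDerivAt_const _ _)
  simpa [expU_zero] using this

theorem HasD.ibp {f : UU n → ℂ} {D} (h : HasD f D) (μ : Measure (UU n))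
    [IsProbabilityMeasure μ] [μ.IsMulLeftInvariant] (X) :
    ∫ g, D X g ∂μ = 0 := by
  have h1 := h.ibp_skew μ ((1/2 : ℂ) • (X - Xᴴ)) (by
    simp only [conjTranspose_smul, conjTranspose_sub, conjTranspose_conjTranspose]
    rw [← smul_neg]; simp)
  have h2 := h.ibp_skew μ ((Complex.I/2 : ℂ) • (X + Xᴴ)) (by
    simp only [conjTranspose_smul, conjTranspose_add, conjTranspose_conjTranspose]
    rw [← neg_smul, add_comm X]; simp [neg_div])
  have h3 : ∀ g, D X g = D ((1/2 : ℂ) • (X - Xᴴ)) g +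
      (-Complex.I) * D ((Complex.I/2 : ℂ) • (X + Xᴴ)) g := by
    intro g
    rw [← h.smul, ← h.add]
    congr 1
    rw [smul_smul, smul_sub, smul_add]
    have : -Complex.I * (Complex.I / 2) = 1/2 := by
      rw [neg_mul, mul_div_assoc', Complex.I_mul_I]; norm_num
    rw [this, sub_add_add_cancel, ← add_smul]
    norm_num
  simp_rw [h3]
  rw [integral_add (integrable_cont μ (h.contD _))
    ((integrable_cont μ (h.contD _)).const_mul _), integral_const_mul, h1, h2]
  simp

end one

section two

set_option linter.unusedSimpArgs false

variable {n : ℕ}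

theorem HasD.congr {f : UU n → ℂ} {D D'} (h : HasD f D) (e : ∀ X g, D X g = D' X g) :
    HasD f D' := by
  have : D = D' := by funext X g; exact e X g
  rwa [← this]

theorem HasD.const (c : ℂ) : HasD (n := n) (fun _ => c) (fun _ _ => 0) where
  cont := continuous_const
  contD _ := continuous_const
  add := by simp
  smul := by simp
  deriv _ _ _ := hasDerivAt_const _ _

theorem HasD.conj {f : UU n → ℂ} {D} (h : HasD f D) :
    HasD (fun g => star (f g)) (fun X g => - star (D Xᴴ g)) where
  cont := h.cont.star
  contD X := (h.contD _).star.neg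
  add X Y g := by rw [conjTranspose_add, h.add, star_add, neg_add]
  smul c X g := by rw [conjTranspose_smul, h.smul]; simp
  deriv X hX g := by
    have h1 := (h.deriv X hX g).star
    have h2 : D Xᴴ g = - D X g := by
      rw [hX, ← neg_one_smul ℂ, h.smul]; simp
    rw [h2, star_neg, neg_neg]
    exact h1

theorem HasD.mul {f f' : UU n → ℂ} {D D'} (h : HasD f D) (h' : HasD f' D') :
    HasD (fun g => f g * f' g) (fun X g => D X g * f' g + f g * D' X g) where
  cont := h.cont.mul h'.cont
  contD X := ((h.contD X).mul h'.cont).add (h.cont.mul (h'.contD X))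
  add X Y g := by rw [h.add, h'.add]; ring
  smul c X g := by rw [h.smul, h'.smul]; ring
  deriv X hX g := by
    have := (h.deriv X hX g).fun_mul (h'.deriv X hX g)
    simp only [expU_zero, one_mul] at this
    exact this

theorem HasD.fadd {f f' : UU n → ℂ} {D D'} (h : HasD f D) (h' : HasD f' D') :
    HasD (fun g => f g + f' g) (fun X g => D X g + D' X g) where
  cont := h.cont.add h'.cont
  contD X := (h.contD X).add (h'.contD X)
  add X Y g := by rw [h.add, h'.add]; ring
  smul c X g := by rw [h.smul, h'.smul]; ring
  deriv X hX g := (h.deriv X hX g).add (h'.deriv X hX g)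

theorem HasD.sum {ι : Type*} (s : Finset ι) {f : ι → UU n → ℂ}
    {D : ι → Matrix (Fin n) (Fin n) ℂ → UU n → ℂ}
    (h : ∀ i, HasD (f i) (D i)) :
    HasD (fun g => ∑ i ∈ s, f i g) (fun X g => ∑ i ∈ s, D i X g) where
  cont := continuous_finsetSum _ fun i _ => (h i).cont
  contD X := continuous_finsetSum _ fun i _ => (h i).contD X
  add X Y g := by rw [← Finset.sum_add_distrib]; exact Finset.sum_congr rfl fun i _ => (h i).add _ _ _
  smul c X g := by rw [Finset.mul_sum]; exact Finset.sum_congr rfl fun i _ => (h i).smul _ _ _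
  deriv X hX g := HasDerivAt.fun_sum fun i _ => (h i).deriv X hX g

theorem HasD.cexp {f : UU n → ℂ} {D} (h : HasD f D) :
    HasD (fun g => Complex.exp (f g)) (fun X g => Complex.exp (f g) * D X g) where
  cont := Complex.continuous_exp.comp h.cont
  contD X := (Complex.continuous_exp.comp h.cont).mul (h.contD X)
  add X Y g := by rw [h.add]; ring
  smul c X g := by rw [h.smul]; ring
  deriv X hX g := by
    have := (h.deriv X hX g).cexp
    simpa [expU_zero] using this

/-- Matrix valued version of `HasD`. -/
def HasDM (M : UU n → Matrix (Fin n) (Fin n) ℂ)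
    (D : Matrix (Fin n) (Fin n) ℂ → UU n → Matrix (Fin n) (Fin n) ℂ) : Prop :=
  ∀ i j, HasD (fun g => M g i j) (fun X g => D X g i j)

theorem HasDM.mul {M M' : UU n → Matrix (Fin n) (Fin n) ℂ} {D D'}
    (h : HasDM M D) (h' : HasDM M' D') :
    HasDM (fun g => M g * M' g) (fun X g => D X g * M' g + M g * D' X g) := by
  intro i j
  have := HasD.sum Finset.univ fun k => (h i k).mul (h' k j)
  simp only [Matrix.add_apply, Matrix.mul_apply]
  refine this.congr ?_
  intro X g
  rw [Finset.sum_add_distrib]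

theorem HasDM.const (A : Matrix (Fin n) (Fin n) ℂ) : HasDM (fun _ => A) (fun _ _ => 0) :=
  fun i j => HasD.const (A i j)

theorem HasDM.mul_const {M : UU n → Matrix (Fin n) (Fin n) ℂ} {D}
    (h : HasDM M D) (A : Matrix (Fin n) (Fin n) ℂ) :
    HasDM (fun g => M g * A) (fun X g => D X g * A) := by
  intro i j
  refine ((h.mul (HasDM.const A)) i j).congr ?_
  intro X g
  simp

theorem HasDM.transpose {M : UU n → Matrix (Fin n) (Fin n) ℂ} {D}
    (h : HasDM M D) : HasDM (fun g => (M g)ᵀ) (fun X g => (D X g)ᵀ) :=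
  fun i j => h j i

theorem HasDM.trace {M : UU n → Matrix (Fin n) (Fin n) ℂ} {D}
    (h : HasDM M D) : HasD (fun g => (M g).trace) (fun X g => (D X g).trace) :=
  HasD.sum Finset.univ fun i => h i i

theorem HasDM.self : HasDM (n := n) (fun g => g.1) (fun X g => X * g.1) := by
  intro i j
  refine ⟨?_, ?_, ?_, ?_, ?_⟩
  · exact continuous_subtype_val.matrix_elem i j
  · exact fun X => (continuous_const.matrix_mul continuous_subtype_val).matrix_elem i j
  · intro X Y g; change ((X + Y) * g.1) i j = (X * g.1) i j + (Y * g.1) i j; rw [add_mul]; rfl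
  · intro c X g; change ((c • X) * g.1) i j = c * (X * g.1) i j; rw [smul_mul_assoc]; rfl
  · intro X hX g
    have : ∀ s : ℝ, (expU X hX s * g).1 i j = ∑ k, (expU X hX s).1 i k * g.1 k j := fun s => rfl
    simp_rw [this, Matrix.mul_apply]
    exact HasDerivAt.fun_sum fun k _ => (expU_deriv X hX i k).mul_const _

/-- The symmetric unitary `g gᵀ`. -/
def VV (g : UU n) : Matrix (Fin n) (Fin n) ℂ := g.1 * g.1ᵀ

theorem VV_symm (g : UU n) : (VV g)ᵀ = VV g := by simp [VV]

theorem VV_unit (g : UU n) : (VV g)ᴴ * VV g = 1 := by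
  have h1 : g.1ᴴ * g.1 = 1 := Matrix.mem_unitaryGroup_iff'.mp g.2
  have h2 : g.1ᵀᴴ * g.1ᵀ = 1 := by
    have h3 : g.1 * g.1ᴴ = 1 := Matrix.mem_unitaryGroup_iff.mp g.2
    have := congrArg Matrix.transpose h3
    rw [Matrix.transpose_mul, Matrix.transpose_one] at this
    exact this
  rw [VV, Matrix.conjTranspose_mul, mul_assoc, ← mul_assoc g.1ᴴ, h1, one_mul, h2]

theorem HasDM.V : HasDM (n := n) VV (fun X g => X * VV g + VV g * Xᵀ) := by
  intro i j
  refine ((HasDM.self.mul HasDM.self.transpose) i j).congr ?_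
  intro X g
  simp only [VV, Matrix.transpose_mul, mul_assoc]

theorem trace_single' (a b : Fin n) (K : Matrix (Fin n) (Fin n) ℂ) :
    (Matrix.single a b (1:ℂ) * K).trace = K b a := by
  simp [Matrix.trace, Matrix.mul_apply, Matrix.single, ite_and]

theorem ibp_sum (μ : Measure (UU n)) [IsProbabilityMeasure μ] [μ.IsMulLeftInvariant]
    {M : UU n → Matrix (Fin n) (Fin n) ℂ} {DM} (hM : HasDM M DM)
    {h : UU n → ℂ} {K : UU n → Matrix (Fin n) (Fin n) ℂ}
    (hh : HasD h (fun X g => (X * K g).trace)) :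
    ∫ g, ((∑ a, ∑ b, DM (Matrix.single a b 1) g a b) * h g + (M g * K g).trace) ∂μ = 0 := by
  have e : ∀ a b, ∫ g, (DM (Matrix.single a b 1) g a b * h g +
      M g a b * (Matrix.single a b (1:ℂ) * K g).trace) ∂μ = 0 := fun a b =>
    ((hM a b).mul hh).ibp μ (Matrix.single a b 1)
  have c : ∀ a b, Continuous fun g => (DM (Matrix.single a b 1) g a b * h g +
      M g a b * (Matrix.single a b (1:ℂ) * K g).trace) := fun a b =>
    ((hM a b).mul hh).contD (Matrix.single a b 1)
  have : ∀ g, ((∑ a, ∑ b, DM (Matrix.single a b 1) g a b) * h g + (M g * K g).trace) =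
      ∑ a : Fin n, ∑ b : Fin n, (DM (Matrix.single a b 1) g a b * h g +
      M g a b * (Matrix.single a b (1:ℂ) * K g).trace) := by
    intro g
    simp_rw [Finset.sum_add_distrib, Finset.sum_mul]
    congr 1
    simp only [trace_single']
    simp [Matrix.trace, Matrix.mul_apply]
  simp_rw [this]
  rw [integral_finsetSum _ fun a _ =>
    integrable_cont μ (continuous_finsetSum _ fun b _ => c a b)]
  refine Finset.sum_eq_zero fun a _ => ?_
  rw [integral_finsetSum _ fun b _ => integrable_cont μ (c a b)]
  exact Finset.sum_eq_zero fun b _ => e a b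

theorem sum_single (P Q : Matrix (Fin n) (Fin n) ℂ) :
    ∑ a : Fin n, ∑ b : Fin n, (P * Matrix.single a b 1 * Q : Matrix (Fin n) (Fin n) ℂ) a b = P.trace * Q.trace := by
  simp [Matrix.trace, Finset.sum_mul_sum, Matrix.mul_apply, Matrix.single, ite_and]

theorem sum_singleT (P Q : Matrix (Fin n) (Fin n) ℂ) :
    ∑ a : Fin n, ∑ b : Fin n, (P * (Matrix.single a b 1)ᵀ * Q : Matrix (Fin n) (Fin n) ℂ) a b = (P * Qᵀ).trace := by
  simp [Matrix.trace, Matrix.mul_apply, Matrix.single, ite_and]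

theorem sum_DVA (A : Matrix (Fin n) (Fin n) ℂ) (hA : Aᵀ = A) (g : UU n) :
    ∑ a : Fin n, ∑ b : Fin n, (((Matrix.single a b 1 : Matrix (Fin n) (Fin n) ℂ) * VV g +
      VV g * (Matrix.single a b 1)ᵀ) * A : Matrix (Fin n) (Fin n) ℂ) a b = (n + 1) * (VV g * A).trace := by
  have h1 := sum_single 1 (VV g * A)
  have h2 := sum_singleT (VV g) A
  rw [hA] at h2
  simp only [one_mul, ← mul_assoc, Matrix.trace_one, Fintype.card_fin] at h1
  simp only [add_mul, Matrix.add_apply, Finset.sum_add_distrib, h1, h2]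
  ring

theorem sum_DVAVA (A : Matrix (Fin n) (Fin n) ℂ) (hA : Aᵀ = A) (g : UU n) :
    ∑ a : Fin n, ∑ b : Fin n, ((((Matrix.single a b 1 : Matrix (Fin n) (Fin n) ℂ) * VV g +
      VV g * (Matrix.single a b 1)ᵀ) * A) * (VV g * A) +
      (VV g * A) * (((Matrix.single a b 1 : Matrix (Fin n) (Fin n) ℂ) * VV g +
      VV g * (Matrix.single a b 1)ᵀ) * A) : Matrix (Fin n) (Fin n) ℂ) a b =
      (n + 2) * (VV g * A * (VV g * A)).trace + (VV g * A).trace ^ 2 := by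
  have h1 := sum_single 1 (VV g * A * (VV g * A))
  have h2 := sum_singleT (VV g) (A * (VV g * A))
  have h3 := sum_single (VV g * A) (VV g * A)
  have h4 := sum_singleT (VV g * A * VV g) A
  simp only [one_mul, ← mul_assoc, Matrix.trace_one, Fintype.card_fin,
    Matrix.transpose_mul, hA, VV_symm] at h1 h2 h3 h4
  simp only [add_mul, mul_add, ← mul_assoc, Matrix.add_apply, Finset.sum_add_distrib,
    h1, h2, h3, h4]
  ring

theorem HasD.Z (A : Matrix (Fin n) (Fin n) ℂ) (hA : Aᵀ = A) :
    HasD (fun g : UU n => (VV g * A).trace) (fun X g => (X * ((2:ℂ) • (VV g * A))).trace) := by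
  refine (HasDM.V.mul_const A).trace.congr ?_
  intro X g
  have : (VV g * Xᵀ * A).trace = (X * (VV g * A)).trace := by
    rw [← Matrix.trace_transpose]
    simp only [Matrix.transpose_mul, Matrix.transpose_transpose, hA, VV_symm]
    rw [Matrix.trace_mul_comm, mul_assoc]
  rw [add_mul, Matrix.trace_add, this, mul_smul_comm, Matrix.trace_smul, mul_assoc, smul_eq_mul]
  ring

theorem HasD.F (A : Matrix (Fin n) (Fin n) ℂ) (hA : Aᵀ = A) :
    HasD (fun g : UU n => (VV g * A * (VV g * A)).trace)
      (fun X g => (X * ((4:ℂ) • (VV g * A * (VV g * A)))).trace) := by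
  refine ((HasDM.V.mul_const A).mul (HasDM.V.mul_const A)).trace.congr ?_
  intro X g
  have : (VV g * Xᵀ * A * (VV g * A)).trace = (X * (VV g * A * (VV g * A))).trace := by
    rw [← Matrix.trace_transpose]
    simp only [Matrix.transpose_mul, Matrix.transpose_transpose, hA, VV_symm]
    rw [← mul_assoc, ← mul_assoc, mul_assoc _ X, Matrix.trace_mul_comm]
    simp only [mul_assoc]
  rw [Matrix.trace_add, Matrix.trace_mul_comm (VV g * A), add_mul, add_mul, Matrix.trace_add,
    this, mul_smul_comm, Matrix.trace_smul, mul_assoc X, mul_assoc X, smul_eq_mul]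
  ring

theorem HasD.conjK {f : UU n → ℂ} {K : UU n → Matrix (Fin n) (Fin n) ℂ}
    (h : HasD f (fun X g => (X * K g).trace)) :
    HasD (fun g => star (f g)) (fun X g => (X * (-(K g)ᴴ)).trace) := by
  refine h.conj.congr ?_
  intro X g
  rw [← Matrix.trace_conjTranspose, Matrix.conjTranspose_mul, Matrix.conjTranspose_conjTranspose,
    Matrix.trace_mul_comm, mul_neg, Matrix.trace_neg]

end two

section three

variable {n : ℕ}

/-- Squared Frobenius norm. -/
noncomputable def SS (M : Matrix (Fin n) (Fin n) ℂ) : ℝ := ∑ i, ∑ j, ‖M i j‖ ^ 2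

theorem SS_nonneg (M : Matrix (Fin n) (Fin n) ℂ) : 0 ≤ SS M :=
  Finset.sum_nonneg fun _ _ => Finset.sum_nonneg fun _ _ => sq_nonneg _

theorem trace_SS (M : Matrix (Fin n) (Fin n) ℂ) : (M * Mᴴ).trace = (SS M : ℂ) := by
  simp only [Matrix.trace, Matrix.diag_apply, Matrix.mul_apply, Matrix.conjTranspose_apply, SS]
  push_cast
  refine Finset.sum_congr rfl fun i _ => Finset.sum_congr rfl fun j _ => ?_
  rw [← Complex.mul_conj']
  rfl

theorem cs_sum {ι : Type*} (s : Finset ι) (a b : ι → ℂ) :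
    ‖∑ i ∈ s, a i * b i‖ ^ 2 ≤ (∑ i ∈ s, ‖a i‖ ^ 2) * ∑ i ∈ s, ‖b i‖ ^ 2 := by
  calc ‖∑ i ∈ s, a i * b i‖ ^ 2 ≤ (∑ i ∈ s, ‖a i‖ * ‖b i‖) ^ 2 := by
        gcongr
        refine (norm_sum_le _ _).trans (le_of_eq ?_)
        simp
    _ ≤ _ := Finset.sum_mul_sq_le_sq_mul_sq _ _ _

theorem SS_mul (P Q : Matrix (Fin n) (Fin n) ℂ) : SS (P * Q) ≤ SS P * SS Q := by
  have : SS P * SS Q = ∑ i, ∑ j, (∑ k, ‖P i k‖ ^ 2) * ∑ k, ‖Q k j‖ ^ 2 := by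
    unfold SS
    rw [Finset.sum_comm (f := fun i j => ‖Q i j‖ ^ 2), Finset.sum_mul_sum]
  rw [this]
  unfold SS
  refine Finset.sum_le_sum fun i _ => Finset.sum_le_sum fun j _ => ?_
  rw [Matrix.mul_apply]
  exact cs_sum _ _ _

theorem tr_mul_le (P Q : Matrix (Fin n) (Fin n) ℂ) : ‖(P * Q).trace‖ ^ 2 ≤ SS P * SS Q := by
  have h1 : (P * Q).trace = ∑ p : Fin n × Fin n, P p.1 p.2 * Q p.2 p.1 := by
    rw [Fintype.sum_prod_type]
    simp [Matrix.trace, Matrix.mul_apply]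
  have h2 : SS P = ∑ p : Fin n × Fin n, ‖P p.1 p.2‖ ^ 2 := by
    rw [Fintype.sum_prod_type]; rfl
  have h3 : SS Q = ∑ p : Fin n × Fin n, ‖Q p.2 p.1‖ ^ 2 := by
    rw [Fintype.sum_prod_type, Finset.sum_comm]; rfl
  rw [h1, h2, h3]
  exact cs_sum _ _ _

theorem SS_V (A : Matrix (Fin n) (Fin n) ℂ) (g : UU n) : SS (VV g * A) = SS A := by
  apply Complex.ofReal_injective
  rw [← trace_SS, ← trace_SS, Matrix.trace_mul_comm, Matrix.conjTranspose_mul, mul_assoc,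
    ← mul_assoc _ (VV g), VV_unit, one_mul, Matrix.trace_mul_comm]

/-- `Tr(VA)` -/
noncomputable def ZZ (A : Matrix (Fin n) (Fin n) ℂ) (g : UU n) : ℂ := (VV g * A).trace

/-- `Tr(VAVA)` -/
noncomputable def FF (A : Matrix (Fin n) (Fin n) ℂ) (g : UU n) : ℂ :=
  (VV g * A * (VV g * A)).trace

theorem FF_le (A : Matrix (Fin n) (Fin n) ℂ) (g : UU n) : ‖FF A g‖ ≤ SS A := by
  have := tr_mul_le (VV g * A) (VV g * A)
  rw [SS_V, ← sq (SS A)] at this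
  exact abs_le_of_sq_le_sq' this (SS_nonneg A) |>.2

theorem SS_VAVA_le (A : Matrix (Fin n) (Fin n) ℂ) (g : UU n) :
    SS (VV g * A * (VV g * A)) ≤ SS A ^ 2 := by
  have := SS_mul (VV g * A) (VV g * A)
  rwa [SS_V, ← sq (SS A)] at this

theorem ZZ_cont (A : Matrix (Fin n) (Fin n) ℂ) (hA : Aᵀ = A) : Continuous (ZZ A) := (HasD.Z A hA).cont

theorem FF_cont (A : Matrix (Fin n) (Fin n) ℂ) (hA : Aᵀ = A) : Continuous (FF A) := (HasD.F A hA).cont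

theorem E1 (A : Matrix (Fin n) (Fin n) ℂ) (hA : Aᵀ = A)
    (μ : Measure (UU n)) [IsProbabilityMeasure μ] [μ.IsMulLeftInvariant] : (n + 1) * ∫ g, ‖ZZ A g‖ ^ 2 ∂μ = 2 * SS A := by
  have h := ibp_sum μ (HasDM.V.mul_const A) (HasD.Z A hA).conjK
  have e : ∀ g : UU n, (∑ a : Fin n, ∑ b : Fin n,
      (((Matrix.single a b 1 : Matrix (Fin n) (Fin n) ℂ) * VV g +
      VV g * (Matrix.single a b 1)ᵀ) * A : Matrix (Fin n) (Fin n) ℂ) a b) *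
      star ((VV g * A).trace) + (VV g * A * (-((2:ℂ) • (VV g * A))ᴴ)).trace =
      (((n + 1) * ‖ZZ A g‖ ^ 2 - 2 * SS A : ℝ) : ℂ) := by
    intro g
    rw [sum_DVA A hA, Matrix.conjTranspose_smul, mul_neg, Matrix.trace_neg, mul_smul_comm,
      Matrix.trace_smul, trace_SS, SS_V, mul_assoc]
    have : (VV g * A).trace * star (VV g * A).trace = (‖ZZ A g‖ : ℂ) ^ 2 := Complex.mul_conj' _
    rw [this]
    push_cast
    simp
    ring
  simp_rw [e] at h
  rw [integral_complex_ofReal, Complex.ofReal_eq_zero, integral_sub, integral_const_mul] at h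
  · simp at h; linarith
  · exact (integrable_cont μ ((ZZ_cont A hA).norm.pow 2)).const_mul _
  · exact integrable_const _

theorem E2 (A : Matrix (Fin n) (Fin n) ℂ) (hA : Aᵀ = A)
    (μ : Measure (UU n)) [IsProbabilityMeasure μ] [μ.IsMulLeftInvariant] : (n + 2) * ∫ g, ‖FF A g‖ ^ 2 ∂μ ≤ 6 * SS A ^ 2 := by
  have h := ibp_sum μ ((HasDM.V.mul_const A).mul (HasDM.V.mul_const A)) (HasD.F A hA).conjK
  have e : ∀ g : UU n, (∑ a : Fin n, ∑ b : Fin n,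
      ((((Matrix.single a b 1 : Matrix (Fin n) (Fin n) ℂ) * VV g +
      VV g * (Matrix.single a b 1)ᵀ) * A) * (VV g * A) +
      (VV g * A) * (((Matrix.single a b 1 : Matrix (Fin n) (Fin n) ℂ) * VV g +
      VV g * (Matrix.single a b 1)ᵀ) * A) : Matrix (Fin n) (Fin n) ℂ) a b) *
      star ((VV g * A * (VV g * A)).trace) +
      (VV g * A * (VV g * A) * (-((4:ℂ) • (VV g * A * (VV g * A)))ᴴ)).trace =
      (((n + 2) * ‖FF A g‖ ^ 2 - 4 * SS (VV g * A * (VV g * A)) : ℝ) : ℂ) +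
        ZZ A g ^ 2 * star (FF A g) := by
    intro g
    rw [sum_DVAVA A hA, Matrix.conjTranspose_smul, mul_neg, Matrix.trace_neg, mul_smul_comm,
      Matrix.trace_smul, trace_SS, add_mul, mul_assoc ((n : ℂ) + 2)]
    have : (VV g * A * (VV g * A)).trace * star (VV g * A * (VV g * A)).trace =
      (‖FF A g‖ : ℂ) ^ 2 := Complex.mul_conj' _
    rw [this]
    push_cast
    simp [ZZ, FF]
    ring
  simp_rw [e] at h
  have cS : Continuous fun g : UU n => SS (VV g * A * (VV g * A)) := by
    unfold SS
    have := (HasDM.V.mul_const A).mul (HasDM.V.mul_const A)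
    exact continuous_finsetSum _ fun i _ => continuous_finsetSum _ fun j _ =>
      (this i j).cont.norm.pow 2
  have cF := FF_cont A hA
  have cZ := ZZ_cont A hA
  have cI : Continuous fun g => (((n + 2) * ‖FF A g‖ ^ 2 -
        4 * SS (VV g * A * (VV g * A)) : ℝ) : ℂ) + ZZ A g ^ 2 * star (FF A g) := by
    fun_prop
  have h2 : ∫ g, ((((n + 2) * ‖FF A g‖ ^ 2 -
        4 * SS (VV g * A * (VV g * A)) : ℝ) : ℂ) + ZZ A g ^ 2 * star (FF A g)).re ∂μ = 0 := by
    have := integral_re (integrable_cont μ cI)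
    rw [h] at this
    simpa using this
  have h3 : ∫ g, ((n + 2) * ‖FF A g‖ ^ 2 - SS A * ‖ZZ A g‖ ^ 2 - 4 * SS A ^ 2) ∂μ ≤ 0 := by
    rw [← h2]
    refine integral_mono (integrable_cont μ (by fun_prop))
      (integrable_cont μ (Complex.continuous_re.comp cI)) ?_
    intro g
    simp only [Complex.add_re, Complex.ofReal_re]
    have a1 := SS_VAVA_le A g
    have a2 : -(SS A * ‖ZZ A g‖ ^ 2) ≤ (ZZ A g ^ 2 * star (FF A g)).re := by
      have b1 := Complex.abs_re_le_norm (ZZ A g ^ 2 * star (FF A g))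
      have b2 : ‖ZZ A g ^ 2 * star (FF A g)‖ = ‖ZZ A g‖ ^ 2 * ‖FF A g‖ := by simp
      have b3 : ‖ZZ A g‖ ^ 2 * ‖FF A g‖ ≤ ‖ZZ A g‖ ^ 2 * SS A := by
        gcongr; exact FF_le A g
      have b4 := neg_abs_le (ZZ A g ^ 2 * star (FF A g)).re
      linarith
    linarith
  rw [integral_sub (integrable_cont μ (by fun_prop)) (integrable_const _),
    integral_sub (integrable_cont μ (by fun_prop)) (integrable_cont μ (by fun_prop)),
    integral_const_mul, integral_const_mul] at h3
  simp only [integral_const, probReal_univ, smul_eq_mul, one_mul] at h3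
  have e1 := E1 A hA μ
  have e2 : ∫ g, ‖ZZ A g‖ ^ 2 ∂μ ≤ 2 * SS A := by
    rw [← e1]
    have : 0 ≤ ∫ g, ‖ZZ A g‖ ^ 2 ∂μ := integral_nonneg fun _ => sq_nonneg _
    have : 0 ≤ (n : ℝ) * ∫ g, ‖ZZ A g‖ ^ 2 ∂μ := by positivity
    linarith
  have e3 := mul_le_mul_of_nonneg_left e2 (SS_nonneg A)
  linarith

theorem E3 (A : Matrix (Fin n) (Fin n) ℂ) (hA : Aᵀ = A)
    (μ : Measure (UU n)) [IsProbabilityMeasure μ] [μ.IsMulLeftInvariant] : ∫ g, ‖FF A g‖ ∂μ ≤ SS A * √(6 / (n + 2)) := by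
  have cF := FF_cont A hA
  set m := ∫ g, ‖FF A g‖ ∂μ with hm
  have h1 : 0 ≤ ∫ g, (‖FF A g‖ ^ 2 - 2 * m * ‖FF A g‖ + m ^ 2) ∂μ := by
    refine integral_nonneg fun g => ?_
    have := sq_nonneg (‖FF A g‖ - m)
    simp only [Pi.zero_apply]
    linarith
  rw [integral_add (integrable_cont μ (by fun_prop)) (integrable_const _),
    integral_sub (integrable_cont μ (by fun_prop)) (integrable_cont μ (by fun_prop)),
    integral_const_mul, ← hm] at h1
  simp only [integral_const, probReal_univ, smul_eq_mul, one_mul] at h1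
  have h2 := E2 A hA μ
  have hn : (0:ℝ) < n + 2 := by positivity
  have h3 : m ^ 2 ≤ SS A ^ 2 * (6 / (n + 2)) := by
    rw [mul_div_assoc', le_div_iff₀ hn]
    nlinarith
  refine abs_le_of_sq_le_sq' ?_ (mul_nonneg (SS_nonneg A) (Real.sqrt_nonneg _)) |>.2
  rw [mul_pow, Real.sq_sqrt (by positivity)]
  exact h3

/-- The exponential `exp(i t Re Z)`. -/
noncomputable def hh (A : Matrix (Fin n) (Fin n) ℂ) (t : ℝ) (g : UU n) : ℂ := Complex.exp (t * (ZZ A g).re * Complex.I)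

theorem norm_hh (A : Matrix (Fin n) (Fin n) ℂ) (t : ℝ) (g : UU n) : ‖hh A t g‖ = 1 := by
  unfold hh
  rw [← Complex.ofReal_mul]
  exact Complex.norm_exp_ofReal_mul_I _

theorem hh_cont (A : Matrix (Fin n) (Fin n) ℂ) (hA : Aᵀ = A) (t : ℝ) : Continuous (hh A t) := by
  have := ZZ_cont A hA
  unfold hh
  fun_prop

theorem HasD.h (A : Matrix (Fin n) (Fin n) ℂ) (hA : Aᵀ = A) (t : ℝ) : HasD (hh A t)
    (fun X g => (X * ((t * Complex.I * hh A t g) • (VV g * A - (VV g * A)ᴴ))).trace) := by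
  have h1 := HasD.Z A hA
  have h2 := ((HasD.const (n := n) (t / 2 * Complex.I)).mul (h1.fadd h1.conjK)).cexp
  have e : hh A t = fun g => Complex.exp (t / 2 * Complex.I *
      ((VV g * A).trace + star (VV g * A).trace)) := by
    funext g
    unfold hh
    congr 1
    have : (VV g * A).trace + star (VV g * A).trace = (2 * (ZZ A g).re : ℝ) :=
      Complex.add_conj _
    rw [this]
    push_cast
    ring
  rw [e]
  refine h2.congr fun X g => ?_
  simp only [Matrix.conjTranspose_smul, mul_neg, mul_smul_comm, Matrix.trace_smul,
    Matrix.trace_neg, mul_sub, Matrix.trace_sub, smul_eq_mul, star_ofNat]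
  ring

theorem E4 (A : Matrix (Fin n) (Fin n) ℂ) (hA : Aᵀ = A)
    (μ : Measure (UU n)) [IsProbabilityMeasure μ] [μ.IsMulLeftInvariant] (t : ℝ) : (n + 1) * ∫ g, ZZ A g * hh A t g ∂μ =
    t * Complex.I * (SS A * ∫ g, hh A t g ∂μ - ∫ g, FF A g * hh A t g ∂μ) := by
  have h := ibp_sum μ (HasDM.V.mul_const A) (HasD.h A hA t)
  have cF := FF_cont A hA
  have cZ := ZZ_cont A hA
  have ch := hh_cont A hA t
  have e : ∀ g : UU n, (∑ a : Fin n, ∑ b : Fin n,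
      (((Matrix.single a b 1 : Matrix (Fin n) (Fin n) ℂ) * VV g +
      VV g * (Matrix.single a b 1)ᵀ) * A : Matrix (Fin n) (Fin n) ℂ) a b) *
      hh A t g +
      (VV g * A * ((t * Complex.I * hh A t g) • (VV g * A - (VV g * A)ᴴ))).trace =
      (n + 1) * (ZZ A g * hh A t g) - t * Complex.I * (SS A * hh A t g - FF A g * hh A t g) := by
    intro g
    rw [sum_DVA A hA, mul_smul_comm, Matrix.trace_smul, mul_sub, Matrix.trace_sub, trace_SS, SS_V]
    simp only [smul_eq_mul, ZZ, FF]
    ring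
  simp_rw [e] at h
  rw [integral_sub (integrable_cont μ (by fun_prop)) (integrable_cont μ (by fun_prop)),
    integral_const_mul, integral_const_mul,
    integral_sub (integrable_cont μ (by fun_prop)) (integrable_cont μ (by fun_prop)),
    integral_const_mul] at h
  linear_combination h

theorem E5 (A : Matrix (Fin n) (Fin n) ℂ) (hA : Aᵀ = A)
    (μ : Measure (UU n)) [IsProbabilityMeasure μ] [μ.IsMulLeftInvariant] (t : ℝ) : ‖∫ g, ZZ A g * hh A t g ∂μ -
      t * Complex.I * (SS A / (n + 1)) * ∫ g, hh A t g ∂μ‖ ≤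
      |t| * (SS A / (n + 1) * √(6 / (n + 2))) := by
  have h := E4 A hA μ t
  have hn : ((n : ℂ) + 1) ≠ 0 := by exact_mod_cast Nat.succ_ne_zero n
  have e : ∫ g, ZZ A g * hh A t g ∂μ - t * Complex.I * (SS A / (n + 1)) * ∫ g, hh A t g ∂μ =
      - (t * Complex.I * ∫ g, FF A g * hh A t g ∂μ) / (n + 1) := by
    rw [eq_div_iff hn]
    field_simp
    linear_combination h
  have h2 : ‖∫ g, FF A g * hh A t g ∂μ‖ ≤ ∫ g, ‖FF A g‖ ∂μ := by
    refine (norm_integral_le_integral_norm _).trans (le_of_eq ?_)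
    simp [norm_hh]
  have h3 := h2.trans (E3 A hA μ)
  have hn' : ‖(n : ℂ) + 1‖ = (n : ℝ) + 1 := by
    have : ((n : ℂ) + 1) = ((n + 1 : ℝ) : ℂ) := by push_cast; rfl
    rw [this, Complex.norm_real, Real.norm_of_nonneg (by positivity)]
  rw [e, norm_div, norm_neg, norm_mul, norm_mul, Complex.norm_I, mul_one, Complex.norm_real,
    Real.norm_eq_abs, hn', mul_div_assoc]
  gcongr
  rw [div_mul_eq_mul_div]
  gcongr

/-- characteristic function -/
noncomputable def phi (A : Matrix (Fin n) (Fin n) ℂ) (μ : Measure (UU n)) (t : ℝ) : ℂ := ∫ g, hh A t g ∂μ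

theorem phi_deriv (A : Matrix (Fin n) (Fin n) ℂ) (hA : Aᵀ = A)
    (μ : Measure (UU n)) [IsProbabilityMeasure μ] (t : ℝ) :
    HasDerivAt (phi A μ) (Complex.I * ∫ g, (ZZ A g).re * hh A t g ∂μ) t := by
  have cZ := ZZ_cont A hA
  obtain ⟨C, hC⟩ := isCompact_univ.exists_bound_of_continuousOn cZ.continuousOn
  rw [← integral_const_mul]
  refine (hasDerivAt_integral_of_dominated_loc_of_deriv_le (μ := μ) (𝕜 := ℝ)
    (F := fun t g => hh A t g) (F' := fun t g => Complex.I * ((ZZ A g).re * hh A t g)) (x₀ := t)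
    (bound := fun _ => C) (s := Set.univ) Filter.univ_mem
    (Filter.Eventually.of_forall fun s => (hh_cont A hA s).aestronglyMeasurable)
    (integrable_cont μ (hh_cont A hA t)) ?_ ?_ (integrable_const _) ?_).2
  · have := hh_cont A hA t
    exact Continuous.aestronglyMeasurable (by fun_prop)
  · refine Filter.Eventually.of_forall fun g s _ => ?_
    rw [norm_mul, Complex.norm_I, one_mul, norm_mul, norm_hh, mul_one, Complex.norm_real]
    exact (Complex.abs_re_le_norm _).trans (hC g (Set.mem_univ _))
  · refine Filter.Eventually.of_forall fun g s _ => ?_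
    unfold hh
    have h1 : HasDerivAt (fun s : ℝ => (s : ℂ) * (ZZ A g).re * Complex.I)
        (1 * (ZZ A g).re * Complex.I) s :=
      ((Complex.ofRealCLM.hasDerivAt (x := s)).mul_const _).mul_const _
    refine h1.cexp.congr_deriv ?_
    ring

theorem phi_ode (A : Matrix (Fin n) (Fin n) ℂ) (hA : Aᵀ = A)
    (μ : Measure (UU n)) [IsProbabilityMeasure μ] [μ.IsMulLeftInvariant] (t : ℝ) :
    ‖Complex.I * ∫ g, (ZZ A g).re * hh A t g ∂μ + t * (SS A / (n + 1)) * phi A μ t‖ ≤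
      |t| * (SS A / (n + 1) * √(6 / (n + 2))) := by
  have cZ := ZZ_cont A hA
  have ch := hh_cont A hA t
  have h1 := E5 A hA μ t
  have h2 := E5 A hA μ (-t)
  rw [← norm_star] at h2
  have hs : ∀ g, star (hh A (-t) g) = hh A t g := by
    intro g
    unfold hh
    change (starRingEnd ℂ) _ = _
    rw [← Complex.exp_conj]
    simp
  have e1 : star (∫ g, ZZ A g * hh A (-t) g ∂μ -
      ((-t : ℝ) : ℂ) * Complex.I * (SS A / (n + 1)) * ∫ g, hh A (-t) g ∂μ) =
      ∫ g, star (ZZ A g) * hh A t g ∂μ -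
      t * Complex.I * (SS A / (n + 1)) * ∫ g, hh A t g ∂μ := by
    have a1 : star (∫ g, ZZ A g * hh A (-t) g ∂μ) = ∫ g, star (ZZ A g) * hh A t g ∂μ := by
      have := integral_conj (μ := μ) (f := fun g => ZZ A g * hh A (-t) g)
      refine this.symm.trans (integral_congr_ae (Filter.Eventually.of_forall fun g => ?_))
      simp only [map_mul]
      congr 1
      exact hs g
    have a2 : star (∫ g, hh A (-t) g ∂μ) = ∫ g, hh A t g ∂μ := by
      have := integral_conj (μ := μ) (f := fun g => hh A (-t) g)
      exact this.symm.trans (integral_congr_ae (Filter.Eventually.of_forall fun g => hs g))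
    rw [star_sub, a1, star_mul', a2]
    congr 2
    simp
  rw [e1, abs_neg] at h2
  have e2 : ∀ g, ((ZZ A g).re : ℂ) * hh A t g =
      (1 / 2 : ℂ) * (ZZ A g * hh A t g + star (ZZ A g) * hh A t g) := by
    intro g
    have : ZZ A g + star (ZZ A g) = (2 * (ZZ A g).re : ℝ) := Complex.add_conj _
    rw [← add_mul, this]
    push_cast
    ring
  simp_rw [e2]
  rw [integral_const_mul,
    integral_add (integrable_cont μ (by fun_prop)) (integrable_cont μ (by fun_prop))]
  unfold phi
  set a := ∫ g, ZZ A g * hh A t g ∂μ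
  set b := ∫ g, star (ZZ A g) * hh A t g ∂μ
  set p := ∫ g, hh A t g ∂μ
  have e3 : Complex.I * (1 / 2 * (a + b)) + t * (SS A / (n + 1)) * p =
      Complex.I * (1 / 2) * ((a - t * Complex.I * (SS A / (n + 1)) * p) +
        (b - t * Complex.I * (SS A / (n + 1)) * p)) := by
    have := Complex.I_mul_I
    linear_combination (t * (SS A / (n + 1)) * p) * this
  rw [e3, norm_mul]
  have e4 : ‖Complex.I * (1 / 2)‖ = 1 / 2 := by simp
  rw [e4]
  have := norm_add_le (a - t * Complex.I * (SS A / (n + 1)) * p)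
        (b - t * Complex.I * (SS A / (n + 1)) * p)
  linarith

theorem phi_one (A : Matrix (Fin n) (Fin n) ℂ) (hA : Aᵀ = A)
    (μ : Measure (UU n)) [IsProbabilityMeasure μ] [μ.IsMulLeftInvariant] : ‖phi A μ 1 - Complex.exp (-(SS A / (n + 1) : ℝ) / 2)‖ ≤
    SS A / (n + 1) * √(6 / (n + 2)) := by
  set a : ℝ := SS A / (n + 1) with ha
  set ε : ℝ := a * √(6 / (n + 2)) with hε
  have ha0 : 0 ≤ a := div_nonneg (SS_nonneg A) (by positivity)
  have hε0 : 0 ≤ ε := mul_nonneg ha0 (Real.sqrt_nonneg _)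
  have hd : ∀ t : ℝ, HasDerivAt (fun t : ℝ => phi A μ t * Complex.exp (a * t ^ 2 / 2))
      ((Complex.I * ∫ g, (ZZ A g).re * hh A t g ∂μ + t * a * phi A μ t) *
        Complex.exp (a * t ^ 2 / 2)) t := by
    intro t
    have h1 : HasDerivAt (fun t : ℝ => (a : ℂ) * (t : ℂ) ^ 2 / 2) ((a : ℂ) * (t : ℂ)) t := by
      have h0 : HasDerivAt (fun t : ℝ => a * t ^ 2 / 2) (a * t) t := by
        have := (((hasDerivAt_id t).pow 2).const_mul a).div_const 2
        refine this.congr_deriv ?_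
        simp only [id_eq, Nat.cast_ofNat, Nat.add_one_sub_one, pow_one, mul_one]
        ring
      have := h0.ofReal_comp
      push_cast at this
      exact this
    refine ((phi_deriv A hA μ t).fun_mul h1.cexp).congr_deriv ?_
    ring
  have hb : ∀ t ∈ Set.Icc (0:ℝ) 1, ‖(Complex.I * ∫ g, (ZZ A g).re * hh A t g ∂μ +
      t * a * phi A μ t) * Complex.exp (a * t ^ 2 / 2)‖ ≤ ε * Real.exp (a / 2) := by
    intro t ht
    have h1 := phi_ode A hA μ t
    rw [norm_mul]
    have h2 : ‖Complex.exp ((a : ℂ) * t ^ 2 / 2)‖ ≤ Real.exp (a / 2) := by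
      have : (a : ℂ) * t ^ 2 / 2 = ((a * t ^ 2 / 2 : ℝ) : ℂ) := by push_cast; rfl
      rw [this, ← Complex.ofReal_exp, Complex.norm_real, Real.norm_of_nonneg (Real.exp_nonneg _)]
      gcongr
      have : t ^ 2 ≤ 1 := pow_le_one₀ ht.1 ht.2
      nlinarith
    refine mul_le_mul ?_ h2 (norm_nonneg _) hε0
    have h3 : |t| * ε ≤ ε := by
      rw [abs_of_nonneg ht.1]
      nlinarith [ht.2]
    refine le_trans ?_ h3
    have h4 : ((a : ℝ) : ℂ) = (SS A : ℂ) / (n + 1) := by rw [ha]; push_cast; rfl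
    rw [h4]
    exact h1
  have hm := (convex_Icc (0:ℝ) 1).norm_image_sub_le_of_norm_hasDerivWithin_le
    (fun t _ => (hd t).hasDerivWithinAt) hb (Set.left_mem_Icc.2 zero_le_one)
    (Set.right_mem_Icc.2 zero_le_one)
  have p0 : phi A μ 0 = 1 := by simp [phi, hh]
  simp only [p0] at hm
  have e : phi A μ 1 - Complex.exp (-(a : ℝ) / 2) =
      (phi A μ 1 * Complex.exp (a / 2) - 1) * Complex.exp (-(a : ℝ) / 2) := by
    rw [sub_mul, mul_assoc, ← Complex.exp_add, neg_div, add_neg_cancel, Complex.exp_zero]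
    ring
  have e2 : ‖Complex.exp (-(a : ℂ) / 2)‖ = Real.exp (-a / 2) := by
    have : -(a : ℂ) / 2 = ((-a / 2 : ℝ) : ℂ) := by push_cast; rfl
    rw [this, ← Complex.ofReal_exp, Complex.norm_real, Real.norm_of_nonneg (Real.exp_nonneg _)]
  rw [e, norm_mul, e2]
  have hm' : ‖phi A μ 1 * Complex.exp (a / 2) - 1‖ ≤ ε * Real.exp (a / 2) := by
    simpa using hm
  calc _ ≤ ε * Real.exp (a / 2) * Real.exp (-a / 2) := by gcongr
    _ = ε := by rw [mul_assoc, ← Real.exp_add, neg_div, add_neg_cancel, Real.exp_zero, mul_one]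

end three

section four

theorem SS_eq {n : ℕ} (M : Matrix (Fin n) (Fin n) ℂ) : SS M = (M * Mᴴ).trace.re := by
  rw [trace_SS, Complex.ofReal_re]

theorem phi_tendsto (B : (n : ℕ) → Matrix (Fin n) (Fin n) ℂ) (hB : ∀ n, (B n)ᵀ = B n)
    (μ : (n : ℕ) → Measure (UU n)) (hprob : ∀ n, IsProbabilityMeasure (μ n))
    (hinv : ∀ n, (μ n).IsMulLeftInvariant) (σ : ℝ)
    (hσ : Tendsto (fun n : ℕ => (1 / (n : ℝ)) * SS (B n)) atTop (𝓝 σ)) :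
    Tendsto (fun n => phi (B n) (μ n) 1) atTop (𝓝 (Complex.exp (-(σ : ℂ) / 2))) := by
  have h1 : Tendsto (fun n : ℕ => SS (B n) / (n + 1)) atTop (𝓝 σ) := by
    have := hσ.mul (tendsto_natCast_div_add_atTop (𝕜 := ℝ) 1)
    rw [mul_one] at this
    refine this.congr' ?_
    filter_upwards [eventually_gt_atTop 0] with n hn
    have : (n : ℝ) ≠ 0 := by positivity
    field_simp
  have h2 : Tendsto (fun n : ℕ => √(6 / ((n : ℝ) + 2))) atTop (𝓝 0) := by
    have : Tendsto (fun n : ℕ => (6 : ℝ) / ((n : ℝ) + 2)) atTop (𝓝 0) :=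
      tendsto_const_nhds.div_atTop
        (tendsto_atTop_add_const_right _ _ tendsto_natCast_atTop_atTop)
    simpa using this.sqrt
  have h3 := h1.mul h2
  rw [mul_zero] at h3
  have h4 : Tendsto (fun n : ℕ => phi (B n) (μ n) 1 -
      Complex.exp (-(SS (B n) / (n + 1) : ℝ) / 2)) atTop (𝓝 0) :=
    squeeze_zero_norm (fun n => by
      have := hprob n
      have := hinv n
      exact phi_one (B n) (hB n) (μ n)) h3
  have h5 : Tendsto (fun n : ℕ => Complex.exp (-((SS (B n) / (n + 1) : ℝ) : ℂ) / 2)) atTop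
      (𝓝 (Complex.exp (-(σ : ℂ) / 2))) := by
    have c : Continuous fun x : ℝ => Complex.exp (-(x : ℂ) / 2) := by fun_prop
    exact (c.tendsto σ).comp h1
  have := h4.add h5
  simpa using this

theorem SS_comb {n r : ℕ} (A : Fin r → Matrix (Fin n) (Fin n) ℂ) (x : Fin r → ℝ) :
    SS (∑ ν, (x ν : ℂ) • A ν) =
      ∑ i, ∑ j, x i * ((A i * (A j)ᴴ).trace.re) * x j := by
  rw [SS_eq, Matrix.conjTranspose_sum, Finset.sum_mul_sum, Matrix.trace_sum, Complex.re_sum]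
  refine Finset.sum_congr rfl fun i _ => ?_
  rw [Matrix.trace_sum, Complex.re_sum]
  refine Finset.sum_congr rfl fun j _ => ?_
  rw [Matrix.conjTranspose_smul, smul_mul_smul_comm, Matrix.trace_smul]
  have : (x i : ℂ) * star (x j : ℂ) = ((x i * x j : ℝ) : ℂ) := by simp
  rw [this, smul_eq_mul, Complex.re_ofReal_mul]
  ring

end four

end BorelAI

open BorelAI

/-- Borel theorem for the class AI symmetric space `U(n)/O(n)`:
with `V = g gᵀ` for `g` Haar distributed on `U(n)` and symmetric parameter
matrices `A^{(ν,n)}`, the vector `(Re Tr(A^{(ν,n)} V))_ν` converges in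
distribution to the centered Gaussian with covariances
`c μ ν = lim (1/n) Re Tr(A^{(μ,n)} (A^{(ν,n)})^*)`. -/
theorem borel_theorem_AI
    (r : ℕ) (hr : 1 ≤ r)
    (A : Fin r → (n : ℕ) → Matrix (Fin n) (Fin n) ℂ)
    (hsym : ∀ ν n, (A ν n)ᵀ = A ν n)
    (c : Matrix (Fin r) (Fin r) ℝ)
    (hc : ∀ μ' ν, Tendsto
      (fun n : ℕ => (1 / (n : ℝ)) * ((A μ' n * (A ν n)ᴴ).trace.re))
      atTop (𝓝 (c μ' ν)))
    (hpos : ∀ ν, 0 < c ν ν)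
    (μ : (n : ℕ) → Measure (Matrix.unitaryGroup (Fin n) ℂ))
    (hprob : ∀ n, IsProbabilityMeasure (μ n))
    (hinv : ∀ n, (μ n).IsMulLeftInvariant) :
    ∃ γ : Measure (Fin r → ℝ), IsGaussianMeasure γ 0 c ∧
      ∀ f : BoundedContinuousFunction (Fin r → ℝ) ℝ,
        Tendsto
          (fun n : ℕ => ∫ g, f (fun ν =>
            ((A ν n * ((g : Matrix (Fin n) (Fin n) ℂ)
              * (g : Matrix (Fin n) (Fin n) ℂ)ᵀ)).trace.re)) ∂ μ n)
          atTop (𝓝 (∫ x, f x ∂ γ)) := by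
  -- limits of the quadratic forms
  have hlim : ∀ x : Fin r → ℝ, Tendsto (fun n : ℕ => (1 / (n : ℝ)) *
      SS (∑ ν, (x ν : ℂ) • A ν n)) atTop (𝓝 (∑ i, ∑ j, x i * c i j * x j)) := by
    intro x
    have h : Tendsto (fun n : ℕ => ∑ i, ∑ j, x i * ((1 / (n : ℝ)) *
        ((A i n * (A j n)ᴴ).trace.re)) * x j) atTop (𝓝 (∑ i, ∑ j, x i * c i j * x j)) :=
      tendsto_finsetSum _ fun i _ => tendsto_finsetSum _ fun j _ =>
        ((hc i j).const_mul (x i)).mul_const (x j)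
    refine h.congr fun n => ?_
    rw [SS_comb (fun ν => A ν n), Finset.mul_sum]
    refine Finset.sum_congr rfl fun i _ => ?_
    rw [Finset.mul_sum]
    refine Finset.sum_congr rfl fun j _ => ?_
    ring
  have hq : ∀ x : Fin r → ℝ, x ⬝ᵥ c *ᵥ x = ∑ i, ∑ j, x i * c i j * x j := by
    intro x
    simp only [dotProduct, Matrix.mulVec, Finset.mul_sum, mul_assoc]
  have hpsd : c.PosSemidef := by
    refine Matrix.PosSemidef.of_dotProduct_mulVec_nonneg ?_ ?_
    · ext i j
      rw [Matrix.conjTranspose_apply, star_trivial]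
      refine tendsto_nhds_unique (hc j i) ((hc i j).congr fun n => ?_)
      have e : (A j n * (A i n)ᴴ).trace = star (A i n * (A j n)ᴴ).trace := by
        rw [← Matrix.trace_conjTranspose, Matrix.conjTranspose_mul,
          Matrix.conjTranspose_conjTranspose]
      rw [e]
      rfl
    · intro x
      rw [star_trivial, hq]
      refine ge_of_tendsto' (hlim x) fun n => ?_
      exact mul_nonneg (by positivity) (SS_nonneg _)
  let γ0 : Measure (EuclideanSpace ℝ (Fin r)) := multivariateGaussian 0 c
  let W : (n : ℕ) → UU n → EuclideanSpace ℝ (Fin r) := fun n g => WithLp.toLp 2 fun ν =>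
    ((A ν n * ((g : Matrix (Fin n) (Fin n) ℂ) * (g : Matrix (Fin n) (Fin n) ℂ)ᵀ)).trace.re)
  have hW : ∀ n, Continuous (W n) := by
    intro n
    refine (PiLp.continuous_toLp 2 _).comp (continuous_pi fun ν => ?_)
    exact Complex.continuous_re.comp (Continuous.matrix_trace (continuous_const.matrix_mul
      (continuous_subtype_val.matrix_mul continuous_subtype_val.matrix_transpose)))
  let P : ℕ → ProbabilityMeasure (EuclideanSpace ℝ (Fin r)) := fun n =>
    ⟨(μ n).map (W n), by
      have := hprob n
      exact Measure.isProbabilityMeasure_map (hW n).aemeasurable⟩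
  let P0 : ProbabilityMeasure (EuclideanSpace ℝ (Fin r)) := ⟨γ0, by
    change IsProbabilityMeasure (multivariateGaussian 0 c); infer_instance⟩
  have hconv : Tendsto P atTop (𝓝 P0) := by
    rw [ProbabilityMeasure.tendsto_iff_tendsto_charFun]
    intro x
    have h0 : charFun (P0 : Measure (EuclideanSpace ℝ (Fin r))) x =
        Complex.exp (-((∑ i, ∑ j, x i * c i j * x j : ℝ) : ℂ) / 2) := by
      change charFun (multivariateGaussian 0 c) x = _
      rw [charFun_multivariateGaussian hpsd, hq]
      congr 1
      simp
      ring
    rw [h0]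
    refine (phi_tendsto (fun n => ∑ ν, (x ν : ℂ) • A ν n) (fun n => ?_) μ hprob hinv _
      (hlim x)).congr fun n => ?_
    · simp [Matrix.transpose_sum, Matrix.transpose_smul, hsym]
    · change _ = charFun ((μ n).map (W n)) x
      rw [charFun_apply, integral_map (hW n).aemeasurable (by fun_prop)]
      unfold phi
      refine integral_congr_ae (Filter.Eventually.of_forall fun g => ?_)
      simp only [hh, Complex.ofReal_one, one_mul]
      congr 3
      simp only [ZZ, VV, W, PiLp.inner_apply, Matrix.mul_sum, Matrix.trace_sum, Complex.re_sum]
      refine Finset.sum_congr rfl fun ν _ => ?_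
      rw [mul_smul_comm, Matrix.trace_smul, smul_eq_mul, Complex.re_ofReal_mul,
        Matrix.trace_mul_comm]
      simp
  have hm : Measurable (WithLp.ofLp : EuclideanSpace ℝ (Fin r) → (Fin r → ℝ)) :=
    (PiLp.continuous_ofLp 2 _).measurable
  have : IsProbabilityMeasure γ0 := P0.2
  refine ⟨γ0.map WithLp.ofLp, ⟨Measure.isProbabilityMeasure_map hm.aemeasurable, ?_⟩, ?_⟩
  · intro t
    rw [Measure.map_map (by fun_prop) hm]
    have hf : ((fun x : Fin r → ℝ => ∑ i, t i * x i) ∘ WithLp.ofLp) =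
        fun x : EuclideanSpace ℝ (Fin r) => inner ℝ (WithLp.toLp 2 t) x := by
      funext x
      simp [PiLp.inner_apply, mul_comm]
    rw [hf]
    have : IsProbabilityMeasure (γ0.map (fun x : EuclideanSpace ℝ (Fin r) =>
      inner ℝ (WithLp.toLp 2 t) x)) := Measure.isProbabilityMeasure_map (by fun_prop)
    apply Measure.ext_of_charFun
    funext s
    rw [charFun_apply_real, integral_map (by fun_prop) (by fun_prop), charFun_gaussianReal]
    have h1 := charFun_multivariateGaussian (μ := 0) hpsd (s • WithLp.toLp 2 t)
    rw [charFun_apply] at h1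
    have hnn : 0 ≤ ∑ i, ∑ j, t i * c i j * t j :=
      ge_of_tendsto' (hlim t) fun n => mul_nonneg (by positivity) (SS_nonneg _)
    refine Eq.trans ?_ (h1.trans ?_)
    · refine integral_congr_ae (Filter.Eventually.of_forall fun y => ?_)
      simp only []
      rw [inner_smul_right, real_inner_comm]
      simp
    · congr 1
      have e : (s • WithLp.toLp 2 t : EuclideanSpace ℝ (Fin r)).ofLp = s • t := rfl
      rw [Real.coe_toNNReal _ hnn, e, Matrix.mulVec_smul, smul_dotProduct, dotProduct_smul, hq]
      simp
      ring
  · intro f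
    have h := ProbabilityMeasure.tendsto_iff_forall_integral_tendsto.mp hconv
      (f.compContinuous ⟨WithLp.ofLp, PiLp.continuous_ofLp 2 _⟩)
    rw [integral_map hm.aemeasurable f.continuous.aestronglyMeasurable]
    refine h.congr fun n => ?_
    change ∫ y, f (WithLp.ofLp y) ∂((μ n).map (W n)) = _
    exact integral_map (hW n).aemeasurable
      (f.continuous.comp (PiLp.continuous_ofLp 2 _)).aestronglyMeasurable
end

section
/- Let J denote the 2n×2n block matrix [[0, −Iₙ],[Iₙ, 0]]. Let r ≥ 1 and for each ν ∈ {1,…,r} and n ∈ ℕ let A^{(ν,n)} be a complex 2n×2n matrix with (A^{(ν,n)}J)ᵀ = −A^{(ν,n)}J. Assume that for all μ,ν ∈ {1,…,r} the limit c_{μν} := lim_{n→∞} (1/(2n))·Re Tr(A^{(μ,n)}(A^{(ν,n)})*) exists, and that c_{νν} > 0 for each ν. Let g^{(n)} be a Haar-distributed random element of U(2n) and set V^{(n)} := g^{(n)}Jᵀ(g^{(n)})ᵀJ. Then, as n → ∞, the random vector (Re Tr(A^{(1,n)}V^{(n)}), …, Re Tr(A^{(r,n)}V^{(n)})) converges in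 distribution to the centered Gaussian distribution on ℝ^r with covariance matrix (c_{μν}). -/
open MeasureTheory ProbabilityTheory Matrix Filter Topology

/-- The complex `2n×2n` block matrix `J = [[0, -Iₙ],[Iₙ, 0]]`. -/
def Jmat (n : ℕ) : Matrix (Fin n ⊕ Fin n) (Fin n ⊕ Fin n) ℂ :=
  Matrix.fromBlocks 0 (-1) 1 0

section Helpers

set_option linter.unusedSectionVars false

variable {ι : Type*} [Fintype ι] [DecidableEq ι]

instance matrixBorelSpace : BorelSpace (Matrix ι ι ℂ) :=
  inferInstanceAs (BorelSpace (ι → ι → ℂ))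

/-- Entrywise derivative at `0` of a curve of matrices. -/
def EDeriv (M : ℝ → Matrix ι ι ℂ) (M' : Matrix ι ι ℂ) : Prop :=
  ∀ i j, HasDerivAt (fun s => M s i j) (M' i j) 0

lemma EDeriv.mul {M N : ℝ → Matrix ι ι ℂ} {M' N' : Matrix ι ι ℂ} (hM : EDeriv M M')
    (hN : EDeriv N N') : EDeriv (fun s => M s * N s) (M' * N 0 + M 0 * N') := by
  intro i j
  simp only [Matrix.mul_apply, Matrix.add_apply, ← Finset.sum_add_distrib]
  exact HasDerivAt.fun_sum fun k _ => (hM i k).mul (hN k j)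

lemma EDeriv.const (M : Matrix ι ι ℂ) : EDeriv (fun _ => M) 0 := fun _ _ => hasDerivAt_const _ _

lemma EDeriv.transpose {M : ℝ → Matrix ι ι ℂ} {M' : Matrix ι ι ℂ} (hM : EDeriv M M') :
    EDeriv (fun s => (M s)ᵀ) M'ᵀ := fun i j => hM j i

lemma EDeriv.trace {M : ℝ → Matrix ι ι ℂ} {M' : Matrix ι ι ℂ} (hM : EDeriv M M') :
    HasDerivAt (fun s => (M s).trace) M'.trace 0 := by
  simp only [Matrix.trace, Matrix.diag]
  exact HasDerivAt.fun_sum fun k _ => hM k k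

section
attribute [local instance] Matrix.linftyOpNormedRing Matrix.linftyOpNormedAlgebra

lemma exists_curve (X : Matrix ι ι ℂ) (hX : Xᴴ = -X) :
    ∃ h : ℝ → Matrix ι ι ℂ, (∀ s, h s ∈ Matrix.unitaryGroup ι ℂ) ∧
      (∀ s t, h (s + t) = h s * h t) ∧ h 0 = 1 ∧ EDeriv h X := by
  refine ⟨fun s => NormedSpace.exp (s • X), ?_, ?_, ?_, ?_⟩
  · intro s
    have h1 : (NormedSpace.exp (s • X))ᴴ = NormedSpace.exp (-(s • X)) := by
      rw [← Matrix.exp_conjTranspose, Matrix.conjTranspose_smul, hX]; simp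
    rw [Matrix.mem_unitaryGroup_iff, Matrix.star_eq_conjTranspose, h1,
      ← Matrix.exp_add_of_commute _ _ (Commute.refl (s • X)).neg_right]
    simp
  · intro s t
    simp only [add_smul]
    exact Matrix.exp_add_of_commute _ _ (((Commute.refl X).smul_left s).smul_right t)
  · simp
  · intro i j
    have h := hasDerivAt_exp_smul_const (𝕂 := ℝ) X (0 : ℝ)
    simp only [zero_smul, NormedSpace.exp_zero, one_mul] at h
    let L : Matrix ι ι ℂ →ₗ[ℝ] ℂ :=
      { toFun := fun M => M i j, map_add' := fun _ _ => rfl, map_smul' := fun _ _ => rfl }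
    have := (LinearMap.toContinuousLinearMap L).hasFDerivAt.comp_hasDerivAt (0:ℝ) h
    exact this
end

lemma isCompact_unitary : IsCompact (Matrix.unitaryGroup ι ℂ : Set (Matrix ι ι ℂ)) := by
  have hK : IsCompact (Set.univ.pi fun _ : ι => Set.univ.pi fun _ : ι =>
      Metric.closedBall (0 : ℂ) 1) :=
    isCompact_univ_pi fun _ => isCompact_univ_pi fun _ => isCompact_closedBall _ _
  refine IsCompact.of_isClosed_subset (X := Matrix ι ι ℂ) hK ?_ ?_
  · have : (Matrix.unitaryGroup ι ℂ : Set (Matrix ι ι ℂ)) = {A | A * star A = 1} := by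
      ext A; simp [Matrix.mem_unitaryGroup_iff]
    rw [this]
    exact isClosed_eq (by fun_prop) (by fun_prop)
  · intro U hU i _ j _
    simpa using entry_norm_bound_of_unitary hU i j

instance compactSpace_unitary : CompactSpace (Matrix.unitaryGroup ι ℂ) :=
  isCompact_iff_compactSpace.mp isCompact_unitary

instance secondCountable_mat : SecondCountableTopology (Matrix ι ι ℂ) :=
  inferInstanceAs (SecondCountableTopology (ι → ι → ℂ))

lemma integ (μ : Measure (Matrix.unitaryGroup ι ℂ)) [IsProbabilityMeasure μ]
    {E : Type*} [NormedAddCommGroup E] [SecondCountableTopology E] [MeasurableSpace E] [BorelSpace E]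
    {F : Matrix.unitaryGroup ι ℂ → E} (hF : Continuous F) : Integrable F μ := by
  obtain ⟨C, hC⟩ := (isCompact_univ (X := Matrix.unitaryGroup ι ℂ)).exists_bound_of_continuousOn
    hF.continuousOn
  exact Integrable.of_bound hF.measurable.aestronglyMeasurable C (ae_of_all _ fun x => hC x trivial)

lemma ibp (μ : Measure (Matrix.unitaryGroup ι ℂ)) [IsProbabilityMeasure μ]
    [μ.IsMulLeftInvariant] (F F' : Matrix ι ι ℂ → ℂ) (hF : Continuous F) (hF' : Continuous F')
    (X : Matrix ι ι ℂ) (hX : Xᴴ = -X)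
    (hd : ∀ h : ℝ → Matrix ι ι ℂ, EDeriv h X → h 0 = 1 → ∀ g ∈ Matrix.unitaryGroup ι ℂ,
      HasDerivAt (fun s => F (h s * g)) (F' g) 0) :
    ∫ g, F' (g : Matrix ι ι ℂ) ∂μ = 0 := by
  obtain ⟨h, hu, hadd, h0, hX'⟩ := exists_curve X hX
  obtain ⟨C, hC⟩ := isCompact_unitary.exists_bound_of_continuousOn hF'.continuousOn
  have hder : ∀ g : Matrix.unitaryGroup ι ℂ, ∀ s : ℝ,
      HasDerivAt (fun s => F (h s * g)) (F' (h s * g)) s := by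
    intro g s
    have h1 := hd h hX' h0 (h s * g) (mul_mem (hu s) g.2)
    have h2 : HasDerivAt (fun s' => F (h (s' - s) * (h s * g))) (F' (h s * g)) s := by
      have h3 : HasDerivAt (fun s' => F (h s' * (h s * g))) (F' (h s * g)) (s - s) := by
        simpa using h1
      exact h3.comp_sub_const s s
    refine h2.congr_of_eventuallyEq (Eventually.of_forall fun s' => ?_)
    simp only
    rw [← Matrix.mul_assoc, ← hadd]; simp
  have hc : ∀ s, Continuous fun g : Matrix.unitaryGroup ι ℂ => F (h s * g) := by
    intro s; exact hF.comp (continuous_const.mul continuous_subtype_val)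
  have key := hasDerivAt_integral_of_dominated_loc_of_deriv_le (μ := μ) (𝕜 := ℝ) (x₀ := (0:ℝ))
    (s := Set.univ) (F := fun s (g : Matrix.unitaryGroup ι ℂ) => F (h s * g))
    (F' := fun s (g : Matrix.unitaryGroup ι ℂ) => F' (h s * g)) (bound := fun _ => C)
    Filter.univ_mem (Eventually.of_forall fun s => (hc s).measurable.aestronglyMeasurable)
    (integ μ (hc 0))
    (hF'.comp (continuous_const.mul continuous_subtype_val)).measurable.aestronglyMeasurable
    (ae_of_all _ fun g s _ => hC _ (mul_mem (hu s) g.2)) (integrable_const _)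
    (ae_of_all _ fun g s _ => hder g s)
  have hconst : (fun s => ∫ g : Matrix.unitaryGroup ι ℂ, F (h s * g) ∂μ) =
      fun _ => ∫ g : Matrix.unitaryGroup ι ℂ, F g ∂μ := by
    funext s
    exact integral_mul_left_eq_self (μ := μ) (fun g : Matrix.unitaryGroup ι ℂ => F g) ⟨h s, hu s⟩
  have h2 := key.2
  rw [hconst] at h2
  have := h2.unique (hasDerivAt_const _ _)
  simpa [h0] using this

lemma ibpC (μ : Measure (Matrix.unitaryGroup ι ℂ)) [IsProbabilityMeasure μ]
    [μ.IsMulLeftInvariant] (F : Matrix ι ι ℂ → ℂ) (D : Matrix ι ι ℂ → Matrix ι ι ℂ → ℂ)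
    (hF : Continuous F) (hD : ∀ X, Continuous (D X))
    (hadd : ∀ X Y g, D (X + Y) g = D X g + D Y g)
    (hsmul : ∀ (a : ℂ) X g, D (a • X) g = a * D X g)
    (hd : ∀ X : Matrix ι ι ℂ, Xᴴ = -X →
      ∀ h : ℝ → Matrix ι ι ℂ, EDeriv h X → h 0 = 1 → ∀ g ∈ Matrix.unitaryGroup ι ℂ,
      HasDerivAt (fun s => F (h s * g)) (D X g) 0) (X : Matrix ι ι ℂ) :
    ∫ g, D X (g : Matrix ι ι ℂ) ∂μ = 0 := by
  let X1 : Matrix ι ι ℂ := (1/2 : ℂ) • (X - Xᴴ)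
  let X2 : Matrix ι ι ℂ := (-Complex.I/2) • (X + Xᴴ)
  have hX : X = X1 + Complex.I • X2 := by
    ext i j
    simp [X1, X2]
    linear_combination ((X i j)/2 + (starRingEnd ℂ) (X j i)/2) * Complex.I_mul_I
  have h1 : X1ᴴ = -X1 := by
    ext i j; simp [X1]; ring
  have h2 : X2ᴴ = -X2 := by
    ext i j; simp [X2]; ring
  have e1 := ibp μ F (D X1) hF (hD _) X1 h1 (hd X1 h1)
  have e2 := ibp μ F (D X2) hF (hD _) X2 h2 (hd X2 h2)
  have : ∀ g : Matrix.unitaryGroup ι ℂ, D X g = D X1 g + Complex.I * D X2 g := by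
    intro g; rw [← hsmul, ← hadd, ← hX]
  simp_rw [this]
  rw [integral_add, integral_const_mul, e1, e2]
  · simp
  · exact integ μ ((hD _).comp continuous_subtype_val)
  · exact (integ μ ((hD _).comp continuous_subtype_val)).const_mul _

lemma divergence (μ : Measure (Matrix.unitaryGroup ι ℂ)) [IsProbabilityMeasure μ]
    [μ.IsMulLeftInvariant] (Q : Matrix ι ι ℂ → Matrix ι ι ℂ)
    (dQ : Matrix ι ι ℂ → Matrix ι ι ℂ → Matrix ι ι ℂ) (F : Matrix ι ι ℂ → ℂ)
    (Y : Matrix ι ι ℂ → Matrix ι ι ℂ) (divQ : Matrix ι ι ℂ → ℂ)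
    (hQ : Continuous Q) (hdQ : ∀ X, Continuous (dQ X)) (hF : Continuous F) (hY : Continuous Y)
    (hadd : ∀ X X' g, dQ (X + X') g = dQ X g + dQ X' g)
    (hsmul : ∀ (a : ℂ) X g, dQ (a • X) g = a • dQ X g)
    (hQd : ∀ X : Matrix ι ι ℂ, Xᴴ = -X →
      ∀ h : ℝ → Matrix ι ι ℂ, EDeriv h X → h 0 = 1 → ∀ g ∈ Matrix.unitaryGroup ι ℂ,
      EDeriv (fun s => Q (h s * g)) (dQ X g))
    (hFd : ∀ X : Matrix ι ι ℂ, Xᴴ = -X →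
      ∀ h : ℝ → Matrix ι ι ℂ, EDeriv h X → h 0 = 1 → ∀ g ∈ Matrix.unitaryGroup ι ℂ,
      HasDerivAt (fun s => F (h s * g)) (X * Y g).trace 0)
    (hdiv : ∀ g, ∑ j, ∑ k, dQ (Matrix.single j k 1) g j k = divQ g) :
    ∫ g : Matrix.unitaryGroup ι ℂ, (divQ g * F g + (Q g * Y g).trace) ∂μ = 0 := by
  have key : ∀ j k, ∫ g : Matrix.unitaryGroup ι ℂ, (dQ (Matrix.single j k 1) g j k * F g
      + Q g j k * (Matrix.single j k 1 * Y g).trace) ∂μ = 0 := by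
    intro j k
    refine ibpC μ (fun g => Q g j k * F g)
      (fun X g => dQ X g j k * F g + Q g j k * (X * Y g).trace) ?_ ?_ ?_ ?_ ?_ _
    · exact (hQ.matrix_elem j k).mul hF
    · intro X
      exact (((hdQ X).matrix_elem j k).mul hF).add ((hQ.matrix_elem j k).mul
        ((continuous_const.mul hY).matrix_trace))
    · intro X X' g
      simp only [hadd, Matrix.add_apply, Matrix.add_mul, Matrix.trace_add]; ring
    · intro a X g
      simp only [hsmul, Matrix.smul_apply, Matrix.smul_mul, Matrix.trace_smul, smul_eq_mul]; ring
    · intro X hX h hh h0 g hg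
      have := (hQd X hX h hh h0 g hg j k).fun_mul (hFd X hX h hh h0 g hg)
      simp only [h0, Matrix.one_mul] at this
      exact this
  have hcont : ∀ j k, Continuous fun g : Matrix.unitaryGroup ι ℂ =>
      (dQ (Matrix.single j k 1) g j k * F g
      + Q g j k * (Matrix.single j k 1 * Y g).trace) := fun j k =>
    ((((hdQ _).matrix_elem j k).mul hF).add ((hQ.matrix_elem j k).mul
        ((continuous_const.mul hY).matrix_trace))).comp continuous_subtype_val
  have e : ∀ g : Matrix.unitaryGroup ι ℂ, divQ g * F g + (Q g * Y g).trace =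
      ∑ j, ∑ k, (dQ (Matrix.single j k 1) g j k * F g
      + Q g j k * (Matrix.single j k 1 * Y g).trace) := by
    intro g
    simp only [Finset.sum_add_distrib, ← Finset.sum_mul, hdiv]
    congr 1
    simp only [Matrix.trace, Matrix.diag, Matrix.mul_apply (M := Q g)]
    refine Finset.sum_congr rfl fun j _ => Finset.sum_congr rfl fun k _ => ?_
    congr 1
    have := Matrix.trace_single_mul (R := ℂ) j k 1 (Y g)
    simpa [Matrix.trace] using this.symm
  simp_rw [e]
  rw [integral_finsetSum]
  · refine Finset.sum_eq_zero fun j _ => ?_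
    rw [integral_finsetSum]
    · exact Finset.sum_eq_zero fun k _ => key j k
    · intro k _
      exact integ μ (hcont j k)
  · intro j _
    exact integrable_finsetSum _ fun k _ => integ μ (hcont j k)

/-- The antisymmetric unitary matrix `g K gᵀ`. -/
def Smat (K g : Matrix ι ι ℂ) : Matrix ι ι ℂ := g * K * gᵀ

/-- `S B`. -/
def Pmat (K B g : Matrix ι ι ℂ) : Matrix ι ι ℂ := Smat K g * B

lemma continuous_Smat (K : Matrix ι ι ℂ) : Continuous (Smat K) := by
  exact (continuous_id.matrix_mul continuous_const).matrix_mul continuous_id.matrix_transpose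

lemma continuous_Pmat (K B : Matrix ι ι ℂ) : Continuous (Pmat K B) := by
  exact (continuous_Smat K).matrix_mul continuous_const

lemma continuous_dP (K B X : Matrix ι ι ℂ) :
    Continuous fun g => (X * Smat K g + Smat K g * Xᵀ) * B :=
  ((continuous_const.matrix_mul (continuous_Smat K)).add
    ((continuous_Smat K).matrix_mul continuous_const)).matrix_mul continuous_const

lemma Smat_transpose {K : Matrix ι ι ℂ} (hK : Kᵀ = -K) (g : Matrix ι ι ℂ) :
    (Smat K g)ᵀ = -Smat K g := by
  simp [Smat, Matrix.transpose_mul, hK, Matrix.mul_assoc]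

lemma Smat_unitary {K : Matrix ι ι ℂ} (hKK : Kᴴ * K = 1) {g : Matrix ι ι ℂ}
    (hg : g ∈ Matrix.unitaryGroup ι ℂ) : (Smat K g)ᴴ * Smat K g = 1 := by
  have h1 : gᴴ * g = 1 := by
    have := Matrix.mem_unitaryGroup_iff'.mp hg
    rwa [Matrix.star_eq_conjTranspose] at this
  have h2 : (gᵀ)ᴴ * gᵀ = 1 := by
    have := Matrix.mem_unitaryGroup_iff.mp hg
    rw [Matrix.star_eq_conjTranspose] at this
    have h3 := congrArg Matrix.transpose this
    rw [Matrix.transpose_mul, Matrix.transpose_one] at h3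
    rw [← h3]; rfl
  calc (Smat K g)ᴴ * Smat K g = (gᵀ)ᴴ * (Kᴴ * (gᴴ * g) * K) * gᵀ := by
        simp only [Smat, Matrix.conjTranspose_mul, Matrix.mul_assoc]
    _ = 1 := by rw [h1, Matrix.mul_one, hKK, Matrix.mul_one, h2]

lemma edS (K X : Matrix ι ι ℂ) {h : ℝ → Matrix ι ι ℂ} (hh : EDeriv h X) (h0 : h 0 = 1)
    (g : Matrix ι ι ℂ) :
    EDeriv (fun s => Smat K (h s * g)) (X * Smat K g + Smat K g * Xᵀ) := by
  have h1 := (((hh.mul (EDeriv.const g)).mul (EDeriv.const K))).mul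
    (hh.mul (EDeriv.const g)).transpose
  simp only [h0, Matrix.one_mul, Matrix.mul_zero, add_zero, Matrix.transpose_mul] at h1
  simpa only [Smat, Matrix.mul_assoc, Matrix.transpose_mul] using h1

lemma edP (K B X : Matrix ι ι ℂ) {h : ℝ → Matrix ι ι ℂ} (hh : EDeriv h X) (h0 : h 0 = 1)
    (g : Matrix ι ι ℂ) :
    EDeriv (fun s => Pmat K B (h s * g)) ((X * Smat K g + Smat K g * Xᵀ) * B) := by
  have h1 := (edS K X hh h0 g).mul (EDeriv.const B)
  simp only [Matrix.mul_zero, add_zero] at h1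
  exact h1

lemma edR (K B X : Matrix ι ι ℂ) {h : ℝ → Matrix ι ι ℂ} (hh : EDeriv h X) (h0 : h 0 = 1)
    (g : Matrix ι ι ℂ) :
    EDeriv (fun s => Pmat K B (h s * g) * Pmat K B (h s * g))
      ((X * Smat K g + Smat K g * Xᵀ) * B * Pmat K B g +
        Pmat K B g * ((X * Smat K g + Smat K g * Xᵀ) * B)) := by
  have h1 := (edP K B X hh h0 g).mul (edP K B X hh h0 g)
  simpa only [h0, Matrix.one_mul] using h1

lemma trace_dP {K B : Matrix ι ι ℂ} (hK : Kᵀ = -K) (hB : Bᵀ = -B) (X g : Matrix ι ι ℂ) :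
    ((X * Smat K g + Smat K g * Xᵀ) * B).trace = 2 * (X * Pmat K B g).trace := by
  have h1 : (Smat K g * Xᵀ * B).trace = (X * Pmat K B g).trace := by
    rw [← Matrix.trace_transpose, Matrix.transpose_mul, Matrix.transpose_mul, Smat_transpose hK, hB,
      Matrix.transpose_transpose, Matrix.neg_mul, Matrix.mul_neg, Matrix.mul_neg, neg_neg,
      Matrix.trace_mul_comm, Pmat, Matrix.mul_assoc]
  rw [Matrix.add_mul, Matrix.trace_add, h1, Matrix.mul_assoc X, ← Pmat]
  ring

lemma trace_dR {K B : Matrix ι ι ℂ} (hK : Kᵀ = -K) (hB : Bᵀ = -B) (X g : Matrix ι ι ℂ) :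
    ((X * Smat K g + Smat K g * Xᵀ) * B * Pmat K B g +
        Pmat K B g * ((X * Smat K g + Smat K g * Xᵀ) * B)).trace =
      4 * (X * (Pmat K B g * Pmat K B g)).trace := by
  have h1 : (Smat K g * Xᵀ * B * Pmat K B g).trace = (X * (Pmat K B g * Pmat K B g)).trace := by
    rw [← Matrix.trace_transpose, Pmat]
    simp only [Matrix.transpose_mul, Smat_transpose hK, hB, Matrix.transpose_transpose,
      Matrix.neg_mul, Matrix.mul_neg, neg_neg]
    simp only [← Matrix.mul_assoc]
    rw [Matrix.mul_assoc (B * Smat K g * B), Matrix.trace_mul_comm]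
    simp only [← Matrix.mul_assoc]
  rw [Matrix.trace_add, Matrix.trace_mul_comm (Pmat K B g)]
  simp only [Matrix.add_mul, Matrix.trace_add, h1]
  rw [Matrix.mul_assoc X, ← Pmat, Matrix.mul_assoc X]
  ring

lemma star_trace_skew {X : Matrix ι ι ℂ} (hX : Xᴴ = -X) (M : Matrix ι ι ℂ) :
    star (X * M).trace = -(X * Mᴴ).trace := by
  rw [← Matrix.trace_conjTranspose, Matrix.conjTranspose_mul, hX, Matrix.mul_neg, Matrix.trace_neg,
    Matrix.trace_mul_comm]

lemma div1 (M : Matrix ι ι ℂ) : ∑ j : ι, ∑ k : ι, (Matrix.single j k (1:ℂ) * M : Matrix ι ι ℂ) j k =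
    Fintype.card ι * M.trace := by
  simp [Matrix.trace]

lemma div2 (M M' : Matrix ι ι ℂ) : ∑ j : ι, ∑ k : ι, (M * (Matrix.single j k (1:ℂ))ᵀ * M' : Matrix ι ι ℂ) j k =
    (M * M'ᵀ).trace := by
  simp [Matrix.trace, Matrix.mul_apply, Matrix.single_apply, ite_and, Finset.sum_ite_eq]

lemma div3 (M M' : Matrix ι ι ℂ) : ∑ j : ι, ∑ k : ι, (M * Matrix.single j k (1:ℂ) * M' : Matrix ι ι ℂ) j k =
    M.trace * M'.trace := by
  simp [Matrix.trace, Matrix.mul_apply, Matrix.single_apply, ite_and, Finset.sum_ite_eq,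
    Finset.sum_mul_sum]

lemma divP {K B : Matrix ι ι ℂ} (hB : Bᵀ = -B) (g : Matrix ι ι ℂ) :
    ∑ j : ι, ∑ k : ι, ((Matrix.single j k 1 * Smat K g + Smat K g * (Matrix.single j k 1)ᵀ) * B : Matrix ι ι ℂ) j k =
      ((Fintype.card ι : ℂ) - 1) * (Pmat K B g).trace := by
  simp only [Matrix.add_mul, Matrix.add_apply, Finset.sum_add_distrib]
  rw [div2]
  simp only [Matrix.mul_assoc]
  rw [div1, hB]
  simp only [Matrix.mul_neg, Matrix.trace_neg, Pmat]
  ring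

lemma divR {K B : Matrix ι ι ℂ} (hK : Kᵀ = -K) (hB : Bᵀ = -B) (g : Matrix ι ι ℂ) :
    ∑ j : ι, ∑ k : ι, ((Matrix.single j k 1 * Smat K g + Smat K g * (Matrix.single j k 1)ᵀ) * B * Pmat K B g
      + Pmat K B g * ((Matrix.single j k 1 * Smat K g
        + Smat K g * (Matrix.single j k 1)ᵀ) * B) : Matrix ι ι ℂ) j k =
      ((Fintype.card ι : ℂ) - 2) * (Pmat K B g * Pmat K B g).trace + (Pmat K B g).trace ^ 2 := by
  have e1 : ∀ X : Matrix ι ι ℂ, (X * Smat K g + Smat K g * Xᵀ) * B * Pmat K B g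
      + Pmat K B g * ((X * Smat K g + Smat K g * Xᵀ) * B) =
      X * (Pmat K B g * Pmat K B g) + Smat K g * Xᵀ * (B * Pmat K B g)
      + (Pmat K B g * X * Pmat K B g + (Pmat K B g * Smat K g) * Xᵀ * B) := by
    intro X; simp only [Pmat, Matrix.add_mul, Matrix.mul_add, Matrix.mul_assoc]
  simp only [e1]
  simp only [Matrix.add_apply, Finset.sum_add_distrib, div1, div2, div3]
  simp only [Pmat, Matrix.transpose_mul, Smat_transpose hK, hB, Matrix.neg_mul, Matrix.mul_neg,
    neg_neg, Matrix.mul_assoc, Matrix.trace_neg]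
  ring

lemma ident1 (μ : Measure (Matrix.unitaryGroup ι ℂ)) [IsProbabilityMeasure μ]
    [μ.IsMulLeftInvariant] {K B : Matrix ι ι ℂ} (hK : Kᵀ = -K) (hB : Bᵀ = -B) (t : ℝ) :
    ∫ g : Matrix.unitaryGroup ι ℂ, ((((Fintype.card ι : ℂ) - 1) * (Pmat K B g).trace) *
      Complex.exp (Complex.I * t * (((Pmat K B g).trace + star (Pmat K B g).trace) / 2)) +
      (Pmat K B g * ((Complex.I * t * Complex.exp (Complex.I * t *
        (((Pmat K B g).trace + star (Pmat K B g).trace) / 2))) •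
        (Pmat K B g - (Pmat K B g)ᴴ))).trace) ∂μ = 0 := by
  have cP := continuous_Pmat K B
  have cu : Continuous fun g => (Pmat K B g).trace := cP.matrix_trace
  have ce : Continuous fun g => Complex.exp (Complex.I * t *
        (((Pmat K B g).trace + star (Pmat K B g).trace) / 2)) := by fun_prop
  refine divergence μ (Pmat K B) (fun X g => (X * Smat K g + Smat K g * Xᵀ) * B)
    (fun g => Complex.exp (Complex.I * t *
        (((Pmat K B g).trace + star (Pmat K B g).trace) / 2)))
    (fun g => (Complex.I * t * Complex.exp (Complex.I * t *
        (((Pmat K B g).trace + star (Pmat K B g).trace) / 2))) •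
        (Pmat K B g - (Pmat K B g)ᴴ)) _ cP (continuous_dP K B) ce
    ((continuous_const.mul ce).smul (cP.sub cP.matrix_conjTranspose))
    ?_ ?_ ?_ ?_ (divP hB)
  · intro X X' g
    simp only [Matrix.transpose_add, Matrix.add_mul, Matrix.mul_add]; abel
  · intro a X g
    simp only [Matrix.transpose_smul, Matrix.smul_mul, Matrix.mul_smul, Matrix.add_mul, smul_add]
  · intro X hX h hh h0 g hg
    exact edP K B X hh h0 g
  · intro X hX h hh h0 g hg
    have d := (edP K B X hh h0 g).trace
    have d2 := ((((d.fun_add d.star).div_const 2).const_mul (Complex.I * (t:ℂ)))).cexp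
    rw [trace_dP hK hB, star_mul', star_trace_skew hX] at d2
    refine d2.congr_deriv ?_
    simp only [h0, Matrix.one_mul, Matrix.mul_smul, Matrix.trace_smul, Matrix.mul_sub,
      Matrix.trace_sub, smul_eq_mul]
    simp
    ring

lemma ident2 (μ : Measure (Matrix.unitaryGroup ι ℂ)) [IsProbabilityMeasure μ]
    [μ.IsMulLeftInvariant] {K B : Matrix ι ι ℂ} (hK : Kᵀ = -K) (hB : Bᵀ = -B) :
    ∫ g : Matrix.unitaryGroup ι ℂ, ((((Fintype.card ι : ℂ) - 1) * (Pmat K B g).trace) *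
      star (Pmat K B g).trace +
      (Pmat K B g * ((-2 : ℂ) • (Pmat K B g)ᴴ)).trace) ∂μ = 0 := by
  have cP := continuous_Pmat K B
  refine divergence μ (Pmat K B) (fun X g => (X * Smat K g + Smat K g * Xᵀ) * B)
    (fun g => star (Pmat K B g).trace)
    (fun g => (-2 : ℂ) • (Pmat K B g)ᴴ) _ cP (continuous_dP K B) cP.matrix_trace.star
    (cP.matrix_conjTranspose.const_smul (-2 : ℂ))
    ?_ ?_ ?_ ?_ (divP hB)
  · intro X X' g
    simp only [Matrix.transpose_add, Matrix.add_mul, Matrix.mul_add]; abel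
  · intro a X g
    simp only [Matrix.transpose_smul, Matrix.smul_mul, Matrix.mul_smul, Matrix.add_mul, smul_add]
  · intro X hX h hh h0 g hg
    exact edP K B X hh h0 g
  · intro X hX h hh h0 g hg
    have d2 := (edP K B X hh h0 g).trace.star
    rw [trace_dP hK hB, star_mul', star_trace_skew hX] at d2
    refine d2.congr_deriv ?_
    simp

lemma ident3 (μ : Measure (Matrix.unitaryGroup ι ℂ)) [IsProbabilityMeasure μ]
    [μ.IsMulLeftInvariant] {K B : Matrix ι ι ℂ} (hK : Kᵀ = -K) (hB : Bᵀ = -B) :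
    ∫ g : Matrix.unitaryGroup ι ℂ, ((((Fintype.card ι : ℂ) - 2) * (Pmat K B g * Pmat K B g).trace
        + (Pmat K B g).trace ^ 2) * star (Pmat K B g * Pmat K B g).trace +
      (Pmat K B g * Pmat K B g * ((-4 : ℂ) • (Pmat K B g * Pmat K B g)ᴴ)).trace) ∂μ = 0 := by
  have cP := continuous_Pmat K B
  refine divergence μ (fun g => Pmat K B g * Pmat K B g)
    (fun X g => (X * Smat K g + Smat K g * Xᵀ) * B * Pmat K B g +
        Pmat K B g * ((X * Smat K g + Smat K g * Xᵀ) * B))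
    (fun g => star (Pmat K B g * Pmat K B g).trace)
    (fun g => (-4 : ℂ) • (Pmat K B g * Pmat K B g)ᴴ) _ (cP.matrix_mul cP)
    (fun X => ((continuous_dP K B X).matrix_mul cP).add (cP.matrix_mul (continuous_dP K B X)))
    (cP.matrix_mul cP).matrix_trace.star 
    ((cP.matrix_mul cP).matrix_conjTranspose.const_smul (-4 : ℂ)) ?_ ?_ ?_ ?_ (divR hK hB)
  · intro X X' g
    simp only [Matrix.transpose_add, Matrix.add_mul, Matrix.mul_add]; abel
  · intro a X g
    simp only [Matrix.transpose_smul, Matrix.smul_mul, Matrix.mul_smul, Matrix.add_mul,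
      Matrix.mul_add, smul_add]
  · intro X hX h hh h0 g hg
    exact edR K B X hh h0 g
  · intro X hX h hh h0 g hg
    have d2 := (edR K B X hh h0 g).trace.star
    rw [trace_dR hK hB, star_mul', star_trace_skew hX] at d2
    refine d2.congr_deriv ?_
    simp

/-- Squared Frobenius norm. -/
noncomputable def frob (M : Matrix ι ι ℂ) : ℝ := ∑ i, ∑ j, ‖M i j‖ ^ 2

lemma frob_nonneg (M : Matrix ι ι ℂ) : 0 ≤ frob M := by unfold frob; positivity

lemma trace_frob (M : Matrix ι ι ℂ) : (M * Mᴴ).trace = (frob M : ℂ) := by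
  simp only [Matrix.trace, Matrix.diag, Matrix.mul_apply, frob, Matrix.conjTranspose_apply]
  push_cast
  refine Finset.sum_congr rfl fun i _ => Finset.sum_congr rfl fun j _ => ?_
  exact Complex.mul_conj' _

lemma frob_mul_le (M M' : Matrix ι ι ℂ) : frob (M * M') ≤ frob M * frob M' := by
  have h1 : ∀ i j, ‖(M * M') i j‖ ^ 2 ≤ (∑ k, ‖M i k‖ ^ 2) * ∑ k, ‖M' k j‖ ^ 2 := by
    intro i j
    have h2 : ‖(M * M') i j‖ ≤ ∑ k, ‖M i k‖ * ‖M' k j‖ := by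
      rw [Matrix.mul_apply]
      exact (norm_sum_le _ _).trans (le_of_eq (by simp))
    calc ‖(M * M') i j‖ ^ 2 ≤ (∑ k, ‖M i k‖ * ‖M' k j‖) ^ 2 := by gcongr
      _ ≤ _ := Finset.sum_mul_sq_le_sq_mul_sq _ _ _
  calc frob (M * M') ≤ ∑ i, ∑ j, (∑ k, ‖M i k‖ ^ 2) * ∑ k, ‖M' k j‖ ^ 2 :=
        Finset.sum_le_sum fun i _ => Finset.sum_le_sum fun j _ => h1 i j
    _ = frob M * frob M' := by
        rw [← Finset.sum_mul_sum]
        congr 1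
        rw [Finset.sum_comm]; rfl

lemma norm_trace_mul_le (M : Matrix ι ι ℂ) : ‖(M * M).trace‖ ≤ frob M := by
  have h1 : ‖(M * M).trace‖ ≤ ∑ i, ∑ j, ‖M i j‖ * ‖M j i‖ := by
    simp only [Matrix.trace, Matrix.diag, Matrix.mul_apply]
    refine (norm_sum_le _ _).trans (Finset.sum_le_sum fun i _ => ?_)
    exact (norm_sum_le _ _).trans (le_of_eq (by simp))
  have h2 : ∑ i, ∑ j, ‖M i j‖ * ‖M j i‖ ≤ ∑ i, ∑ j, (‖M i j‖ ^ 2 / 2 + ‖M j i‖ ^ 2 / 2) := by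
    refine Finset.sum_le_sum fun i _ => Finset.sum_le_sum fun j _ => ?_
    nlinarith [sq_nonneg (‖M i j‖ - ‖M j i‖)]
  have h3 : ∑ i, ∑ j, (‖M i j‖ ^ 2 / 2 + ‖M j i‖ ^ 2 / 2) = frob M := by
    simp only [Finset.sum_add_distrib]
    rw [Finset.sum_comm (f := fun i j => ‖M j i‖ ^ 2 / 2)]
    simp only [← Finset.sum_div, frob]
    ring
  linarith

lemma frob_Pmat {K B : Matrix ι ι ℂ} (hKK : Kᴴ * K = 1) {g : Matrix ι ι ℂ}
    (hg : g ∈ Matrix.unitaryGroup ι ℂ) : frob (Pmat K B g) = frob B := by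
  have : ((frob (Pmat K B g) : ℝ) : ℂ) = (frob B : ℝ) := by
    rw [← trace_frob, ← trace_frob, Matrix.trace_mul_comm, Matrix.trace_mul_comm B, Pmat,
      Matrix.conjTranspose_mul, Matrix.mul_assoc, ← Matrix.mul_assoc (Smat K g)ᴴ,
      Smat_unitary hKK hg, Matrix.one_mul]
  exact_mod_cast this

lemma continuous_u (K B : Matrix ι ι ℂ) :
    Continuous fun g : Matrix.unitaryGroup ι ℂ => (Pmat K B g).trace :=
  (continuous_Pmat K B).matrix_trace.comp continuous_subtype_val

lemma continuous_T (K B : Matrix ι ι ℂ) :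
    Continuous fun g : Matrix.unitaryGroup ι ℂ => (Pmat K B g * Pmat K B g).trace :=
  ((continuous_Pmat K B).matrix_mul (continuous_Pmat K B)).matrix_trace.comp continuous_subtype_val

lemma continuous_frobR (K B : Matrix ι ι ℂ) :
    Continuous fun g : Matrix.unitaryGroup ι ℂ => frob (Pmat K B g * Pmat K B g) := by
  have h := ((continuous_Pmat K B).matrix_mul (continuous_Pmat K B)).comp
    (continuous_subtype_val (p := fun g => g ∈ Matrix.unitaryGroup ι ℂ))
  unfold frob
  refine continuous_finsetSum _ fun i _ => continuous_finsetSum _ fun j _ => ?_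
  exact (h.matrix_elem i j).norm.pow 2

lemma est2 (μ : Measure (Matrix.unitaryGroup ι ℂ)) [IsProbabilityMeasure μ]
    [μ.IsMulLeftInvariant] {K B : Matrix ι ι ℂ} (hK : Kᵀ = -K) (hKK : Kᴴ * K = 1) (hB : Bᵀ = -B) :
    ((Fintype.card ι : ℝ) - 1) * ∫ g : Matrix.unitaryGroup ι ℂ, ‖(Pmat K B g).trace‖ ^ 2 ∂μ
      = 2 * frob B := by
  have h := ident2 μ hK hB
  have e : ∀ g : Matrix.unitaryGroup ι ℂ, (((Fintype.card ι : ℂ) - 1) * (Pmat K B g).trace) *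
      star (Pmat K B g).trace + (Pmat K B g * ((-2 : ℂ) • (Pmat K B g)ᴴ)).trace =
      ((((Fintype.card ι : ℝ) - 1) * ‖(Pmat K B g).trace‖ ^ 2 - 2 * frob B : ℝ) : ℂ) := by
    intro g
    rw [Matrix.mul_smul, Matrix.trace_smul, trace_frob, frob_Pmat hKK g.2, mul_assoc]
    have : (Pmat K B g).trace * star (Pmat K B g).trace = (‖(Pmat K B g).trace‖ : ℂ) ^ 2 :=
      Complex.mul_conj' _
    rw [this]; push_cast; simp; ring
  simp_rw [e] at h
  rw [integral_complex_ofReal] at h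
  have h' : ∫ g : Matrix.unitaryGroup ι ℂ, (((Fintype.card ι : ℝ) - 1) * ‖(Pmat K B g).trace‖ ^ 2
    - 2 * frob B) ∂μ = 0 := by exact_mod_cast h
  rw [integral_sub, integral_const_mul] at h'
  · simp at h'; linarith
  · exact integ μ (continuous_const.mul ((continuous_u K B).norm.pow 2))
  · exact integrable_const _

lemma est3 (μ : Measure (Matrix.unitaryGroup ι ℂ)) [IsProbabilityMeasure μ]
    [μ.IsMulLeftInvariant] {K B : Matrix ι ι ℂ} (hK : Kᵀ = -K) (hKK : Kᴴ * K = 1) (hB : Bᵀ = -B) :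
    ((Fintype.card ι : ℝ) - 2) * ∫ g : Matrix.unitaryGroup ι ℂ, ‖(Pmat K B g * Pmat K B g).trace‖ ^ 2 ∂μ
      ≤ frob B * ∫ g : Matrix.unitaryGroup ι ℂ, ‖(Pmat K B g).trace‖ ^ 2 ∂μ + 4 * frob B ^ 2 := by
  have h := ident3 μ hK hB
  have hc1 := continuous_u K B
  have hc2 := continuous_T K B
  have hc3 := continuous_frobR K B
  have e : ∀ g : Matrix.unitaryGroup ι ℂ,
      (((Fintype.card ι : ℂ) - 2) * (Pmat K B g * Pmat K B g).trace
        + (Pmat K B g).trace ^ 2) * star (Pmat K B g * Pmat K B g).trace +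
      (Pmat K B g * Pmat K B g * ((-4 : ℂ) • (Pmat K B g * Pmat K B g)ᴴ)).trace =
      ((((Fintype.card ι : ℝ) - 2) * ‖(Pmat K B g * Pmat K B g).trace‖ ^ 2 : ℝ) : ℂ)
      - (-((Pmat K B g).trace ^ 2 * star (Pmat K B g * Pmat K B g).trace) +
        ((4 * frob (Pmat K B g * Pmat K B g) : ℝ) : ℂ)) := by
    intro g
    rw [Matrix.mul_smul, Matrix.trace_smul, trace_frob, add_mul, mul_assoc]
    have : (Pmat K B g * Pmat K B g).trace * star (Pmat K B g * Pmat K B g).trace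
      = (‖(Pmat K B g * Pmat K B g).trace‖ : ℂ) ^ 2 := Complex.mul_conj' _
    rw [this]; push_cast; simp; ring
  simp_rw [e] at h
  rw [integral_sub, sub_eq_zero, integral_complex_ofReal, integral_const_mul] at h
  · have h1 := congrArg norm h
    have h2 := le_of_eq h1
    rw [Complex.norm_real] at h2
    refine (le_abs_self _).trans (h2.trans ((norm_integral_le_integral_norm _).trans ?_))
    rw [← integral_const_mul]
    have : frob B * 0 = 0 := by simp
    calc _ ≤ ∫ g : Matrix.unitaryGroup ι ℂ, (frob B * ‖(Pmat K B g).trace‖ ^ 2 + 4 * frob B ^ 2) ∂μ := by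
          refine integral_mono (integ μ (by fun_prop)) (integ μ (by fun_prop)) fun g => ?_
          refine (norm_add_le _ _).trans ?_
          rw [norm_neg, norm_mul, norm_pow, norm_star, Complex.norm_real, Real.norm_eq_abs,
            abs_of_nonneg (mul_nonneg (by norm_num) (frob_nonneg _))]
          have a1 := norm_trace_mul_le (Pmat K B g)
          have a2 := frob_mul_le (Pmat K B g) (Pmat K B g)
          rw [frob_Pmat hKK g.2] at a1 a2
          nlinarith [sq_nonneg ‖(Pmat K B g).trace‖]
      _ = _ := by
          rw [integral_add (integ μ (by fun_prop)) (integrable_const _)]; simp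
  · exact integ μ (by fun_prop)
  · exact integ μ (by fun_prop)

lemma estT (μ : Measure (Matrix.unitaryGroup ι ℂ)) [IsProbabilityMeasure μ]
    [μ.IsMulLeftInvariant] {K B : Matrix ι ι ℂ} (hK : Kᵀ = -K) (hKK : Kᴴ * K = 1) (hB : Bᵀ = -B)
    (hN : 3 ≤ Fintype.card ι) :
    ∫ g : Matrix.unitaryGroup ι ℂ, ‖(Pmat K B g * Pmat K B g).trace‖ ∂μ
      ≤ frob B * √(6 / ((Fintype.card ι : ℝ) - 2)) := by
  have hN' : (3:ℝ) ≤ Fintype.card ι := by exact_mod_cast hN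
  have h2 := est2 μ hK hKK hB
  have h3 := est3 μ hK hKK hB
  have hc2 := continuous_T K B
  have hb := frob_nonneg B
  set N : ℝ := (Fintype.card ι : ℝ) with hNdef
  set m := ∫ g : Matrix.unitaryGroup ι ℂ, ‖(Pmat K B g * Pmat K B g).trace‖ ∂μ with hm
  have hm0 : 0 ≤ m := integral_nonneg fun _ => norm_nonneg _
  set q := ∫ g : Matrix.unitaryGroup ι ℂ, ‖(Pmat K B g * Pmat K B g).trace‖ ^ 2 ∂μ with hq
  set w := ∫ g : Matrix.unitaryGroup ι ℂ, ‖(Pmat K B g).trace‖ ^ 2 ∂μ with hw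
  have hw0 : 0 ≤ w := integral_nonneg fun _ => by positivity
  have hvar : m ^ 2 ≤ q := by
    have : 0 ≤ ∫ g : Matrix.unitaryGroup ι ℂ, (‖(Pmat K B g * Pmat K B g).trace‖ - m) ^ 2 ∂μ :=
      integral_nonneg fun _ => sq_nonneg _
    have e : ∫ g : Matrix.unitaryGroup ι ℂ, (‖(Pmat K B g * Pmat K B g).trace‖ - m) ^ 2 ∂μ =
        q - 2 * m * m + m ^ 2 := by
      have : ∀ g : Matrix.unitaryGroup ι ℂ, (‖(Pmat K B g * Pmat K B g).trace‖ - m) ^ 2 =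
        ‖(Pmat K B g * Pmat K B g).trace‖ ^ 2 - 2 * m * ‖(Pmat K B g * Pmat K B g).trace‖ + m ^ 2 :=
        fun g => by ring
      simp_rw [this]
      rw [integral_add (integ μ (by fun_prop)) (integrable_const _),
        integral_sub (integ μ (by fun_prop)) (integ μ (by fun_prop)), integral_const_mul]
      simp [hq, hm]
    nlinarith
  have hwb : w ≤ 2 * frob B := by nlinarith
  have hqb : (N - 2) * q ≤ 6 * frob B ^ 2 := by nlinarith
  have : q ≤ frob B ^ 2 * (6 / (N - 2)) := by
    rw [← mul_div_assoc, le_div_iff₀ (by linarith)]; linarith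
  calc m = √(m ^ 2) := (Real.sqrt_sq hm0).symm
    _ ≤ √(frob B ^ 2 * (6 / (N - 2))) := Real.sqrt_le_sqrt (hvar.trans this)
    _ = _ := by rw [Real.sqrt_mul (sq_nonneg _), Real.sqrt_sq hb]

lemma est1 (μ : Measure (Matrix.unitaryGroup ι ℂ)) [IsProbabilityMeasure μ]
    [μ.IsMulLeftInvariant] {K B : Matrix ι ι ℂ} (hK : Kᵀ = -K) (hKK : Kᴴ * K = 1) (hB : Bᵀ = -B)
    (t : ℝ) :
    ∫ g : Matrix.unitaryGroup ι ℂ, (((Fintype.card ι : ℂ) - 1) * ((Pmat K B g).trace.re : ℂ)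
      + Complex.I * t * (((Pmat K B g * Pmat K B g).trace.re : ℂ) - frob B)) *
      Complex.exp (Complex.I * t * ((Pmat K B g).trace.re : ℂ)) ∂μ = 0 := by
  have hc1 := continuous_u K B
  have hc2 := continuous_T K B
  have key : ∀ t : ℝ, ∫ g : Matrix.unitaryGroup ι ℂ, (((Fintype.card ι : ℂ) - 1) * (Pmat K B g).trace
      + Complex.I * t * ((Pmat K B g * Pmat K B g).trace - frob B)) *
      Complex.exp (Complex.I * t * ((Pmat K B g).trace.re : ℂ)) ∂μ = 0 := by
    intro t
    rw [← ident1 μ hK hB t]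
    refine integral_congr_ae (ae_of_all _ fun g => ?_)
    have e1 : ((Pmat K B g).trace + star (Pmat K B g).trace) / 2 = ((Pmat K B g).trace.re : ℂ) :=
      (Complex.re_eq_add_conj _).symm
    simp only [e1]
    rw [Matrix.mul_smul, Matrix.trace_smul, Matrix.mul_sub, Matrix.trace_sub, trace_frob,
      frob_Pmat hKK g.2, smul_eq_mul]
    ring
  have k1 := key t
  have k2 := congrArg (starRingEnd ℂ) (key (-t))
  rw [← integral_conj, map_zero] at k2
  have k3 : ∫ g : Matrix.unitaryGroup ι ℂ, (((Fintype.card ι : ℂ) - 1) * star (Pmat K B g).trace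
      + Complex.I * t * (star (Pmat K B g * Pmat K B g).trace - frob B)) *
      Complex.exp (Complex.I * t * ((Pmat K B g).trace.re : ℂ)) ∂μ = 0 := by
    rw [← k2]
    refine integral_congr_ae (ae_of_all _ fun g => ?_)
    simp [← Complex.exp_conj]
  have k4 := congrArg₂ (fun a b : ℂ => (a + b) / 2) k1 k3
  beta_reduce at k4
  rw [← integral_add (integ μ (by fun_prop)) (integ μ (by fun_prop)), ← integral_div] at k4
  rw [← (show ((0:ℂ) + 0) / 2 = 0 by simp), ← k4]
  refine integral_congr_ae (ae_of_all _ fun g => ?_)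
  simp only [Complex.re_eq_add_conj]
  simp only [Complex.star_def]
  ring

lemma charfun_est (μ : Measure (Matrix.unitaryGroup ι ℂ)) [IsProbabilityMeasure μ]
    [μ.IsMulLeftInvariant] {K B : Matrix ι ι ℂ} (hK : Kᵀ = -K) (hKK : Kᴴ * K = 1) (hB : Bᵀ = -B)
    (hN : 3 ≤ Fintype.card ι) :
    ‖∫ g : Matrix.unitaryGroup ι ℂ, Complex.exp (Complex.I * ((Pmat K B g).trace.re : ℂ)) ∂μ
      - Complex.exp (-((frob B / ((Fintype.card ι : ℝ) - 1) : ℝ) : ℂ) / 2)‖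
      ≤ frob B / ((Fintype.card ι : ℝ) - 1) * √(6 / ((Fintype.card ι : ℝ) - 2)) := by
  have hN' : (3:ℝ) ≤ Fintype.card ι := by exact_mod_cast hN
  have hc1 := continuous_u K B
  have hc2 := continuous_T K B
  have hT := estT μ hK hKK hB hN
  have h1 := est1 μ hK hKK hB
  have hb := frob_nonneg B
  set N : ℝ := (Fintype.card ι : ℝ) with hNdef
  have hNC : (Fintype.card ι : ℂ) = (N : ℂ) := by simp [hNdef]
  have hN1 : (N : ℂ) - 1 ≠ 0 := by
    have : (N - 1 : ℝ) ≠ 0 := by linarith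
    exact_mod_cast this
  set b := frob B with hbdef
  set v : ℝ := b / (N - 1) with hv
  let e : ℝ → Matrix.unitaryGroup ι ℂ → ℂ := fun t g =>
    Complex.exp (Complex.I * t * ((Pmat K B g).trace.re : ℂ))
  have he : ∀ t g, ‖e t g‖ = 1 := by
    intro t g
    have : Complex.I * t * ((Pmat K B g).trace.re : ℂ)
        = ((t * (Pmat K B g).trace.re : ℝ) : ℂ) * Complex.I := by push_cast; ring
    simp only [e, this, Complex.norm_exp_ofReal_mul_I]
  have hec : ∀ t, Continuous (e t) := by intro t; simp only [e]; fun_prop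
  let φ : ℝ → ℂ := fun t => ∫ g, e t g ∂μ
  let τ : ℝ → ℂ := fun t => ∫ g, ((Pmat K B g * Pmat K B g).trace.re : ℂ) * e t g ∂μ
  have hφ : ∀ t, HasDerivAt φ (∫ g, e t g * (Complex.I * ((Pmat K B g).trace.re : ℂ)) ∂μ) t := by
    intro t
    refine (hasDerivAt_integral_of_dominated_loc_of_deriv_le (μ := μ) (𝕜 := ℝ) (x₀ := t)
      (s := Set.univ) (F := e) (F' := fun t g => e t g * (Complex.I * ((Pmat K B g).trace.re : ℂ)))
      (bound := fun g => ‖(((Pmat K B g).trace.re : ℝ) : ℂ)‖)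
      Filter.univ_mem (Eventually.of_forall fun s => (hec s).measurable.aestronglyMeasurable)
      (integ μ (hec t)) ?_ (ae_of_all _ fun g s _ => ?_) (integ μ (by fun_prop))
      (ae_of_all _ fun g s _ => ?_)).2
    · have := hec t
      exact (integ μ (by fun_prop)).aestronglyMeasurable
    · rw [norm_mul, he, norm_mul, Complex.norm_I, one_mul, one_mul]
    · have d0 : HasDerivAt (fun s : ℝ => (s : ℂ)) 1 s := Complex.ofRealCLM.hasDerivAt
      have := ((d0.const_mul Complex.I).mul_const ((Pmat K B g).trace.re : ℂ)).cexp
      simpa [e] using this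
  have hφ' : ∀ t : ℝ, (∫ g, e t g * (Complex.I * ((Pmat K B g).trace.re : ℂ)) ∂μ)
      = t / (N - 1) * τ t - t * v * φ t := by
    intro t
    have h2 := h1 t
    have het := hec t
    have e1 : ∀ g : Matrix.unitaryGroup ι ℂ,
      (((Fintype.card ι : ℂ) - 1) * ((Pmat K B g).trace.re : ℂ)
      + Complex.I * t * (((Pmat K B g * Pmat K B g).trace.re : ℂ) - b)) *
      Complex.exp (Complex.I * t * ((Pmat K B g).trace.re : ℂ)) =
      (-Complex.I * (N - 1)) * (e t g * (Complex.I * ((Pmat K B g).trace.re : ℂ))) +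
      (Complex.I * t) * (((Pmat K B g * Pmat K B g).trace.re : ℂ) * e t g)
      - (Complex.I * t * b) * e t g := by
      intro g
      rw [hNC]
      simp only [e]
      linear_combination ((N - 1) * ((Pmat K B g).trace.re : ℂ) *
        Complex.exp (Complex.I * t * ((Pmat K B g).trace.re : ℂ))) * Complex.I_mul_I
    simp_rw [e1] at h2
    rw [integral_sub, integral_add, integral_const_mul, integral_const_mul, integral_const_mul] at h2
    · change -Complex.I * (N - 1) * _ + Complex.I * t * τ t - Complex.I * t * b * φ t = 0 at h2
      have hvC : (v : ℂ) = b / (N - 1) := by rw [hv]; push_cast; ring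
      rw [hvC]
      generalize (∫ g, e t g * (Complex.I * ((Pmat K B g).trace.re : ℂ)) ∂μ) = Z at h2 ⊢
      field_simp
      have := mul_left_cancel₀ Complex.I_ne_zero (a := Complex.I)
        (b := (N - 1) * Z)
        (c := t * τ t - t * b * φ t) (by linear_combination -h2)
      linear_combination this
    · exact integ μ (by fun_prop)
    · exact integ μ (by fun_prop)
    · exact integ μ (by fun_prop)
    · exact integ μ (by fun_prop)
  have hτ : ∀ t, ‖τ t‖ ≤ b * √(6 / (N - 2)) := by
    intro t
    refine (norm_integral_le_integral_norm _).trans (le_trans ?_ hT)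
    have het := hec t
    refine integral_mono (integ μ (by fun_prop)) (integ μ (by fun_prop)) fun g => ?_
    simp only [norm_mul, he, mul_one, Complex.norm_real]
    exact Complex.abs_re_le_norm _
  have hψ : ∀ t : ℝ, HasDerivAt (fun t : ℝ => φ t * Complex.exp ((v : ℂ) * (t:ℂ) ^ 2 / 2))
      (t / (N - 1) * τ t * Complex.exp ((v : ℂ) * (t:ℂ) ^ 2 / 2)) t := by
    intro t
    have d0 : HasDerivAt (fun s : ℝ => (s : ℂ)) 1 t := Complex.ofRealCLM.hasDerivAt
    have d1 := (((d0.fun_pow 2).const_mul (v : ℂ)).div_const 2).cexp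
    refine ((hφ t).fun_mul d1).congr_deriv ?_
    rw [hφ']
    push_cast
    ring
  have hseg := norm_image_sub_le_of_norm_deriv_le_segment_01'
    (f := fun t : ℝ => φ t * Complex.exp ((v : ℂ) * (t:ℂ) ^ 2 / 2))
    (C := b * √(6 / (N - 2)) / (N - 1) * Real.exp (v / 2))
    (fun x _ => (hψ x).hasDerivWithinAt) (fun x hx => by
      have hv0 : 0 ≤ v := div_nonneg hb (by linarith)
      have a1 : ‖Complex.exp ((v : ℂ) * (x:ℂ) ^ 2 / 2)‖ ≤ Real.exp (v / 2) := by
        rw [Complex.norm_exp]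
        have : ((v : ℂ) * (x:ℂ) ^ 2 / 2).re = v * x ^ 2 / 2 := by
          have : (v : ℂ) * (x:ℂ) ^ 2 / 2 = ((v * x ^ 2 / 2 : ℝ) : ℂ) := by push_cast; ring
          rw [this, Complex.ofReal_re]
        rw [this]
        apply Real.exp_le_exp.mpr
        have := hx.1; have := hx.2
        have : x ^ 2 ≤ 1 := by nlinarith
        nlinarith
      have a2 : ‖(x : ℂ) / (N - 1)‖ ≤ 1 / (N - 1) := by
        have : (x : ℂ) / (N - 1) = ((x / (N - 1) : ℝ) : ℂ) := by push_cast; ring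
        rw [this, Complex.norm_real, Real.norm_eq_abs, abs_of_nonneg (div_nonneg hx.1 (by linarith))]
        have := hx.2
        have : 0 < N - 1 := by linarith
        gcongr
      rw [norm_mul, norm_mul]
      have : 0 ≤ 1 / (N - 1) := div_nonneg zero_le_one (by linarith)
      calc _ ≤ 1 / (N - 1) * (b * √(6 / (N - 2))) * Real.exp (v / 2) := by
            gcongr
            exact hτ x
        _ = _ := by ring)
  have p1 : φ 1 = ∫ g : Matrix.unitaryGroup ι ℂ,
      Complex.exp (Complex.I * ((Pmat K B g).trace.re : ℂ)) ∂μ := by simp [φ, e]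
  have p0 : φ 0 = 1 := by simp [φ, e]
  rw [← p1]
  simp only [p0] at hseg
  have q1 : φ 1 - Complex.exp (-(v : ℂ) / 2) =
      (φ 1 * Complex.exp ((v : ℂ) * ((1:ℝ):ℂ) ^ 2 / 2)
        - 1 * Complex.exp ((v : ℂ) * ((0:ℝ):ℂ) ^ 2 / 2)) * Complex.exp (-(v : ℂ) / 2) := by
    have : Complex.exp ((v : ℂ) / 2) * Complex.exp (-(v : ℂ) / 2) = 1 := by
      rw [← Complex.exp_add]; simp [neg_div]
    simp
    linear_combination (-φ 1) * this
  have q2 : ‖Complex.exp (-(v : ℂ) / 2)‖ = Real.exp (-(v / 2)) := by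
    have : (-(v : ℂ) / 2) = ((-(v / 2) : ℝ) : ℂ) := by push_cast; ring
    rw [this, Complex.norm_exp, Complex.ofReal_re]
  rw [q1, norm_mul, q2]
  calc _ ≤ (b * √(6 / (N - 2)) / (N - 1) * Real.exp (v / 2)) * Real.exp (-(v / 2)) := by
        gcongr
    _ = b * √(6 / (N - 2)) / (N - 1) * (Real.exp (v / 2) * Real.exp (-(v / 2))) := by ring
    _ = _ := by rw [← Real.exp_add]; simp [hv]; ring

end Helpers

section Final

lemma Jmat_transpose (n : ℕ) : (Jmat n)ᵀ = -Jmat n := by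
  simp [Jmat, Matrix.fromBlocks_transpose, Matrix.fromBlocks_neg]

lemma Jmat_conjTranspose (n : ℕ) : (Jmat n)ᴴ = -Jmat n := by
  simp [Jmat, Matrix.fromBlocks_conjTranspose, Matrix.fromBlocks_neg]

lemma Jmat_sq (n : ℕ) : Jmat n * Jmat n = -1 := by
  simp only [Jmat, Matrix.fromBlocks_multiply]
  rw [← Matrix.fromBlocks_one, Matrix.fromBlocks_neg]
  simp

/-- The linear combination `∑ t ν • A ν n`. -/
noncomputable def combo {r : ℕ} (A : Fin r → (n : ℕ) → Matrix (Fin n ⊕ Fin n) (Fin n ⊕ Fin n) ℂ)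
    (t : Fin r → ℝ) (n : ℕ) : Matrix (Fin n ⊕ Fin n) (Fin n ⊕ Fin n) ℂ :=
  ∑ ν, (t ν : ℂ) • A ν n

lemma combo_anti {r : ℕ} (A : Fin r → (n : ℕ) → Matrix (Fin n ⊕ Fin n) (Fin n ⊕ Fin n) ℂ)
    (hA : ∀ ν n, (A ν n * Jmat n)ᵀ = -(A ν n * Jmat n)) (t : Fin r → ℝ) (n : ℕ) :
    (Jmat n * combo A t n)ᵀ = -(Jmat n * combo A t n) := by
  have h1 : ∀ ν, (Jmat n * A ν n)ᵀ = -(Jmat n * A ν n) := by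
    intro ν
    have h := hA ν n
    rw [Matrix.transpose_mul, Jmat_transpose, Matrix.neg_mul, neg_inj] at h
    rw [Matrix.transpose_mul, Jmat_transpose, Matrix.mul_neg, neg_inj]
    have h2 := congrArg (fun M => Jmat n * M * Jmat n) h
    beta_reduce at h2
    rw [← Matrix.mul_assoc, Jmat_sq, ← Matrix.mul_assoc, Matrix.mul_assoc (Jmat n * A ν n),
      Jmat_sq] at h2
    simpa using h2
  simp only [combo, Matrix.mul_sum, Matrix.transpose_sum, Matrix.mul_smul, Matrix.transpose_smul, h1,
    smul_neg, Finset.sum_neg_distrib]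

lemma frob_combo {r : ℕ} (A : Fin r → (n : ℕ) → Matrix (Fin n ⊕ Fin n) (Fin n ⊕ Fin n) ℂ)
    (t : Fin r → ℝ) (n : ℕ) :
    frob (Jmat n * combo A t n) = ∑ i, ∑ j, t i * ((A i n * (A j n)ᴴ).trace.re) * t j := by
  have h1 := congrArg Complex.re (trace_frob (Jmat n * combo A t n))
  rw [Complex.ofReal_re] at h1
  rw [← h1, Matrix.conjTranspose_mul, Jmat_conjTranspose, Matrix.trace_mul_comm]
  have h2 : (combo A t n)ᴴ * -Jmat n * (Jmat n * combo A t n) = (combo A t n)ᴴ * combo A t n := by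
    rw [Matrix.mul_assoc, ← Matrix.mul_assoc (-Jmat n), Matrix.neg_mul, Jmat_sq]; simp
  rw [h2, Matrix.trace_mul_comm]
  simp only [combo, Matrix.conjTranspose_sum, Matrix.conjTranspose_smul, Matrix.sum_mul,
    Matrix.mul_sum, Matrix.trace_sum, Complex.re_sum, Matrix.smul_mul, Matrix.mul_smul,
    Matrix.trace_smul, Finset.smul_sum]
  conv_rhs => rw [Finset.sum_comm]
  refine Finset.sum_congr rfl fun i _ => Finset.sum_congr rfl fun j _ => ?_
  simp
  ring

lemma trace_combo {r : ℕ} (A : Fin r → (n : ℕ) → Matrix (Fin n ⊕ Fin n) (Fin n ⊕ Fin n) ℂ)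
    (t : Fin r → ℝ) (n : ℕ) (g : Matrix (Fin n ⊕ Fin n) (Fin n ⊕ Fin n) ℂ) :
    ∑ ν, t ν * (A ν n * (g * (Jmat n)ᵀ * gᵀ * Jmat n)).trace.re =
      (Pmat (Jmat n)ᵀ (Jmat n * combo A t n) g).trace.re := by
  have h1 : ∀ ν, (A ν n * (g * (Jmat n)ᵀ * gᵀ * Jmat n)).trace =
      (Smat (Jmat n)ᵀ g * (Jmat n * A ν n)).trace := by
    intro ν
    rw [Matrix.trace_mul_comm, Smat, ← Matrix.mul_assoc]
  simp only [h1, Pmat, combo, Matrix.mul_sum, Matrix.mul_smul, Matrix.trace_sum, Matrix.trace_smul,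
    Complex.re_sum]
  simp

lemma frob_tendsto {r : ℕ} (A : Fin r → (n : ℕ) → Matrix (Fin n ⊕ Fin n) (Fin n ⊕ Fin n) ℂ)
    (c : Matrix (Fin r) (Fin r) ℝ)
    (hc : ∀ μ' ν, Tendsto
      (fun n : ℕ => (1 / (2 * (n : ℝ))) * ((A μ' n * (A ν n)ᴴ).trace.re))
      atTop (𝓝 (c μ' ν))) (t : Fin r → ℝ) :
    Tendsto (fun n : ℕ => (1 / (2 * (n : ℝ))) * frob (Jmat n * combo A t n)) atTop
      (𝓝 (∑ i, ∑ j, t i * c i j * t j)) := by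
  have h : (fun n : ℕ => (1 / (2 * (n : ℝ))) * frob (Jmat n * combo A t n)) =
      fun n : ℕ => ∑ i, ∑ j, t i * ((1 / (2 * (n : ℝ))) * ((A i n * (A j n)ᴴ).trace.re)) * t j := by
    funext n
    rw [frob_combo, Finset.mul_sum]
    refine Finset.sum_congr rfl fun i _ => ?_
    rw [Finset.mul_sum]
    refine Finset.sum_congr rfl fun j _ => ?_
    ring
  rw [h]
  exact tendsto_finsetSum _ fun i _ => tendsto_finsetSum _ fun j _ =>
    ((hc i j).const_mul _).mul_const _

lemma quad_eq {r : ℕ} (c : Matrix (Fin r) (Fin r) ℝ) (t : Fin r → ℝ) :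
    t ⬝ᵥ c *ᵥ t = ∑ i, ∑ j, t i * c i j * t j := by
  simp only [dotProduct, Matrix.mulVec, Finset.mul_sum, mul_assoc]

lemma c_posSemidef {r : ℕ} (A : Fin r → (n : ℕ) → Matrix (Fin n ⊕ Fin n) (Fin n ⊕ Fin n) ℂ)
    (c : Matrix (Fin r) (Fin r) ℝ)
    (hc : ∀ μ' ν, Tendsto
      (fun n : ℕ => (1 / (2 * (n : ℝ))) * ((A μ' n * (A ν n)ᴴ).trace.re))
      atTop (𝓝 (c μ' ν))) : c.PosSemidef := by
  refine Matrix.PosSemidef.of_dotProduct_mulVec_nonneg ?_ ?_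
  · ext i j
    simp only [Matrix.conjTranspose_apply, star_trivial]
    refine tendsto_nhds_unique (hc j i) ?_
    convert hc i j using 3 with n
    rw [← Complex.conj_re, ← Complex.star_def, ← Matrix.trace_conjTranspose]
    simp
  · intro t
    rw [star_trivial, quad_eq]
    exact ge_of_tendsto' (frob_tendsto A c hc t) fun n =>
      mul_nonneg (by positivity) (frob_nonneg _)

lemma charfun_tendsto {r : ℕ} (A : Fin r → (n : ℕ) → Matrix (Fin n ⊕ Fin n) (Fin n ⊕ Fin n) ℂ)
    (hA : ∀ ν n, (A ν n * Jmat n)ᵀ = -(A ν n * Jmat n))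
    (c : Matrix (Fin r) (Fin r) ℝ)
    (hc : ∀ μ' ν, Tendsto
      (fun n : ℕ => (1 / (2 * (n : ℝ))) * ((A μ' n * (A ν n)ᴴ).trace.re))
      atTop (𝓝 (c μ' ν)))
    (μ : (n : ℕ) → Measure (Matrix.unitaryGroup (Fin n ⊕ Fin n) ℂ))
    (hprob : ∀ n, IsProbabilityMeasure (μ n))
    (hinv : ∀ n, (μ n).IsMulLeftInvariant) (t : Fin r → ℝ) :
    Tendsto (fun n : ℕ => ∫ g : Matrix.unitaryGroup (Fin n ⊕ Fin n) ℂ, Complex.exp (Complex.I *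
      ((Pmat (Jmat n)ᵀ (Jmat n * combo A t n) g).trace.re : ℂ)) ∂(μ n)) atTop
      (𝓝 (Complex.exp (-((∑ i, ∑ j, t i * c i j * t j : ℝ) : ℂ) / 2))) := by
  set σ := ∑ i, ∑ j, t i * c i j * t j with hσ
  have hcard : ∀ n : ℕ, (Fintype.card (Fin n ⊕ Fin n) : ℝ) = 2 * n := by
    intro n; simp; ring
  have hinvn : Tendsto (fun n : ℕ => ((n : ℝ))⁻¹) atTop (𝓝 0) := tendsto_inv_atTop_nhds_zero_nat
  let v : ℕ → ℝ := fun n => frob (Jmat n * combo A t n) / (2 * n - 1)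
  have hv : Tendsto v atTop (𝓝 σ) := by
    have h1 : Tendsto (fun n : ℕ => (1 - (n:ℝ)⁻¹ / 2)⁻¹) atTop (𝓝 1) := by
      have := ((hinvn.div_const 2).const_sub 1).inv₀ (by norm_num)
      simpa using this
    have h2 := (frob_tendsto A c hc t).mul h1
    rw [mul_one] at h2
    refine h2.congr' ?_
    filter_upwards [eventually_ge_atTop 1] with n hn
    have hn' : (1:ℝ) ≤ n := by exact_mod_cast hn
    have : (2 * (n:ℝ) - 1) ≠ 0 := by linarith
    have h0 : (n : ℝ) ≠ 0 := by linarith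
    have e1 : 1 - (n:ℝ)⁻¹ / 2 = (2 * n - 1) / (2 * n) := by field_simp
    simp only [v]
    rw [e1]
    field_simp
  have hr : Tendsto (fun n : ℕ => √(6 / (2 * (n:ℝ) - 2))) atTop (𝓝 0) := by
    have : Tendsto (fun n : ℕ => 6 / (2 * (n:ℝ) - 2)) atTop (𝓝 0) := by
      apply Tendsto.div_atTop tendsto_const_nhds
      exact tendsto_atTop_add_const_right _ _
        (tendsto_natCast_atTop_atTop.const_mul_atTop (by norm_num : (0:ℝ) < 2))
    simpa using this.sqrt
  have hE : Tendsto (fun n : ℕ => Complex.exp (-(v n : ℂ) / 2)) atTop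
      (𝓝 (Complex.exp (-(σ : ℂ) / 2))) := by
    have hcont : Continuous fun x : ℝ => Complex.exp (-(x : ℂ) / 2) := by fun_prop
    exact (hcont.tendsto σ).comp hv
  have hdiff : Tendsto (fun n : ℕ => (∫ g : Matrix.unitaryGroup (Fin n ⊕ Fin n) ℂ,
      Complex.exp (Complex.I *
      ((Pmat (Jmat n)ᵀ (Jmat n * combo A t n) g).trace.re : ℂ)) ∂(μ n))
      - Complex.exp (-(v n : ℂ) / 2)) atTop (𝓝 0) := by
    refine squeeze_zero_norm' (a := fun n => v n * √(6 / (2 * (n:ℝ) - 2))) ?_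
      (by simpa using hv.mul hr)
    filter_upwards [eventually_ge_atTop 2] with n hn
    have h3 : 3 ≤ Fintype.card (Fin n ⊕ Fin n) := by simp; omega
    have := hprob n
    have := hinv n
    have hK : ((Jmat n)ᵀ)ᵀ = -(Jmat n)ᵀ := by rw [Jmat_transpose]; simp [Jmat_transpose]
    have hKK : ((Jmat n)ᵀ)ᴴ * (Jmat n)ᵀ = 1 := by
      rw [Jmat_transpose]; simp [Jmat_conjTranspose, Jmat_sq]
    have key := charfun_est (μ n) hK hKK (combo_anti A hA t n) h3
    rw [hcard] at key
    exact key
  simpa using hdiff.add hE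

end Final

/-- Borel theorem for the class AII symmetric space `U(2n)/Sp(2n)`:
with `V = g Jᵀ gᵀ J` for `g` Haar distributed on `U(2n)` and parameter matrices
`A^{(ν,n)}` satisfying `(A J)ᵀ = -(A J)`, the vector `(Re Tr(A^{(ν,n)} V))_ν`
converges in distribution to the centered Gaussian with covariances
`c μ ν = lim (1/(2n)) Re Tr(A^{(μ,n)} (A^{(ν,n)})^*)`. -/
theorem borel_theorem_AII
    (r : ℕ) (hr : 1 ≤ r)
    (A : Fin r → (n : ℕ) → Matrix (Fin n ⊕ Fin n) (Fin n ⊕ Fin n) ℂ)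
    (hA : ∀ ν n, (A ν n * Jmat n)ᵀ = -(A ν n * Jmat n))
    (c : Matrix (Fin r) (Fin r) ℝ)
    (hc : ∀ μ' ν, Tendsto
      (fun n : ℕ => (1 / (2 * (n : ℝ))) * ((A μ' n * (A ν n)ᴴ).trace.re))
      atTop (𝓝 (c μ' ν)))
    (hpos : ∀ ν, 0 < c ν ν)
    (μ : (n : ℕ) → Measure (Matrix.unitaryGroup (Fin n ⊕ Fin n) ℂ))
    (hprob : ∀ n, IsProbabilityMeasure (μ n))
    (hinv : ∀ n, (μ n).IsMulLeftInvariant) :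
    ∃ γ : Measure (Fin r → ℝ), IsGaussianMeasure γ 0 c ∧
      ∀ f : BoundedContinuousFunction (Fin r → ℝ) ℝ,
        Tendsto
          (fun n : ℕ => ∫ g, f (fun ν =>
            ((A ν n * ((g : Matrix (Fin n ⊕ Fin n) (Fin n ⊕ Fin n) ℂ)
              * (Jmat n)ᵀ
              * (g : Matrix (Fin n ⊕ Fin n) (Fin n ⊕ Fin n) ℂ)ᵀ
              * Jmat n)).trace.re)) ∂ μ n)
          atTop (𝓝 (∫ x, f x ∂ γ)) := by
  classical
  have hcp := c_posSemidef A c hc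
  let G : Measure (EuclideanSpace ℝ (Fin r)) := multivariateGaussian 0 c
  have hG : ∀ t : EuclideanSpace ℝ (Fin r), charFun G t =
      Complex.exp (-((∑ i, ∑ j, t i * c i j * t j : ℝ) : ℂ) / 2) := by
    intro t
    rw [charFun_multivariateGaussian hcp]
    have := quad_eq c (fun i => t i)
    rw [← this]
    simp [neg_div]
  let X : (n : ℕ) → Matrix.unitaryGroup (Fin n ⊕ Fin n) ℂ → Fin r → ℝ := fun n g ν =>
    ((A ν n * ((g : Matrix (Fin n ⊕ Fin n) (Fin n ⊕ Fin n) ℂ)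
              * (Jmat n)ᵀ
              * (g : Matrix (Fin n ⊕ Fin n) (Fin n ⊕ Fin n) ℂ)ᵀ
              * Jmat n)).trace.re)
  have hX : ∀ n, Continuous (X n) := by
    intro n
    refine continuous_pi fun ν => Complex.continuous_re.comp (Continuous.matrix_trace ?_)
    have h0 : Continuous fun g : Matrix.unitaryGroup (Fin n ⊕ Fin n) ℂ =>
      (g : Matrix (Fin n ⊕ Fin n) (Fin n ⊕ Fin n) ℂ) := continuous_subtype_val
    exact continuous_const.matrix_mul (((h0.matrix_mul continuous_const).matrix_mul
      h0.matrix_transpose).matrix_mul continuous_const)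
  have hX2 : ∀ n, Measurable (fun g => WithLp.toLp 2 (X n g) :
      _ → EuclideanSpace ℝ (Fin r)) := fun n =>
    ((PiLp.continuous_toLp 2 _).comp (hX n)).measurable
  have hofLp : Measurable (WithLp.ofLp : EuclideanSpace ℝ (Fin r) → Fin r → ℝ) :=
    (PiLp.continuous_ofLp 2 _).measurable
  let νs : ℕ → ProbabilityMeasure (EuclideanSpace ℝ (Fin r)) := fun n =>
    ⟨(μ n).map (fun g => WithLp.toLp 2 (X n g)),
      Measure.isProbabilityMeasure_map (hX2 n).aemeasurable⟩
  let G0 : ProbabilityMeasure (EuclideanSpace ℝ (Fin r)) := ⟨G, inferInstance⟩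
  have hconv : Tendsto νs atTop (𝓝 G0) := by
    apply ProbabilityMeasure.tendsto_of_tendsto_charFun
    intro t
    change Tendsto _ _ (𝓝 (charFun G t))
    rw [hG]
    refine (charfun_tendsto A hA c hc μ hprob hinv (fun i => t i)).congr fun n => ?_
    change _ = charFun ((μ n).map (fun g => WithLp.toLp 2 (X n g))) t
    rw [charFun_apply, integral_map (hX2 n).aemeasurable (by fun_prop)]
    refine integral_congr_ae (ae_of_all _ fun g => ?_)
    simp only
    rw [← trace_combo, mul_comm]
    congr 3
  refine ⟨G.map WithLp.ofLp, ⟨Measure.isProbabilityMeasure_map hofLp.aemeasurable, ?_⟩, ?_⟩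
  · intro t
    have hm : Measurable fun x : Fin r → ℝ => ∑ i, t i * x i := by fun_prop
    have hσ : 0 ≤ ∑ i, ∑ j, t i * c i j * t j := by
      rw [← quad_eq]; simpa using hcp.dotProduct_mulVec_nonneg t
    rw [Measure.map_map hm hofLp]
    have : IsProbabilityMeasure (G.map ((fun x : Fin r → ℝ => ∑ i, t i * x i) ∘ WithLp.ofLp)) :=
      Measure.isProbabilityMeasure_map (hm.comp hofLp).aemeasurable
    apply Measure.ext_of_charFun
    funext s
    rw [charFun_gaussianReal, charFun_apply,
      integral_map (hm.comp hofLp).aemeasurable (by fun_prop)]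
    have h1 := hG (WithLp.toLp 2 (fun i => s * t i))
    rw [charFun_apply] at h1
    have h2 : ∀ x : EuclideanSpace ℝ (Fin r),
        inner ℝ (((fun x : Fin r → ℝ => ∑ i, t i * x i) ∘ WithLp.ofLp) x) s =
        inner ℝ x (WithLp.toLp 2 (fun i => s * t i) : EuclideanSpace ℝ (Fin r)) := by
      intro x
      simp [PiLp.inner_apply, Finset.mul_sum]
      refine Finset.sum_congr rfl fun i _ => ?_
      ring
    simp_rw [h2]
    rw [h1]
    congr 1
    have h3 : ∑ i, ∑ j, (s * t i) * c i j * (s * t j) = s ^ 2 * ∑ i, ∑ j, t i * c i j * t j := by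
      simp only [Finset.mul_sum]
      refine Finset.sum_congr rfl fun i _ => Finset.sum_congr rfl fun j _ => ?_
      ring
    have h4 : ((Real.toNNReal (∑ i, ∑ j, t i * c i j * t j) : ℝ) : ℂ) =
        ((∑ i, ∑ j, t i * c i j * t j : ℝ) : ℂ) := by
      rw [Real.coe_toNNReal _ hσ]
    simp only [h3, h4, Pi.zero_apply, mul_zero, Finset.sum_const_zero, Complex.ofReal_zero,
      Complex.ofReal_mul, Complex.ofReal_pow]
    ring
  · intro f
    rw [ProbabilityMeasure.tendsto_iff_forall_integral_tendsto] at hconv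
    have h := hconv (f.compContinuous ⟨WithLp.ofLp, PiLp.continuous_ofLp 2 _⟩)
    have e0 : ∫ x, f x ∂(G.map WithLp.ofLp) = ∫ x, f (WithLp.ofLp x) ∂G :=
      integral_map hofLp.aemeasurable f.continuous.aestronglyMeasurable
    rw [e0]
    refine Tendsto.congr (fun n => ?_) h
    change ∫ x, f (WithLp.ofLp x) ∂((μ n).map (fun g => WithLp.toLp 2 (X n g))) = _
    exact integral_map (hX2 n).aemeasurable
      (f := fun x : EuclideanSpace ℝ (Fin r) => f (WithLp.ofLp x))
      (f.continuous.comp (PiLp.continuous_ofLp 2 _)).aestronglyMeasurable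
end
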